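/- Let r > 0, θ ∈ ℝ, σ > 0, and let h : ℝ → ℝ be Lipschitz with constant L ≥ 0. Let f_h be the solution of the VG(r,θ,σ,0) Stein equation with test function h. Then for every x ≠ 0, every function g : ℝ → ℝ such that f_h has derivative g(y) at every y ≠ 0 in some neighborhood of x, and every d ∈ ℝ such that g has derivative d at x, one has |d| ≤ (1/σ²)·(2/(r+1) + A(r+1,θ,σ))·{1 + (2 + θ²/σ²)·C(r,θ,σ)}·L. -/

import Mathlib

open MeasureTheory Real Filter

/-- Modified Bessel function of the second kind. -/
noncomputable def besselK (ν x : ℝ) : ℝ :=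
  ∫ t in Set.Ioi (0:ℝ), Real.exp (-x * Real.cosh t) * Real.cosh (ν * t)

/-- Modified Bessel function of the first kind. -/
noncomputable def besselI (ν x : ℝ) : ℝ :=
  ∑' k : ℕ, (x / 2) ^ (ν + 2 * (k : ℝ)) / (Real.Gamma (ν + (k : ℝ) + 1) * (Nat.factorial k))

/-- The VG(r,θ,σ,0) density. -/
noncomputable def vgDensity (r θ σ x : ℝ) : ℝ :=
  (σ * Real.sqrt Real.pi * Real.Gamma (r / 2))⁻¹ * Real.exp (θ * x / σ ^ 2) *
    (|x| / (2 * Real.sqrt (θ ^ 2 + σ ^ 2))) ^ ((r - 1) / 2) *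
    besselK ((r - 1) / 2) (Real.sqrt (θ ^ 2 + σ ^ 2) * |x| / σ ^ 2)

/-- The centred test function h̃(x) = h(x) − E h(Z). -/
noncomputable def htilde (r θ σ : ℝ) (h : ℝ → ℝ) (x : ℝ) : ℝ :=
  h x - ∫ t, h t * vgDensity r θ σ t

/-- The solution of the VG(r,θ,σ,0) Stein equation with test function h. -/
noncomputable def steinSolution (r θ σ : ℝ) (h : ℝ → ℝ) (x : ℝ) : ℝ :=
  -(Real.exp (-(θ / σ ^ 2) * x) *
      besselK ((r - 1) / 2) (Real.sqrt (θ ^ 2 + σ ^ 2) / σ ^ 2 * |x|) /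
      (σ ^ 2 * |x| ^ ((r - 1) / 2))) *
    (∫ t in (0:ℝ)..x, Real.exp ((θ / σ ^ 2) * t) * |t| ^ ((r - 1) / 2) *
      besselI ((r - 1) / 2) (Real.sqrt (θ ^ 2 + σ ^ 2) / σ ^ 2 * |t|) * htilde r θ σ h t) -
  (Real.exp (-(θ / σ ^ 2) * x) *
      besselI ((r - 1) / 2) (Real.sqrt (θ ^ 2 + σ ^ 2) / σ ^ 2 * |x|) /
      (σ ^ 2 * |x| ^ ((r - 1) / 2))) *
    (∫ t in Set.Ioi x, Real.exp ((θ / σ ^ 2) * t) * |t| ^ ((r - 1) / 2) *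
      besselK ((r - 1) / 2) (Real.sqrt (θ ^ 2 + σ ^ 2) / σ ^ 2 * |t|) * htilde r θ σ h t)

/-- The constant A(r,θ,σ). -/
noncomputable def Aconst (r θ σ : ℝ) : ℝ :=
  if 2 ≤ r then 2 * Real.sqrt Real.pi / Real.sqrt (2 * r - 1) * (1 + θ ^ 2 / σ ^ 2) ^ (r / 2)
  else 12 * Real.Gamma (r / 2) * (1 + θ ^ 2 / σ ^ 2)

/-- The constant B(r,θ,σ). -/
noncomputable def Bconst (r θ σ : ℝ) : ℝ :=
  if 2 ≤ r then Real.sqrt (Real.pi * (r - 1) / 2) * (1 + θ ^ 2 / σ ^ 2) ^ (r / 2 - 1)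
  else 2

/-- The constant C(r,θ,σ). -/
noncomputable def Cconst (r θ σ : ℝ) : ℝ :=
  6 + 2 * Real.sqrt 2 / Real.sqrt r +
    2 * Real.sqrt (2 * Real.pi * (r + 1)) * (|θ| / σ) * (1 + θ ^ 2 / σ ^ 2) ^ ((r - 1) / 2) +
    2 * (Real.sqrt (2 * r) + r) * Aconst r θ σ


/-- Auxiliary integral `∫ s^(μ-1) exp(-s-u/s)`. -/
noncomputable def bN (μ u : ℝ) : ℝ :=
  ∫ s in Set.Ioi (0:ℝ), s ^ (μ - 1) * Real.exp (-s - u / s)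

lemma bN_bound (k : ℕ) {u s : ℝ} (hu : 0 < u) (hs : 0 < s) :
    Real.exp (-(u / s)) ≤ (Nat.factorial k) * (s / u) ^ k := by
  have h1 : (u / s) ^ k / (Nat.factorial k) ≤ Real.exp (u / s) :=
    Real.pow_div_factorial_le_exp _ (by positivity) k
  have hk : (0:ℝ) < Nat.factorial k := by positivity
  rw [Real.exp_neg]
  have h2 : (s / u) ^ k = ((u / s) ^ k)⁻¹ := by rw [← inv_pow, inv_div]
  rw [h2]
  have h3 : (0:ℝ) < (u / s) ^ k := by positivity
  calc (Real.exp (u/s))⁻¹ ≤ ((u / s) ^ k / (Nat.factorial k))⁻¹ := by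
        apply inv_anti₀ (by positivity) h1
    _ = _ := by rw [inv_div]; rfl

lemma bN_meas (μ u : ℝ) : Measurable (fun s : ℝ => s ^ (μ - 1) * Real.exp (-s - u / s)) := by
  fun_prop

lemma bN_integrable (μ : ℝ) {u : ℝ} (hu : 0 < u) :
    IntegrableOn (fun s : ℝ => s ^ (μ - 1) * Real.exp (-s - u / s)) (Set.Ioi 0) := by
  obtain ⟨k, hk⟩ := exists_nat_gt (-μ)
  have h1 := (Real.GammaIntegral_convergent (s := μ + k) (by linarith)).const_mul
    ((Nat.factorial k : ℝ) * (1 / u) ^ k)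
  refine Integrable.mono' h1 (bN_meas μ u).aestronglyMeasurable ?_
  filter_upwards [ae_restrict_mem measurableSet_Ioi] with s hs
  have hs : 0 < s := hs
  rw [Real.norm_of_nonneg (by positivity)]
  have e1 : Real.exp (-s - u / s) = Real.exp (-s) * Real.exp (-(u/s)) := by
    rw [← Real.exp_add]; ring_nf
  have e2 : s ^ (μ + k - 1) = s ^ (μ - 1) * s ^ k := by
    rw [← Real.rpow_natCast, ← Real.rpow_add hs]; ring_nf
  rw [e1, e2]
  have := bN_bound k hu hs
  calc s ^ (μ - 1) * (Real.exp (-s) * Real.exp (-(u/s)))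
      ≤ s ^ (μ - 1) * (Real.exp (-s) * ((Nat.factorial k) * (s / u) ^ k)) := by gcongr
    _ = _ := by rw [div_pow, one_div, inv_pow]; ring

lemma bN_pos (μ : ℝ) {u : ℝ} (hu : 0 < u) : 0 < bN μ u := by
  rw [bN, setIntegral_pos_iff_support_of_nonneg_ae]
  · have : Function.support (fun s : ℝ => s ^ (μ - 1) * Real.exp (-s - u / s)) ∩ Set.Ioi 0
        = Set.Ioi 0 := by
      ext s
      simp only [Set.mem_inter_iff, Function.mem_support, Set.mem_Ioi]
      constructor
      · exact fun h => h.2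
      · intro h
        exact ⟨by positivity, h⟩
    rw [this]; simp
  · filter_upwards [ae_restrict_mem measurableSet_Ioi] with s hs
    have hs : 0 < s := hs
    simp only [Pi.zero_apply]; positivity
  · exact bN_integrable μ hu

lemma bN_hasDerivAt (μ : ℝ) {u : ℝ} (hu : 0 < u) :
    HasDerivAt (bN μ) (-bN (μ - 1) u) u := by
  have key := hasDerivAt_integral_of_dominated_loc_of_deriv_le
    (μ := volume.restrict (Set.Ioi (0:ℝ)))
    (F := fun u s : ℝ => s ^ (μ - 1) * Real.exp (-s - u / s))
    (F' := fun u s : ℝ => -(s ^ (μ - 1 - 1) * Real.exp (-s - u / s)))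
    (x₀ := u) (s := Metric.ball u (u/2))
    (bound := fun s => s ^ (μ - 1 - 1) * Real.exp (-s - (u/2) / s))
    (Metric.ball_mem_nhds u (by positivity))
    (Eventually.of_forall fun v => (bN_meas μ v).aestronglyMeasurable)
    (bN_integrable μ hu)
    ((bN_meas (μ-1) u).neg.aestronglyMeasurable) ?_ (bN_integrable (μ - 1) (by positivity)) ?_
  · have := key.2
    simp only [integral_neg] at this
    exact this
  · filter_upwards [ae_restrict_mem measurableSet_Ioi] with s hs v hv
    have hs : 0 < s := hs
    have hv : u / 2 < v := by
      have := abs_lt.1 (by simpa [Real.dist_eq] using hv : |v - u| < u / 2)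
      linarith [this.1]
    rw [norm_neg, Real.norm_of_nonneg (by positivity)]
    gcongr
  · filter_upwards [ae_restrict_mem measurableSet_Ioi] with s hs v hv
    have hs : 0 < s := hs
    have h1 : HasDerivAt (fun v : ℝ => -s - v / s) (-(1/s)) v := by
      simpa using ((hasDerivAt_id v).div_const s).const_sub (-s)
    have h2 := (h1.exp).const_mul (s ^ (μ - 1))
    refine h2.congr_deriv ?_
    rw [Real.rpow_sub_one hs.ne' (μ - 1)]
    field_simp

lemma bN_rec (μ : ℝ) {u : ℝ} (hu : 0 < u) :
    bN (μ + 1) u = μ * bN μ u + u * bN (μ - 1) u := by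
  have hi := (((bN_integrable μ hu).const_mul μ).add ((bN_integrable (μ-1) hu).const_mul u)).sub
    (bN_integrable (μ+1) hu)
  have h0 : Tendsto (fun s : ℝ => s ^ μ * Real.exp (-s - u / s)) (nhdsWithin 0 (Set.Ioi 0)) (nhds 0) := by
    have h1 := (tendsto_rpow_mul_exp_neg_mul_atTop_nhds_zero (-μ) u hu).comp tendsto_inv_nhdsGT_zero
    refine squeeze_zero' ?_ ?_ h1
    · filter_upwards [self_mem_nhdsWithin] with s hs
      have hs : 0 < s := hs
      positivity
    · filter_upwards [self_mem_nhdsWithin] with s hs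
      have hs : 0 < s := hs
      simp only [Function.comp]
      rw [Real.inv_rpow hs.le, Real.rpow_neg hs.le, inv_inv]
      gcongr
      rw [div_eq_mul_inv]; linarith
  have h2 : Tendsto (fun s : ℝ => s ^ μ * Real.exp (-s - u / s)) atTop (nhds 0) := by
    have h1 := (tendsto_rpow_mul_exp_neg_mul_atTop_nhds_zero μ 1 one_pos)
    refine squeeze_zero' ?_ ?_ h1
    · filter_upwards [eventually_gt_atTop 0] with s hs
      positivity
    · filter_upwards [eventually_gt_atTop 0] with s hs
      gcongr
      have : 0 < u / s := by positivity
      linarith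
  have e : Set.EqOn ((((fun x => μ * (x ^ (μ - 1) * rexp (-x - u / x))) + fun x => u * (x ^ (μ - 1 - 1) * rexp (-x - u / x))) - fun s =>
      s ^ (μ + 1 - 1) * rexp (-s - u / s)))
      ((fun s : ℝ => μ * s ^ (μ - 1)) * (fun s : ℝ => Real.exp (-s - u / s)) +
       (fun s : ℝ => s ^ μ) * (fun s : ℝ => Real.exp (-s - u / s) * (-1 + u / s ^ 2))) (Set.Ioi 0) := by
    intro s hs
    have hs : 0 < s := hs
    simp only [Pi.add_apply, Pi.sub_apply, Pi.mul_apply]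
    rw [Real.rpow_sub_one hs.ne' (μ - 1), Real.rpow_sub_one hs.ne' μ, add_sub_cancel_right]
    field_simp
    ring
  have := integral_Ioi_deriv_mul_eq_sub (a := (0:ℝ)) (u := fun s : ℝ => s ^ μ)
    (v := fun s : ℝ => Real.exp (-s - u / s)) (u' := fun s : ℝ => μ * s ^ (μ - 1))
    (v' := fun s : ℝ => Real.exp (-s - u / s) * (-1 + u / s ^ 2)) (a' := 0) (b' := 0) ?_ ?_
    (IntegrableOn.congr_fun hi e measurableSet_Ioi) h0 h2
  · have this2 := (setIntegral_congr_fun (μ := volume) measurableSet_Ioi (fun s hs => e hs)).trans this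
    clear this
    rename' this2 => this
    simp only [Pi.add_apply, Pi.sub_apply] at this
    rw [integral_sub, integral_add, integral_const_mul, integral_const_mul] at this
    · simp only [bN]; linarith
    · exact (bN_integrable μ hu).const_mul μ
    · exact (bN_integrable (μ-1) hu).const_mul u
    · exact ((bN_integrable μ hu).const_mul μ).add ((bN_integrable (μ-1) hu).const_mul u)
    · exact (bN_integrable (μ+1) hu)
  · intro s hs
    exact Real.hasDerivAt_rpow_const (p := μ) (Or.inl (ne_of_gt hs))
  · intro s hs
    have hs : 0 < s := hs
    have h1 : HasDerivAt (fun s : ℝ => -s - u / s) (-1 + u / s ^ 2) s := by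
      have := ((hasDerivAt_id s).neg).sub ((hasDerivAt_inv hs.ne').const_mul u)
      refine this.congr_deriv ?_
      simp [div_eq_mul_inv]
    exact h1.exp

lemma bN_le_Gamma {μ : ℝ} (hμ : 0 < μ) {u : ℝ} (hu : 0 < u) : bN μ u ≤ Real.Gamma μ := by
  rw [Real.Gamma_eq_integral hμ, bN]
  refine setIntegral_mono_on (bN_integrable μ hu) (Real.GammaIntegral_convergent hμ) measurableSet_Ioi ?_
  intro s hs
  have hs : 0 < s := hs
  rw [mul_comm]
  gcongr
  have : 0 < u / s := by positivity
  linarith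

lemma bN_tendsto {μ : ℝ} (hμ : 0 < μ) :
    Tendsto (bN μ) (nhdsWithin 0 (Set.Ioi 0)) (nhds (Real.Gamma μ)) := by
  rw [Real.Gamma_eq_integral hμ]
  refine tendsto_integral_filter_of_dominated_convergence (fun s => rexp (-s) * s ^ (μ - 1)) ?_ ?_
    (Real.GammaIntegral_convergent hμ) ?_
  · exact Eventually.of_forall fun v => (bN_meas μ v).aestronglyMeasurable
  · filter_upwards [self_mem_nhdsWithin] with u hu
    have hu : 0 < u := hu
    filter_upwards [ae_restrict_mem measurableSet_Ioi] with s hs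
    have hs : 0 < s := hs
    rw [Real.norm_of_nonneg (by positivity), mul_comm]
    gcongr
    have : 0 < u / s := by positivity
    linarith
  · filter_upwards [ae_restrict_mem measurableSet_Ioi] with s hs
    have hs : 0 < s := hs
    have : Continuous (fun u : ℝ => s ^ (μ - 1) * rexp (-s - u / s)) := by fun_prop
    have h := (this.tendsto 0).mono_left (nhdsWithin_le_nhds (s := Set.Ioi 0))
    simp only [zero_div, sub_zero] at h
    rw [mul_comm]
    exact h

lemma besselK_eq_bN (μ : ℝ) {z : ℝ} (hz : 0 < z) :
    besselK μ z = 1 / 2 * (z / 2) ^ (-μ) * bN μ (z ^ 2 / 4) := by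
  set g : ℝ → ℝ := fun s => s ^ (μ - 1) * Real.exp (-s - (z^2/4) / s) with hg
  have h1 : bN μ (z^2/4) = ∫ t : ℝ, (z/2) ^ μ * (Real.exp (-z * Real.cosh t) * Real.exp (μ * t)) := by
    have e := integral_image_eq_integral_abs_deriv_smul (s := Set.univ) (f := fun t : ℝ => z/2 * Real.exp t)
      (f' := fun t : ℝ => z/2 * Real.exp t) MeasurableSet.univ
      (fun t _ => ((Real.hasDerivAt_exp t).const_mul (z/2)).hasDerivWithinAt) ?_ g
    · have : (fun t : ℝ => z/2 * Real.exp t) '' Set.univ = Set.Ioi 0 := by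
        ext y
        simp only [Set.image_univ, Set.mem_range, Set.mem_Ioi]
        constructor
        · rintro ⟨t, rfl⟩; positivity
        · intro hy
          refine ⟨Real.log (y / (z/2)), ?_⟩
          rw [Real.exp_log (by positivity)]; field_simp
      rw [this, setIntegral_univ] at e
      rw [bN, e]
      congr 1
      ext t
      have hx : 0 < z / 2 * Real.exp t := by positivity
      rw [abs_of_pos hx, smul_eq_mul]
      simp only [hg]
      rw [Real.rpow_sub_one hx.ne', Real.mul_rpow (by positivity) (by positivity), ← Real.exp_mul,
        mul_comm t μ]
      have : -(z / 2 * Real.exp t) - z ^ 2 / 4 / (z / 2 * Real.exp t) = -z * Real.cosh t := by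
        rw [Real.cosh_eq, Real.exp_neg]; field_simp; ring
      rw [this]; field_simp
    · intro x _ y _ hxy
      simp only at hxy
      exact Real.exp_injective (mul_left_cancel₀ (by positivity) hxy)
  have hIntg : Integrable (fun t : ℝ => (z/2) ^ μ * (Real.exp (-z * Real.cosh t) * Real.exp (μ * t))) := by
    by_contra hcon
    rw [integral_undef hcon] at h1
    exact absurd h1 (bN_pos μ (by positivity)).ne'
  have hIntg2 : Integrable (fun t : ℝ => (Real.exp (-z * Real.cosh t) * Real.exp (μ * t))) :=
    (integrable_const_mul_iff (by
      exact (IsUnit.mk0 _ (by positivity))) _).1 hIntg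
  rw [integral_const_mul] at h1
  have h3 : ∫ t : ℝ, (Real.exp (-z * Real.cosh t) * Real.exp (μ * t)) = 2 * besselK μ z := by
    rw [← integral_add_compl (s := Set.Ioi (0:ℝ)) measurableSet_Ioi hIntg2, Set.compl_Ioi]
    have : ∫ t in Set.Iic (0:ℝ), (Real.exp (-z * Real.cosh t) * Real.exp (μ * t)) =
        ∫ t in Set.Ioi (0:ℝ), (Real.exp (-z * Real.cosh t) * Real.exp (-(μ * t))) := by
      have := integral_comp_neg_Ioi (0:ℝ) (fun t => (Real.exp (-z * Real.cosh t) * Real.exp (μ * t)))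
      simp only [Real.cosh_neg, neg_zero, mul_neg] at this
      rw [this]
    rw [this, ← integral_add hIntg2.integrableOn, besselK, ← integral_const_mul]
    · congr 1
      ext t
      rw [Real.cosh_eq (μ * t)]; ring
    · have := hIntg2.comp_neg
      simp only [Real.cosh_neg, mul_neg] at this
      exact this.integrableOn
  rw [h3] at h1
  rw [h1, Real.rpow_neg (by positivity)]
  have : 0 < (z/2) ^ μ := by positivity
  field_simp

lemma bN_symm (μ : ℝ) {u : ℝ} (hu : 0 < u) : bN (-μ) u = u ^ (-μ) * bN μ u := by
  have hz : 0 < 2 * Real.sqrt u := by positivity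
  have h1 := besselK_eq_bN μ hz
  have h2 := besselK_eq_bN (-μ) hz
  have h3 : besselK (-μ) (2 * Real.sqrt u) = besselK μ (2 * Real.sqrt u) := by
    simp [besselK]
  have h4 : (2 * Real.sqrt u) ^ 2 / 4 = u := by rw [mul_pow, Real.sq_sqrt hu.le]; ring
  have h5 : (2 * Real.sqrt u) / 2 = u ^ (1/2 : ℝ) := by rw [← Real.sqrt_eq_rpow]; ring
  rw [h4, h5, ← Real.rpow_mul hu.le] at h1 h2
  rw [h3, h1] at h2
  have h6 : u ^ (-μ) = u ^ (1/2 * -μ) * u ^ (1/2 * -μ) := by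
    rw [← Real.rpow_add hu]; ring_nf
  have h7 : u ^ (1/2 * - -μ) = (u ^ (1/2 * -μ))⁻¹ := by
    rw [← Real.rpow_neg hu.le]; ring_nf
  rw [h7] at h2
  have : 0 < u ^ (1/2 * -μ) := by positivity
  rw [h6]
  set w := u ^ (1/2 * -μ) with hw
  have h8 : w * (1 / 2 * w⁻¹ * bN (-μ) u) = w * (1 / 2 * w * bN μ u) := by rw [h2]
  have h9 : w * (1 / 2 * w⁻¹ * bN (-μ) u) = 1 / 2 * bN (-μ) u := by
    rw [show w * (1 / 2 * w⁻¹ * bN (-μ) u) = (w * w⁻¹) * (1 / 2 * bN (-μ) u) by ring,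
      mul_inv_cancel₀ this.ne', one_mul]
  linarith

lemma besselK_integrable (μ : ℝ) {z : ℝ} (hz : 0 < z) :
    IntegrableOn (fun t => Real.exp (-z * Real.cosh t) * Real.cosh (μ * t)) (Set.Ioi 0) := by
  by_contra hcon
  have h := besselK_eq_bN μ hz
  rw [besselK, integral_undef hcon] at h
  have := bN_pos μ (u := z^2/4) (by positivity)
  have : 0 < 1 / 2 * (z / 2) ^ (-μ) * bN μ (z ^ 2 / 4) := by positivity
  linarith

lemma besselK_mono {μ μ' : ℝ} (h : |μ| ≤ |μ'|) {z : ℝ} (hz : 0 < z) :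
    besselK μ z ≤ besselK μ' z := by
  refine setIntegral_mono_on (besselK_integrable μ hz) (besselK_integrable μ' hz) measurableSet_Ioi ?_
  intro t ht
  have : Real.cosh (μ * t) ≤ Real.cosh (μ' * t) := by
    rw [Real.cosh_le_cosh, abs_mul, abs_mul]; gcongr
  gcongr

lemma bN_mono_aux {ν : ℝ} (hν : -1/2 < ν) {u : ℝ} (hu : 0 < u) :
    bN (-ν) u ≤ Real.sqrt u * bN (-ν - 1) u := by
  have hz : 0 < 2 * Real.sqrt u := by positivity
  have h0 : besselK (-ν) (2 * Real.sqrt u) ≤ besselK (-ν - 1) (2 * Real.sqrt u) := by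
    apply besselK_mono _ hz
    rw [← sq_le_sq]
    nlinarith
  rw [besselK_eq_bN _ hz, besselK_eq_bN _ hz] at h0
  have h4 : (2 * Real.sqrt u) ^ 2 / 4 = u := by rw [mul_pow, Real.sq_sqrt hu.le]; ring
  have h5 : (2 * Real.sqrt u) / 2 = Real.sqrt u := by ring
  have hs : 0 < Real.sqrt u := by positivity
  rw [h4, h5, show - (-ν - 1) = - -ν + 1 by ring, Real.rpow_add hs, Real.rpow_one] at h0
  have : 0 < Real.sqrt u ^ (- -ν) := by positivity
  have h6 : 1 / 2 * Real.sqrt u ^ (- -ν) * bN (-ν) u ≤ 1 / 2 * Real.sqrt u ^ (- -ν) * (Real.sqrt u * bN (-ν-1) u) := by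
    linarith
  exact le_of_mul_le_mul_left h6 (by positivity)



/-- coefficients of the modified Bessel series -/
noncomputable def bc (μ : ℝ) (k : ℕ) : ℝ := 1 / (Real.Gamma (μ + (k : ℝ) + 1) * (Nat.factorial k))

noncomputable def bG (μ u : ℝ) : ℝ := ∑' k : ℕ, bc μ k * u ^ k

lemma bc_pos {μ : ℝ} (hμ : -1 < μ) (k : ℕ) : 0 < bc μ k := by
  have : 0 < Real.Gamma (μ + k + 1) := Real.Gamma_pos_of_pos (by
    have : (0:ℝ) ≤ k := Nat.cast_nonneg k
    linarith)
  unfold bc; positivity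

lemma bc_shift {μ : ℝ} (k : ℕ) : ((k:ℝ) + 1) * bc μ (k+1) = bc (μ+1) k := by
  unfold bc
  rw [Nat.factorial_succ]; push_cast
  rw [show μ + ((k:ℝ) + 1) + 1 = μ + 1 + k + 1 by ring]
  field_simp

lemma bc_succ {μ : ℝ} (hμ : -1 < μ) (k : ℕ) : bc μ k = (μ + 1 + k) * bc (μ+1) k := by
  unfold bc
  have h0 : 0 < μ + k + 1 := by
    have : (0:ℝ) ≤ k := Nat.cast_nonneg k
    linarith
  rw [show μ + 1 + (k:ℝ) + 1 = (μ + k + 1) + 1 by ring, Real.Gamma_add_one h0.ne']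
  have := Real.Gamma_pos_of_pos h0
  rw [show μ + 1 + (k:ℝ) = μ + k + 1 by ring]
  field_simp

lemma bc_summable {μ : ℝ} (hμ : -1 < μ) (u : ℝ) : Summable (fun k => bc μ k * u ^ k) := by
  rcases eq_or_ne u 0 with rfl | hu
  · apply summable_of_ne_finset_zero (s := {0})
    intro k hk
    have : k ≠ 0 := by simpa using hk
    simp [this]
  refine summable_of_ratio_test_tendsto_lt_one (l := 0) one_pos ?_ ?_
  · exact Eventually.of_forall fun k => mul_ne_zero (bc_pos hμ k).ne' (pow_ne_zero _ hu)
  · have h1 : ∀ k : ℕ, ‖bc μ (k+1) * u ^ (k+1)‖ / ‖bc μ k * u ^ k‖ = |u| / ((μ + 1 + k) * (k + 1)) := by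
      intro k
      have hp := bc_pos hμ k
      have hp1 := bc_pos (μ := μ + 1) (by linarith) k
      have hp2 := bc_pos hμ (k+1)
      have h0 : 0 < μ + 1 + k := by
        have : (0:ℝ) ≤ k := Nat.cast_nonneg k
        linarith
      have hu' : 0 < |u| := abs_pos.2 hu
      rw [norm_mul, norm_mul, norm_pow, norm_pow, Real.norm_of_nonneg hp.le, Real.norm_of_nonneg hp2.le,
        bc_succ hμ k, ← bc_shift k, Real.norm_eq_abs, pow_succ]
      field_simp
    simp only [h1]
    apply Tendsto.div_atTop tendsto_const_nhds
    apply Tendsto.atTop_mul_atTop₀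
    · exact tendsto_atTop_add_const_left _ _ tendsto_natCast_atTop_atTop
    · exact tendsto_atTop_add_const_right _ _ tendsto_natCast_atTop_atTop

lemma bG_hasDerivAt {μ : ℝ} (hμ : -1 < μ) (u : ℝ) : HasDerivAt (bG μ) (bG (μ+1) u) u := by
  have hs : Summable (fun k : ℕ => bc μ k * (k * (|u| + 1) ^ (k-1))) := by
    rw [← summable_nat_add_iff 1]
    refine (bc_summable (μ := μ+1) (by linarith) (|u|+1)).congr ?_
    intro k
    rw [← bc_shift k]; push_cast; try simp only [Nat.add_sub_cancel]
    ring
  have := hasDerivAt_tsum_of_isPreconnected (𝕜 := ℝ) (t := Metric.ball 0 (|u| + 1))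
    (g := fun k y => bc μ k * y ^ k) (g' := fun k y => bc μ k * (k * y ^ (k-1))) (y₀ := 0) (y := u)
    hs Metric.isOpen_ball (convex_ball _ _).isPreconnected ?_ ?_ ?_ (bc_summable hμ 0) ?_
  · refine this.congr_deriv ?_
    have hs2 : Summable (fun k : ℕ => bc μ k * (k * u ^ (k-1))) := by
      rw [← summable_nat_add_iff 1]
      refine (bc_summable (μ := μ+1) (by linarith) u).congr ?_
      intro k
      rw [← bc_shift k]; push_cast; try simp only [Nat.add_sub_cancel]
      ring
    rw [hs2.tsum_eq_zero_add, bG]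
    simp only [Nat.cast_zero, zero_mul, mul_zero, zero_add]
    congr 1; ext k
    rw [← bc_shift k]; push_cast; try simp only [Nat.add_sub_cancel]
    ring
  · intro k y _
    exact (hasDerivAt_pow k y).const_mul _
  · intro k y hy
    have hy : |y| < |u| + 1 := by simpa using hy
    rw [norm_mul, norm_mul, norm_pow, Real.norm_of_nonneg (bc_pos hμ k).le, Real.norm_natCast,
      Real.norm_eq_abs]
    have := bc_pos hμ k
    gcongr
  · simp; positivity
  · simp

lemma bG_rec {μ : ℝ} (hμ : -1 < μ) (u : ℝ) :
    u * bG (μ+2) u = bG μ u - (μ+1) * bG (μ+1) u := by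
  have h0 := bc_summable hμ u
  have h1 := bc_summable (μ := μ+1) (by linarith) u
  have h2 := bc_summable (μ := μ+2) (by linarith) u
  unfold bG
  rw [← tsum_mul_left, ← tsum_mul_left, ← h0.tsum_sub (h1.mul_left _)]
  have e : ∀ k : ℕ, bc μ k * u ^ k - (μ+1) * (bc (μ+1) k * u ^ k) = k * (bc (μ+1) k * u ^ k) := by
    intro k; rw [bc_succ hμ k]; ring
  simp only [e]
  have hs : Summable (fun k : ℕ => (k:ℝ) * (bc (μ+1) k * u ^ k)) := by
    refine (h0.sub (h1.mul_left (μ+1))).congr ?_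
    intro k; exact e k
  rw [hs.tsum_eq_zero_add]
  simp only [Nat.cast_zero, zero_mul, zero_add]
  congr 1; ext k
  rw [show μ + 2 = μ + 1 + 1 by ring, ← bc_shift k]; push_cast; ring

lemma bG_pos {μ : ℝ} (hμ : -1 < μ) {u : ℝ} (hu : 0 ≤ u) : 0 < bG μ u := by
  have h := (bc_summable hμ u).sum_le_tsum (s := {0}) (fun k _ => by
    have := bc_pos hμ k
    positivity)
  have := bc_pos hμ 0
  simp only [Finset.sum_singleton, pow_zero, mul_one] at h
  exact lt_of_lt_of_le this h

lemma bG_zero (μ : ℝ) : bG μ 0 = 1 / Real.Gamma (μ + 1) := by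
  unfold bG
  rw [tsum_eq_single 0]
  · simp [bc]
  · intro k hk; simp [hk]

lemma bessel_wronskian {ν : ℝ} (hν : -1 < ν) {u : ℝ} (hu : 0 < u) :
    u * bN ν u * bG (ν+1) u + bN (ν+1) u * bG ν u = 1 := by
  set W : ℝ → ℝ := fun u => u * bN ν u * bG (ν+1) u + bN (ν+1) u * bG ν u with hW
  have hd : ∀ v ∈ Set.Ioi (0:ℝ), HasDerivAt W 0 v := by
    intro v hv
    have hv : 0 < v := hv
    have h1 := ((hasDerivAt_id v).mul (bN_hasDerivAt ν hv)).mul (bG_hasDerivAt (μ := ν+1) (by linarith) v)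
    have h2 := (bN_hasDerivAt (ν+1) hv).mul (bG_hasDerivAt hν v)
    refine (h1.add h2).congr_deriv ?_
    have r1 := bN_rec ν hv
    have r2 := bG_rec hν v
    simp only [Pi.mul_apply, id, add_sub_cancel_right]
    rw [show ν + 1 + 1 = ν + 2 by ring]
    linear_combination (bG (ν+1) v) * r1 + bN ν v * r2
  have hcst : ∀ v ∈ Set.Ioi (0:ℝ), W v = W u := by
    intro v hv
    have := (convex_Ioi (0:ℝ)).is_const_of_fderivWithin_eq_zero (𝕜 := ℝ) (f := W)
      (fun x hx => (hd x hx).differentiableAt.differentiableWithinAt) ?_ hv (Set.mem_Ioi.2 hu)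
    · exact this
    · intro x hx
      have := (hd x hx).hasFDerivAt.hasFDerivWithinAt (s := Set.Ioi 0)
      rw [this.fderivWithin (isOpen_Ioi.uniqueDiffWithinAt hx)]
      ext; simp
  have hG : ∀ μ : ℝ, -1 < μ → Tendsto (bG μ) (nhdsWithin 0 (Set.Ioi 0)) (nhds (1 / Real.Gamma (μ+1))) := by
    intro μ hμ
    have := (bG_hasDerivAt hμ 0).continuousAt.tendsto
    rw [bG_zero] at this
    exact this.mono_left nhdsWithin_le_nhds
  have hlim : Tendsto W (nhdsWithin 0 (Set.Ioi 0)) (nhds 1) := by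
    have t1 := bN_tendsto (μ := ν + 1) (by linarith)
    have t2 := bN_tendsto (μ := ν + 1 + 1) (by linarith)
    have t3 := t2.sub (t1.const_mul (ν+1))
    rw [Real.Gamma_add_one (by linarith : ν + 1 ≠ 0), sub_self] at t3
    have t4 := (t3.mul (hG (ν+1) (by linarith))).add (t1.mul (hG ν hν))
    have hp := Real.Gamma_pos_of_pos (by linarith : 0 < ν + 1)
    rw [zero_mul, zero_add, mul_one_div_cancel hp.ne'] at t4
    refine t4.congr' ?_
    filter_upwards [self_mem_nhdsWithin] with v hv
    have r := bN_rec (ν+1) (u := v) hv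
    rw [add_sub_cancel_right] at r
    simp only [hW]
    rw [r]; ring
  have h2 : Tendsto W (nhdsWithin 0 (Set.Ioi 0)) (nhds (W u)) := by
    refine tendsto_const_nhds.congr' ?_
    filter_upwards [self_mem_nhdsWithin] with v hv
    exact (hcst v hv).symm
  exact tendsto_nhds_unique h2 hlim

lemma besselI_eq_bG (ν : ℝ) {z : ℝ} (hz : 0 < z) :
    besselI ν z = (z / 2) ^ ν * bG ν (z ^ 2 / 4) := by
  unfold besselI bG bc
  rw [← tsum_mul_left]
  congr 1; ext k
  rw [Real.rpow_add (by positivity), Real.rpow_mul (by positivity), Real.rpow_natCast]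
  rw [show (z/2) ^ (2:ℝ) = z^2/4 by
    rw [show (2:ℝ) = ((2:ℕ):ℝ) by norm_num, Real.rpow_natCast]; push_cast; ring]
  ring



lemma integral_add3 {μ : Measure ℝ} {f g k : ℝ → ℝ} (hf : Integrable f μ) (hg : Integrable g μ)
    (hk : Integrable k μ) : ∫ t, (f t + g t + k t) ∂μ = ∫ t, f t ∂μ + ∫ t, g t ∂μ + ∫ t, k t ∂μ := by
  have h1 := integral_add (hf.add hg) hk
  have h2 := integral_add hf hg
  simp only [Pi.add_apply] at h1
  rw [h1, h2]

lemma gauss_w (m v A B x : ℝ) (hv : 0 < v) :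
    Integrable (fun t : ℝ => (A + B * (x - t)^2) * Real.exp (-(t-m)^2/(2*v))) ∧
    ∫ t : ℝ, (A + B * (x - t)^2) * Real.exp (-(t-m)^2/(2*v))
      = Real.sqrt (2*π*v) * (A + B * ((x-m)^2 + v)) := by
  set V : NNReal := ⟨v, hv.le⟩ with hV
  have hV0 : V ≠ 0 := by
    intro h
    have : (V:ℝ) = 0 := by rw [h]; rfl
    change v = 0 at this
    linarith
  set μ := ProbabilityTheory.gaussianReal m V
  have h2 : MemLp (fun t : ℝ => t) 2 μ := ProbabilityTheory.memLp_id_gaussianReal 2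
  have i1 : Integrable (fun t : ℝ => t) μ := h2.integrable (by norm_num)
  have i2 : Integrable (fun t : ℝ => t^2) μ := h2.integrable_sq
  have hm : ∫ t, t ∂μ = m := ProbabilityTheory.integral_id_gaussianReal
  have hvar := ProbabilityTheory.variance_fun_id_gaussianReal (μ := m) (v := V)
  rw [ProbabilityTheory.variance_eq_sub h2] at hvar
  have hsq : ∫ t, t^2 ∂μ = m^2 + v := by
    have e : (∫ t, t^2 ∂μ) - (∫ t, t ∂μ)^2 = v := hvar
    rw [hm] at e; linarith
  have hexp : ∀ t, A + B * (x - t)^2 = (A + B * x^2) + (-(2*B*x)) * t + B * t^2 := by intro t; ring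
  have iw : Integrable (fun t : ℝ => A + B * (x - t)^2) μ := by
    simp only [hexp]
    exact ((integrable_const _).add (i1.const_mul _)).add (i2.const_mul _)
  have ew : ∫ t, (A + B * (x - t)^2) ∂μ = A + B * ((x-m)^2 + v) := by
    simp only [hexp]
    rw [integral_add3 (integrable_const _) (i1.const_mul _) (i2.const_mul _),
      integral_const_mul, integral_const_mul, hm, hsq]
    simp; ring
  have hpos : 0 < Real.sqrt (2*π*v) := by positivity
  have hpdf : ∀ t, Real.exp (-(t-m)^2/(2*v)) = Real.sqrt (2*π*v) * ProbabilityTheory.gaussianPDFReal m V t := by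
    intro t
    rw [ProbabilityTheory.gaussianPDFReal]
    change _ = Real.sqrt (2*π*v) * ((Real.sqrt (2*π*v))⁻¹ * Real.exp (-(t-m)^2/(2*v)))
    field_simp
  constructor
  · have : Integrable (fun t : ℝ => (A + B * (x - t)^2)) (volume.withDensity (ProbabilityTheory.gaussianPDF m V)) := by
      rw [← ProbabilityTheory.gaussianReal_of_var_ne_zero m hV0]; exact iw
    rw [integrable_withDensity_iff (ProbabilityTheory.measurable_gaussianPDF m V)
      (by filter_upwards with t; exact ProbabilityTheory.gaussianPDF_lt_top)] at this
    refine (this.const_mul (Real.sqrt (2*π*v))).congr ?_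
    filter_upwards with t
    rw [hpdf, ProbabilityTheory.toReal_gaussianPDF]; ring
  · rw [← ew, ProbabilityTheory.integral_gaussianReal_eq_integral_smul hV0, ← integral_const_mul]
    congr 1; ext t
    rw [hpdf, smul_eq_mul]; ring

lemma vg_eq_bN (r θ : ℝ) {t : ℝ} (ht : t ≠ 0) :
    vgDensity r θ 1 t = 1/2 * (Real.sqrt π * Real.Gamma (r/2))⁻¹ * (1+θ^2)^(-((r-1)/2)) *
      (Real.exp (θ*t) * bN ((r-1)/2) ((1+θ^2)*t^2/4)) := by
  have hq : 0 < 1 + θ^2 := by positivity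
  have ht' : 0 < |t| := abs_pos.mpr ht
  set α := Real.sqrt (1+θ^2) with hα
  have hαp : 0 < α := Real.sqrt_pos.mpr hq
  have hα2 : α^2 = 1 + θ^2 := Real.sq_sqrt hq.le
  have e0 : Real.sqrt (θ^2 + 1^2) = α := by rw [hα]; congr 1; ring
  unfold vgDensity
  rw [e0, besselK_eq_bN _ (by positivity)]
  have e1 : (α * |t| / 1^2)^2/4 = (1+θ^2)*t^2/4 := by
    rw [← hα2]; rw [one_pow, div_one, mul_pow, sq_abs]
  have e2 : (1+θ^2)^(-((r-1)/2)) = (|t| / (2*α))^((r-1)/2) * (α * |t| / 1^2 / 2)^(-((r-1)/2)) := by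
    rw [← hα2, Real.rpow_neg (by positivity : (0:ℝ) ≤ α * |t| / 1^2/2), ← div_eq_mul_inv,
      ← Real.div_rpow (by positivity) (by positivity), Real.rpow_neg (by positivity),
      ← Real.inv_rpow (by positivity)]
    congr 1; field_simp
  rw [e1, e2]
  simp only [one_pow, div_one, one_mul]
  ring

lemma vg_weighted (r θ A B x : ℝ) (hr : 0 < r) (hA : 0 ≤ A) (hB : 0 ≤ B) :
    Integrable (fun t : ℝ => (A + B * (x - t)^2) * vgDensity r θ 1 t) ∧
    ∫ t : ℝ, (A + B * (x - t)^2) * vgDensity r θ 1 t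
      = A + B * ((x - r*θ)^2 + r * (1 + 2*θ^2)) := by
  set q := 1 + θ^2 with hq
  have hqp : 0 < q := by positivity
  set ν := (r-1)/2 with hν
  set G : ℝ → ℝ → ℝ := fun t s => (A + B * (x - t)^2) * (Real.exp (θ*t) * (s^(ν-1) * Real.exp (-s - q*t^2/4/s))) with hG
  have hGe : ∀ s, 0 < s → ∀ t, G t s = (s^(ν-1) * Real.exp (-(1/q*s))) *
      ((A + B * (x - t)^2) * Real.exp (-(t-θ*(2*s/q))^2/(2*(2*s/q)))) := by
    intro s hs t
    have : Real.exp (θ*t) * Real.exp (-s - q*t^2/4/s) = Real.exp (-(1/q*s)) * Real.exp (-(t-θ*(2*s/q))^2/(2*(2*s/q))) := by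
      rw [← Real.exp_add, ← Real.exp_add]
      congr 1
      field_simp
      rw [hq]; ring
    simp only [hG]
    linear_combination ((A + B * (x - t)^2) * s^(ν-1)) * this
  have hgi : ∀ s, 0 < s → Integrable (fun t => G t s) := by
    intro s hs
    simp only [hGe s hs]
    exact (gauss_w _ _ A B x (by positivity)).1.const_mul _
  have hGn : ∀ t s, 0 < s → 0 ≤ G t s := by
    intro t s hs; simp only [hG]; positivity
  set c1 := A + B * x^2
  set J : ℝ → ℝ := fun s => (2 * Real.sqrt π / Real.sqrt q) * (c1 * (s^(r/2-1) * Real.exp (-(1/q*s)))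
      + (B * (2/q) * (1 - 2*x*θ)) * (s^((r/2+1)-1) * Real.exp (-(1/q*s)))
      + (B * θ^2 * (2/q)^2) * (s^((r/2+2)-1) * Real.exp (-(1/q*s)))) with hJ
  have hgv : ∀ s, 0 < s → ∫ t, G t s = J s := by
    intro s hs
    simp only [hGe s hs]
    rw [integral_const_mul, (gauss_w _ _ A B x (by positivity)).2]
    have e1 : Real.sqrt (2*π*(2*s/q)) = 2 * Real.sqrt π / Real.sqrt q * s^(1/2:ℝ) := by
      rw [← Real.sqrt_eq_rpow, show 2*π*(2*s/q) = 2^2 * (π / q) * s by ring, Real.sqrt_mul (by positivity),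
        Real.sqrt_mul (by positivity), Real.sqrt_sq (by norm_num), Real.sqrt_div (by positivity)]
      ring
    have e2 : s^(r/2-1) = s^(ν-1) * s^(1/2:ℝ) := by
      rw [← Real.rpow_add hs]; congr 1; rw [hν]; ring
    have e3 : s^(r/2+1-1) = s^(ν-1) * s^(1/2:ℝ) * s := by
      rw [← e2]; nth_rewrite 3 [← Real.rpow_one s]; rw [← Real.rpow_add hs]; congr 1; ring
    have e4 : s^(r/2+2-1) = s^(ν-1) * s^(1/2:ℝ) * s^2 := by
      rw [← e2, ← Real.rpow_natCast, ← Real.rpow_add hs]; congr 1; push_cast; ring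
    simp only [hJ]
    rw [e1, e2, e3, e4]
    ring
  have hIi : ∀ a : ℝ, 0 < a → IntegrableOn (fun s : ℝ => s^(a-1) * Real.exp (-(1/q*s))) (Set.Ioi 0) := by
    intro a ha
    have := integrableOn_rpow_mul_exp_neg_mul_rpow (p := 1) (s := a-1) (b := 1/q) (by linarith) (by norm_num) (by positivity)
    simpa only [Real.rpow_one, neg_mul] using this
  have hJi : IntegrableOn J (Set.Ioi 0) :=
    ((((hIi (r/2) (by positivity)).const_mul c1).add ((hIi (r/2+1) (by positivity)).const_mul _)).add
      ((hIi (r/2+2) (by positivity)).const_mul _)).const_mul _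
  have hIntg : Integrable (Function.uncurry G) (volume.prod (volume.restrict (Set.Ioi 0))) := by
    rw [integrable_prod_iff']
    · constructor
      · filter_upwards [ae_restrict_mem measurableSet_Ioi] with s hs using hgi s hs
      · refine hJi.congr ?_
        filter_upwards [ae_restrict_mem measurableSet_Ioi] with s hs
        rw [← hgv s hs]
        congr 1; ext t
        exact (Real.norm_of_nonneg (hGn t s hs)).symm
    · apply Measurable.aestronglyMeasurable
      simp only [hG]
      unfold Function.uncurry
      fun_prop
  set c0 := 1/2 * (Real.sqrt π * Real.Gamma (r/2))⁻¹ * q^(-ν) with hc0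
  have hvg : (fun t => c0 * ∫ s in Set.Ioi 0, G t s) =ᵐ[volume] fun t => (A + B * (x - t)^2) * vgDensity r θ 1 t := by
    have : ∀ᵐ t : ℝ, t ≠ 0 := by
      rw [ae_iff]; simp
    filter_upwards [this] with t ht
    rw [vg_eq_bN r θ ht]
    simp only [hG]
    rw [integral_const_mul, integral_const_mul, ← bN]
    simp only [hc0]; ring
  constructor
  · exact (hIntg.integral_prod_left.const_mul c0).congr hvg
  · rw [← integral_congr_ae hvg, integral_const_mul, integral_integral_swap hIntg]
    rw [setIntegral_congr_fun measurableSet_Ioi (fun s hs => hgv s hs)]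
    simp only [hJ]
    have hG0 : Real.Gamma (r/2) ≠ 0 := (Real.Gamma_pos_of_pos (by positivity)).ne'
    rw [integral_const_mul, integral_add3 ((hIi (r/2) (by positivity)).const_mul c1) ((hIi (r/2+1) (by positivity)).const_mul _)
        ((hIi (r/2+2) (by positivity)).const_mul _),
      integral_const_mul, integral_const_mul, integral_const_mul,
      Real.integral_rpow_mul_exp_neg_mul_Ioi (by positivity) (by positivity),
      Real.integral_rpow_mul_exp_neg_mul_Ioi (by positivity) (by positivity),
      Real.integral_rpow_mul_exp_neg_mul_Ioi (by positivity) (by positivity),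
      show r/2+2 = r/2+1+1 by ring, Real.Gamma_add_one (s := r/2+1) (by positivity),
      Real.Gamma_add_one (s := r/2) (by positivity)]
    have e1 : (1/(1/q)) = q := by field_simp
    have e2 : q^(r/2+1+1) = q^(r/2) * q^2 := by
      rw [← Real.rpow_natCast, ← Real.rpow_add hqp]; congr 1; push_cast; ring
    have e3 : q^(r/2+1) = q^(r/2) * q := by
      rw [Real.rpow_add_one hqp.ne']
    have e4 : q^(-ν) * q^(r/2) = Real.sqrt q := by
      rw [← Real.rpow_add hqp, Real.sqrt_eq_rpow]; congr 1; rw [hν]; ring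
    have hsq : 0 < Real.sqrt q := Real.sqrt_pos.mpr hqp
    have hsp : 0 < Real.sqrt π := Real.sqrt_pos.mpr Real.pi_pos
    rw [e1, e2, e3]
    set Q := q^(r/2)
    simp only [hc0]
    rw [show q^(-ν) = Real.sqrt q / Q by rw [← e4]; have : Q ≠ 0 := by positivity
                                         field_simp]
    have hQ : 0 < Q := by positivity
    field_simp
    simp only [c1]
    ring

lemma vg_nonneg (r θ : ℝ) (hr : 0 < r) (t : ℝ) : 0 ≤ vgDensity r θ 1 t := by
  unfold vgDensity
  have : 0 ≤ besselK ((r - 1) / 2) (Real.sqrt (θ ^ 2 + 1 ^ 2) * |t| / 1 ^ 2) := by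
    unfold besselK
    apply integral_nonneg
    intro s
    positivity
  have h2 : 0 < Real.Gamma (r/2) := Real.Gamma_pos_of_pos (by positivity)
  positivity

lemma vg_integrable (r θ : ℝ) (hr : 0 < r) : Integrable (vgDensity r θ 1) := by
  have := (vg_weighted r θ 1 0 0 hr (by norm_num) (by norm_num)).1
  simpa using this

lemma vg_integral (r θ : ℝ) (hr : 0 < r) : ∫ t, vgDensity r θ 1 t = 1 := by
  have := (vg_weighted r θ 1 0 0 hr (by norm_num) (by norm_num)).2
  simpa using this

lemma lip_continuous {h : ℝ → ℝ} {L : ℝ} (hL : 0 ≤ L) (hlip : ∀ u v : ℝ, |h u - h v| ≤ L * |u - v|) :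
    Continuous h := by
  have : LipschitzWith ⟨L, hL⟩ h := by
    apply LipschitzWith.of_dist_le_mul
    intro x y
    rw [Real.dist_eq, Real.dist_eq]; exact hlip x y
  exact this.continuous

lemma hp_integrable (r θ : ℝ) (hr : 0 < r) {h : ℝ → ℝ} {L : ℝ} (hL : 0 ≤ L)
    (hlip : ∀ u v : ℝ, |h u - h v| ≤ L * |u - v|) :
    Integrable (fun t => h t * vgDensity r θ 1 t) := by
  have hc := lip_continuous hL hlip
  refine Integrable.mono' (vg_weighted r θ (|h 0| + L) L 0 hr (by positivity) hL).1
    (hc.aestronglyMeasurable.mul (vg_integrable r θ hr).aestronglyMeasurable) ?_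
  filter_upwards with t
  rw [norm_mul, Real.norm_of_nonneg (vg_nonneg r θ hr t), Real.norm_eq_abs]
  apply mul_le_mul_of_nonneg_right _ (vg_nonneg r θ hr t)
  have h1 := hlip t 0
  have h2 := abs_sub_abs_le_abs_sub (h t) (h 0)
  rw [sub_zero] at h1
  have h3 : |t| ≤ 1 + t^2 := by
    nlinarith [sq_abs t, sq_nonneg (|t| - 1), abs_nonneg t]
  have : L * |t| ≤ L * (1+t^2) := by gcongr
  nlinarith

lemma htilde_eq (r θ : ℝ) (hr : 0 < r) {h : ℝ → ℝ} {L : ℝ} (hL : 0 ≤ L)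
    (hlip : ∀ u v : ℝ, |h u - h v| ≤ L * |u - v|) (x : ℝ) :
    htilde r θ 1 h x = ∫ t, (h x - h t) * vgDensity r θ 1 t := by
  simp only [sub_mul]
  rw [integral_sub ((vg_integrable r θ hr).const_mul _) (hp_integrable r θ hr hL hlip),
    integral_const_mul, vg_integral r θ hr, mul_one]
  rfl

lemma htilde_bound (r θ : ℝ) (hr : 0 < r) {h : ℝ → ℝ} {L : ℝ} (hL : 0 ≤ L)
    (hlip : ∀ u v : ℝ, |h u - h v| ≤ L * |u - v|) (x : ℝ) :
    |htilde r θ 1 h x| ≤ L * (|x - r*θ| + Real.sqrt (r * (1+2*θ^2))) := by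
  rw [htilde_eq r θ hr hL hlip]
  have hS : 0 < r * (1+2*θ^2) := by positivity
  have hS' : 0 < (x - r*θ)^2 + r * (1+2*θ^2) := by positivity
  set D := Real.sqrt ((x - r*θ)^2 + r * (1+2*θ^2)) with hD
  have hDp : 0 < D := Real.sqrt_pos.mpr hS'
  have hD2 : D^2 = (x - r*θ)^2 + r * (1+2*θ^2) := Real.sq_sqrt hS'.le
  have hw := vg_weighted r θ (L * D/2) (L/(2*D)) x hr (by positivity) (by positivity)
  have h1 : |∫ t, (h x - h t) * vgDensity r θ 1 t| ≤
      ∫ t, (L * D/2 + L/(2*D) * (x - t)^2) * vgDensity r θ 1 t := by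
    rw [← Real.norm_eq_abs]
    apply norm_integral_le_of_norm_le hw.1
    filter_upwards with t
    rw [norm_mul, Real.norm_of_nonneg (vg_nonneg r θ hr t), Real.norm_eq_abs]
    apply mul_le_mul_of_nonneg_right _ (vg_nonneg r θ hr t)
    refine (hlip x t).trans ?_
    have : |x - t| ≤ D/2 + 1/(2*D) * (x-t)^2 := by
      have e : D/2 + 1/(2*D) * (x-t)^2 = (D^2 + (x-t)^2)/(2*D) := by field_simp
      rw [e, le_div_iff₀ (by positivity), ← sq_abs (x-t)]
      nlinarith [sq_nonneg (D - |x-t|)]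
    calc L * |x-t| ≤ L * (D/2 + 1/(2*D) * (x-t)^2) := by gcongr
      _ = _ := by ring
  rw [hw.2, ← hD2] at h1
  have h2 : L * D/2 + L/(2*D) * D^2 = L * D := by field_simp; ring
  rw [h2] at h1
  refine h1.trans ?_
  gcongr
  apply Real.sqrt_le_iff.mpr
  refine ⟨by positivity, ?_⟩
  have := Real.sq_sqrt hS.le
  have := sq_abs (x - r*θ)
  have : 0 ≤ |x-r*θ| * Real.sqrt (r * (1+2*θ^2)) := by positivity
  nlinarith

lemma htilde_lip (r θ σ : ℝ) {h : ℝ → ℝ} {L : ℝ}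
    (hlip : ∀ u v : ℝ, |h u - h v| ≤ L * |u - v|) (x y : ℝ) :
    |htilde r θ σ h x - htilde r θ σ h y| ≤ L * |x - y| := by
  unfold htilde
  simpa using hlip x y

lemma htilde_mean (r θ : ℝ) (hr : 0 < r) {h : ℝ → ℝ} {L : ℝ} (hL : 0 ≤ L)
    (hlip : ∀ u v : ℝ, |h u - h v| ≤ L * |u - v|) :
    Integrable (fun t => htilde r θ 1 h t * vgDensity r θ 1 t) ∧
    ∫ t, htilde r θ 1 h t * vgDensity r θ 1 t = 0 := by
  constructor
  · exact hp_integrable r θ hr hL (htilde_lip r θ 1 hlip)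
  · unfold htilde
    simp only [sub_mul]
    rw [integral_sub (hp_integrable r θ hr hL hlip) ((vg_integrable r θ hr).const_mul _),
      integral_const_mul, vg_integral r θ hr, mul_one, sub_self]

lemma vg_neg (r θ t : ℝ) : vgDensity r (-θ) 1 t = vgDensity r θ 1 (-t) := by
  unfold vgDensity
  simp



/-- Abstract properties of the pair of modified Bessel solutions. -/
structure BPair (r α C0 : ℝ) (Y1 Y1' Y2 Y2' : ℝ → ℝ) : Prop where
  d1 : ∀ x, HasDerivAt Y1 (Y1' x) x
  dd1 : ∀ x, 0 < x → HasDerivAt Y1' (α^2 * Y1 x - r / x * Y1' x) x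
  c1 : Continuous Y1'
  pos1 : ∀ x, 0 ≤ x → 0 < Y1 x
  nn1 : ∀ x, 0 ≤ x → 0 ≤ Y1' x
  d2 : ∀ x, 0 < x → HasDerivAt Y2 (Y2' x) x
  dd2 : ∀ x, 0 < x → HasDerivAt Y2' (α^2 * Y2 x - r / x * Y2' x) x
  pos2 : ∀ x, 0 < x → 0 < Y2 x
  wr : ∀ x, 0 < x → x^r * (Y1' x * Y2 x - Y1 x * Y2' x) = 1
  dec : ∀ x, 0 < x → α * Y2 x ≤ - Y2' x
  bd : ∀ x, 0 < x → x^r * (-Y2' x) ≤ C0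

noncomputable def PP (r θ : ℝ) (Y1 H : ℝ → ℝ) (x : ℝ) : ℝ :=
  ∫ t in (0:ℝ)..x, Real.exp (θ*t) * t^(r-1) * Y1 t * H t

noncomputable def QQ (r θ : ℝ) (Y2 H : ℝ → ℝ) (x : ℝ) : ℝ :=
  ∫ t in Set.Ioi x, Real.exp (θ*t) * t^(r-1) * Y2 t * H t

noncomputable def FF (r θ : ℝ) (Y1 Y2 H : ℝ → ℝ) (x : ℝ) : ℝ :=
  -(Real.exp (-θ*x) * (Y2 x * PP r θ Y1 H x + Y1 x * QQ r θ Y2 H x))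

noncomputable def FF' (r θ : ℝ) (Y1 Y1' Y2 Y2' H : ℝ → ℝ) (x : ℝ) : ℝ :=
  -(θ * FF r θ Y1 Y2 H x) - (Real.exp (-θ*x) * (Y2' x * PP r θ Y1 H x + Y1' x * QQ r θ Y2 H x))

lemma PP_hasDerivAt {r θ : ℝ} {Y1 H : ℝ → ℝ} (hr : 0 < r) (hY : Continuous Y1) (hH : Continuous H)
    {x : ℝ} (hx : 0 < x) :
    HasDerivAt (PP r θ Y1 H) (Real.exp (θ*x) * x^(r-1) * Y1 x * H x) x := by
  have hc : ContinuousOn (fun t : ℝ => Real.exp (θ*t) * t^(r-1) * Y1 t * H t) (Set.Ioi 0) := by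
    have : ContinuousOn (fun t : ℝ => t^(r-1)) (Set.Ioi 0) :=
      ContinuousOn.rpow_const continuousOn_id (fun t ht => Or.inl (ne_of_gt ht))
    fun_prop
  apply intervalIntegral.integral_hasDerivAt_right
  · have h1 : IntervalIntegrable (fun t : ℝ => t^(r-1)) volume 0 x :=
      intervalIntegral.intervalIntegrable_rpow' (by linarith)
    have h2 := h1.mul_continuousOn (g := fun t => Real.exp (θ*t) * Y1 t * H t) (by fun_prop)
    refine h2.congr ?_
    intro t _
    simp only; ring
  · exact hc.stronglyMeasurableAtFilter isOpen_Ioi x hx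
  · exact hc.continuousAt (Ioi_mem_nhds hx)

lemma PP_bound {r θ : ℝ} {Y1 H : ℝ → ℝ} (hr : 0 < r) (hY : Continuous Y1) (hH : Continuous H) :
    ∃ C, 0 ≤ C ∧ ∀ x, 0 < x → x ≤ 1 → |PP r θ Y1 H x| ≤ C * x^r := by
  have hg : Continuous (fun t => Real.exp (θ*t) * Y1 t * H t) := by fun_prop
  obtain ⟨M, hM⟩ := (isCompact_Icc (a := (0:ℝ)) (b := 1)).exists_bound_of_continuousOn hg.continuousOn
  have hM0 : 0 ≤ M := (norm_nonneg _).trans (hM 0 (by simp))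
  refine ⟨M / r, by positivity, ?_⟩
  intro x hx hx1
  have h1 : IntervalIntegrable (fun t : ℝ => M * t^(r-1)) volume 0 x :=
      (intervalIntegral.intervalIntegrable_rpow' (by linarith)).const_mul M
  have h2 : ‖∫ t in (0:ℝ)..x, Real.exp (θ*t) * t^(r-1) * Y1 t * H t‖ ≤ ∫ t in (0:ℝ)..x, M * t^(r-1) := by
    apply intervalIntegral.norm_integral_le_of_norm_le hx.le _ h1
    filter_upwards with t ht
    have := hM t ⟨ht.1.le, ht.2.trans hx1⟩
    have hp : 0 ≤ t^(r-1) := Real.rpow_nonneg ht.1.le _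
    rw [show Real.exp (θ*t) * t^(r-1) * Y1 t * H t = (Real.exp (θ*t) * Y1 t * H t) * t^(r-1) by ring,
      norm_mul, Real.norm_of_nonneg hp]
    gcongr
  rw [intervalIntegral.integral_const_mul, integral_rpow (Or.inl (by linarith))] at h2
  rw [Real.norm_eq_abs] at h2
  unfold PP
  refine h2.trans (le_of_eq ?_)
  rw [sub_add_cancel, Real.zero_rpow hr.ne', sub_zero]; ring

section
variable {r θ α C0 : ℝ} {Y1 Y1' Y2 Y2' H : ℝ → ℝ}

lemma QQ_eq (hQ : IntegrableOn (fun t => Real.exp (θ*t) * t^(r-1) * Y2 t * H t) (Set.Ioi 0))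
    {x : ℝ} (hx : 0 ≤ x) : QQ r θ Y2 H x = QQ r θ Y2 H 0 -
      ∫ t in (0:ℝ)..x, Real.exp (θ*t) * t^(r-1) * Y2 t * H t := by
  unfold QQ
  rw [← Set.Ioc_union_Ioi_eq_Ioi hx, setIntegral_union Set.Ioc_disjoint_Ioi_same measurableSet_Ioi
    (hQ.mono_set Set.Ioc_subset_Ioi_self) (hQ.mono_set (Set.Ioi_subset_Ioi hx)), intervalIntegral.integral_of_le hx]
  ring

lemma QQ_hasDerivAt (hB : BPair r α C0 Y1 Y1' Y2 Y2') (hH : Continuous H)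
    (hQ : IntegrableOn (fun t => Real.exp (θ*t) * t^(r-1) * Y2 t * H t) (Set.Ioi 0))
    {x : ℝ} (hx : 0 < x) :
    HasDerivAt (QQ r θ Y2 H) (-(Real.exp (θ*x) * x^(r-1) * Y2 x * H x)) x := by
  have hc : ContinuousOn (fun t : ℝ => Real.exp (θ*t) * t^(r-1) * Y2 t * H t) (Set.Ioi 0) := by
    have : ContinuousOn (fun t : ℝ => t^(r-1)) (Set.Ioi 0) :=
      ContinuousOn.rpow_const continuousOn_id (fun t ht => Or.inl (ne_of_gt ht))
    have h2 : ContinuousOn Y2 (Set.Ioi 0) := fun t ht => (hB.d2 t ht).continuousAt.continuousWithinAt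
    fun_prop
  have h1 : HasDerivAt (fun x => ∫ t in (0:ℝ)..x, Real.exp (θ*t) * t^(r-1) * Y2 t * H t)
      (Real.exp (θ*x) * x^(r-1) * Y2 x * H x) x := by
    apply intervalIntegral.integral_hasDerivAt_right
    · rw [intervalIntegrable_iff_integrableOn_Ioc_of_le hx.le]
      exact hQ.mono_set Set.Ioc_subset_Ioi_self
    · exact hc.stronglyMeasurableAtFilter isOpen_Ioi x hx
    · exact hc.continuousAt (Ioi_mem_nhds hx)
  have h2 := h1.const_sub (QQ r θ Y2 H 0)
  refine h2.congr_of_eventuallyEq ?_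
  filter_upwards [Ioi_mem_nhds hx] with y hy
  exact QQ_eq hQ (le_of_lt hy)

lemma QQ_tendsto (hQ : IntegrableOn (fun t => Real.exp (θ*t) * t^(r-1) * Y2 t * H t) (Set.Ioi 0)) :
    Tendsto (QQ r θ Y2 H) (nhdsWithin 0 (Set.Ioi 0)) (nhds (QQ r θ Y2 H 0)) := by
  have hI : IntegrableOn (fun t => Real.exp (θ*t) * t^(r-1) * Y2 t * H t) (Set.Icc 0 1) := by
    rw [integrableOn_Icc_iff_integrableOn_Ioc]
    exact hQ.mono_set Set.Ioc_subset_Ioi_self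
  have hc := intervalIntegral.continuousOn_primitive_interval (by rwa [Set.uIcc_of_le (zero_le_one (α := ℝ))])
  have h0 : Tendsto (fun x => ∫ t in (0:ℝ)..x, Real.exp (θ*t) * t^(r-1) * Y2 t * H t)
      (nhdsWithin 0 (Set.Ioi 0)) (nhds 0) := by
    have := hc 0 (by simp)
    rw [Set.uIcc_of_le (zero_le_one (α := ℝ))] at this
    have h := this.tendsto
    rw [intervalIntegral.integral_same] at h
    refine h.mono_left ?_
    rw [← nhdsWithin_Ioc_eq_nhdsGT (zero_lt_one (α := ℝ))]
    exact nhdsWithin_mono _ Set.Ioc_subset_Icc_self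
  have h2 := h0.const_sub (QQ r θ Y2 H 0)
  rw [sub_zero] at h2
  refine h2.congr' ?_
  filter_upwards [self_mem_nhdsWithin] with y hy
  exact (QQ_eq hQ (le_of_lt hy)).symm

lemma Y1_cont (hB : BPair r α C0 Y1 Y1' Y2 Y2') : Continuous Y1 :=
  continuous_iff_continuousAt.mpr fun x => (hB.d1 x).continuousAt

lemma FF_hasDerivAt (hr : 0 < r) (hB : BPair r α C0 Y1 Y1' Y2 Y2') (hH : Continuous H)
    (hQ : IntegrableOn (fun t => Real.exp (θ*t) * t^(r-1) * Y2 t * H t) (Set.Ioi 0))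
    {x : ℝ} (hx : 0 < x) :
    HasDerivAt (FF r θ Y1 Y2 H) (FF' r θ Y1 Y1' Y2 Y2' H x) x := by
  have hP := PP_hasDerivAt (r := r) (θ := θ) hr (Y1_cont hB) hH hx
  have hQ' := QQ_hasDerivAt hB hH hQ hx
  have he : HasDerivAt (fun x => Real.exp (-θ*x)) (Real.exp (-θ*x) * (-θ)) x := by
    have := ((hasDerivAt_id x).const_mul (-θ)).exp
    simpa using this
  have h := (he.mul (((hB.d2 x hx).mul hP).add ((hB.d1 x).mul hQ'))).neg
  refine h.congr_deriv ?_
  unfold FF' FF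
  simp only [Pi.mul_apply, Pi.add_apply]
  ring

lemma FF'_hasDerivAt (hr : 0 < r) (hα : α^2 = 1 + θ^2) (hB : BPair r α C0 Y1 Y1' Y2 Y2') (hH : Continuous H)
    (hQ : IntegrableOn (fun t => Real.exp (θ*t) * t^(r-1) * Y2 t * H t) (Set.Ioi 0))
    {x : ℝ} (hx : 0 < x) :
    HasDerivAt (FF' r θ Y1 Y1' Y2 Y2' H)
      ((H x - (r + 2*θ*x) * FF' r θ Y1 Y1' Y2 Y2' H x - (r*θ - x) * FF r θ Y1 Y2 H x)/x) x := by
  have hP := PP_hasDerivAt (r := r) (θ := θ) hr (Y1_cont hB) hH hx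
  have hQ' := QQ_hasDerivAt hB hH hQ hx
  have he : HasDerivAt (fun x => Real.exp (-θ*x)) (Real.exp (-θ*x) * (-θ)) x := by
    have := ((hasDerivAt_id x).const_mul (-θ)).exp
    simpa using this
  have h := (((FF_hasDerivAt hr hB hH hQ hx).const_mul θ).neg).sub
    (he.mul (((hB.dd2 x hx).mul hP).add ((hB.dd1 x hx).mul hQ')))
  refine h.congr_deriv ?_
  simp only [Pi.mul_apply, Pi.add_apply]
  have hw := hB.wr x hx
  have hxr : x^r = x^(r-1) * x := by
    rw [Real.rpow_sub_one hx.ne']; field_simp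
  rw [hxr] at hw
  have hee : Real.exp (-θ*x) * Real.exp (θ*x) = 1 := by rw [← Real.exp_add]; simp
  rw [eq_div_iff hx.ne']
  unfold FF' FF
  set E := Real.exp (-θ*x)
  set E' := Real.exp (θ*x)
  set P := PP r θ Y1 H x
  set Q := QQ r θ Y2 H x
  set X := x^(r-1)
  have e1 : r / x * x = r := by field_simp
  have e2 : (α^2 * Y2 x - r/x*Y2' x) * x = α^2 * Y2 x * x - r * Y2' x := by rw [sub_mul]; rw [show r/x*Y2' x*x = r/x*x*Y2' x by ring, e1]
  have e3 : (α^2 * Y1 x - r/x*Y1' x) * x = α^2 * Y1 x * x - r * Y1' x := by rw [sub_mul]; rw [show r/x*Y1' x*x = r/x*x*Y1' x by ring, e1]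
  rw [hα] at e2 e3
  rw [hα]
  linear_combination (-E * P) * e2 - E * Q * e3 + E * E' * H x * hw + H x * hee

lemma Y2_small (hr : 0 < r) (hB : BPair r α C0 Y1 Y1' Y2 Y2') (hα : 0 < α) :
    Tendsto (fun x => x^r * Y2 x) (nhdsWithin 0 (Set.Ioi 0)) (nhds 0) := by
  have hC : 0 ≤ C0 := by
    have h1 := hB.bd 1 one_pos
    have h2 := hB.dec 1 one_pos
    have h3 := hB.pos2 1 one_pos
    rw [Real.one_rpow] at h1
    nlinarith
  have key : ∀ x ε, 0 < x → x < ε → x^r * Y2 x ≤ x^r * Y2 ε + C0 * ε := by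
    intro x ε hx hxe
    have h := (convex_Icc x ε).norm_image_sub_le_of_norm_hasDerivWithin_le (f := Y2) (f' := Y2')
      (C := C0 * (x^r)⁻¹) (x := x) (y := ε)
      (fun t ht => (hB.d2 t (lt_of_lt_of_le hx ht.1)).hasDerivWithinAt) ?_ (by simp [hxe.le]) (by simp [hxe.le])
    · rw [Real.norm_eq_abs, Real.norm_eq_abs] at h
      have h2 : Y2 x - Y2 ε ≤ C0 * (x^r)⁻¹ * |ε - x| := by
        refine le_trans ?_ h
        rw [abs_sub_comm]; exact le_abs_self _
      rw [abs_of_pos (by linarith)] at h2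
      have hxr : 0 < x^r := by positivity
      have h3 : x^r * (Y2 x - Y2 ε) ≤ x^r * (C0 * (x^r)⁻¹ * (ε - x)) := by gcongr
      have h4 : x^r * (C0 * (x^r)⁻¹ * (ε - x)) = C0 * (ε - x) := by field_simp
      nlinarith
    · intro t ht
      have ht0 : 0 < t := lt_of_lt_of_le hx ht.1
      have h1 := hB.dec t ht0
      have h2 := hB.pos2 t ht0
      have h3 := hB.bd t ht0
      have h4 : Y2' t ≤ 0 := by nlinarith
      rw [Real.norm_eq_abs, abs_of_nonpos h4]
      have h5 : x^r ≤ t^r := by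
        have := ht.1
        gcongr
      have hxr : 0 < x^r := by positivity
      rw [← div_eq_mul_inv, le_div_iff₀ hxr]
      nlinarith
  rw [Metric.tendsto_nhdsWithin_nhds]
  intro δ hδ
  set ε := δ / (2*(C0+1)) with hε
  have hεp : 0 < ε := by positivity
  have ht : Tendsto (fun x : ℝ => x^r * Y2 ε) (nhds 0) (nhds 0) := by
    have : ContinuousAt (fun x : ℝ => x^r * Y2 ε) 0 :=
      (Real.continuousAt_rpow_const _ _ (Or.inr hr.le)).mul continuousAt_const
    have h := this.tendsto
    simp only [Real.zero_rpow hr.ne', zero_mul] at h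
    exact h
  rw [Metric.tendsto_nhds_nhds] at ht
  obtain ⟨d, hd, hd2⟩ := ht (δ/2) (by positivity)
  refine ⟨min d ε, by positivity, ?_⟩
  intro x hx hxd
  have hx : 0 < x := hx
  rw [Real.dist_eq, sub_zero] at hxd ⊢
  have h1 := hd2 (x := x) (by rw [Real.dist_eq, sub_zero]; exact hxd.trans_le (min_le_left _ _))
  rw [Real.dist_eq, sub_zero] at h1
  rw [abs_of_pos hx] at hxd
  have h2 := key x ε hx (hxd.trans_le (min_le_right _ _))
  have h3 : 0 < x^r * Y2 x := by
    have := hB.pos2 x hx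
    positivity
  rw [abs_of_pos h3]
  have h4 : C0 * ε ≤ δ/2 := by
    rw [hε, mul_div_assoc', div_le_iff₀ (by positivity)]
    nlinarith
  have := le_abs_self (x^r * Y2 ε)
  linarith

lemma PP_zero (hr : 0 < r) (hY : Continuous Y1) (hH : Continuous H) {Z : ℝ → ℝ}
    (hZ : Tendsto (fun x => x^r * Z x) (nhdsWithin 0 (Set.Ioi 0)) (nhds 0)) :
    Tendsto (fun x => Z x * PP r θ Y1 H x) (nhdsWithin 0 (Set.Ioi 0)) (nhds 0) := by
  obtain ⟨C, hC0, hC⟩ := PP_bound (θ := θ) hr hY hH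
  have h1 : Tendsto (fun x => C * |x^r * Z x|) (nhdsWithin 0 (Set.Ioi 0)) (nhds 0) := by
    have := hZ.abs.const_mul C
    simpa using this
  refine squeeze_zero_norm' ?_ h1
  filter_upwards [Ioc_mem_nhdsGT (zero_lt_one (α := ℝ))] with x hx
  have hxr : 0 < x^r := Real.rpow_pos_of_pos hx.1 _
  rw [norm_mul, Real.norm_eq_abs, Real.norm_eq_abs, abs_mul, abs_of_pos hxr]
  have := hC x hx.1 hx.2
  nlinarith [abs_nonneg (Z x)]

lemma rpow_zero_tendsto (hr : 0 < r) : Tendsto (fun x : ℝ => x^r) (nhdsWithin 0 (Set.Ioi 0)) (nhds 0) := by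
  have : ContinuousAt (fun x : ℝ => x^r) 0 := Real.continuousAt_rpow_const _ _ (Or.inr hr.le)
  have h := this.tendsto
  simp only [Real.zero_rpow hr.ne'] at h
  exact h.mono_left nhdsWithin_le_nhds

lemma FF_zero (hr : 0 < r) (hα : 0 < α) (hB : BPair r α C0 Y1 Y1' Y2 Y2') (hH : Continuous H)
    (hQ : IntegrableOn (fun t => Real.exp (θ*t) * t^(r-1) * Y2 t * H t) (Set.Ioi 0)) :
    Tendsto (FF r θ Y1 Y2 H) (nhdsWithin 0 (Set.Ioi 0)) (nhds (-(Y1 0 * QQ r θ Y2 H 0))) := by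
  have h1 := PP_zero (θ := θ) hr (Y1_cont hB) hH (Y2_small hr hB hα)
  have h2 : Tendsto Y1 (nhdsWithin 0 (Set.Ioi 0)) (nhds (Y1 0)) :=
    ((Y1_cont hB).tendsto 0).mono_left nhdsWithin_le_nhds
  have h3 : Tendsto (fun x => Real.exp (-θ*x)) (nhdsWithin 0 (Set.Ioi 0)) (nhds 1) := by
    have : Continuous (fun x => Real.exp (-θ*x)) := by fun_prop
    have h := (this.tendsto 0).mono_left (nhdsWithin_le_nhds (s := Set.Ioi 0))
    simpa using h
  have := (h3.mul (h1.add (h2.mul (QQ_tendsto hQ)))).neg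
  rw [zero_add, one_mul] at this
  exact this

lemma FF'_zero (hr : 0 < r) (hα : 0 < α) (hB : BPair r α C0 Y1 Y1' Y2 Y2') (hH : Continuous H)
    (hQ : IntegrableOn (fun t => Real.exp (θ*t) * t^(r-1) * Y2 t * H t) (Set.Ioi 0)) :
    Tendsto (fun x => x^r * FF' r θ Y1 Y1' Y2 Y2' H x) (nhdsWithin 0 (Set.Ioi 0)) (nhds 0) := by
  have h0 := rpow_zero_tendsto hr
  have h1 : Tendsto (fun x => (x^r * Y2' x) * PP r θ Y1 H x) (nhdsWithin 0 (Set.Ioi 0)) (nhds 0) := by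
    apply PP_zero hr (Y1_cont hB) hH
    refine squeeze_zero_norm' (a := fun x => C0 * x^r) ?_ ?_
    · filter_upwards [self_mem_nhdsWithin] with x hx
      have hx : 0 < x := hx
      have h1 := hB.dec x hx
      have h2 := hB.pos2 x hx
      have h3 := hB.bd x hx
      have h4 : Y2' x ≤ 0 := by nlinarith
      have hxr : 0 < x^r := Real.rpow_pos_of_pos hx _
      rw [norm_mul, norm_mul, Real.norm_of_nonneg hxr.le, Real.norm_of_nonpos h4]
      nlinarith
    · simpa using h0.const_mul C0
  have h2 : Tendsto Y1' (nhdsWithin 0 (Set.Ioi 0)) (nhds (Y1' 0)) :=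
    (hB.c1.tendsto 0).mono_left nhdsWithin_le_nhds
  have h3 : Tendsto (fun x => Real.exp (-θ*x)) (nhdsWithin 0 (Set.Ioi 0)) (nhds 1) := by
    have : Continuous (fun x => Real.exp (-θ*x)) := by fun_prop
    have h := (this.tendsto 0).mono_left (nhdsWithin_le_nhds (s := Set.Ioi 0))
    simpa using h
  have h4 := FF_zero hr hα hB hH hQ
  have := ((h0.mul (h4.const_mul θ)).neg).sub (h3.mul (h1.add ((h0.mul h2).mul (QQ_tendsto hQ))))
  simp only [zero_mul, neg_zero, add_zero, mul_zero, sub_zero] at this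
  refine this.congr ?_
  intro x
  unfold FF'
  ring

lemma Y2_decay (hB : BPair r α C0 Y1 Y1' Y2 Y2') {t x : ℝ} (ht : 0 < t) (htx : t ≤ x) :
    Y2 x ≤ Y2 t * Real.exp (-α*(x-t)) := by
  have hd : ∀ y, 0 < y → HasDerivAt (fun y => Y2 y * Real.exp (α*y)) ((Y2' y + α * Y2 y) * Real.exp (α*y)) y := by
    intro y hy
    have he : HasDerivAt (fun x => Real.exp (α*x)) (Real.exp (α*y) * α) y := by
      have := ((hasDerivAt_id y).const_mul α).exp
      simpa using this
    refine ((hB.d2 y hy).mul he).congr_deriv ?_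
    ring
  have hanti : AntitoneOn (fun y => Y2 y * Real.exp (α*y)) (Set.Ioi 0) := by
    apply antitoneOn_of_deriv_nonpos (convex_Ioi 0)
    · exact fun y hy => (hd y hy).continuousAt.continuousWithinAt
    · rw [interior_Ioi]; exact fun y hy => (hd y hy).differentiableAt.differentiableWithinAt
    · rw [interior_Ioi]; intro y hy
      rw [(hd y hy).deriv]
      have := hB.dec y hy
      have h2 := Real.exp_pos (α*y)
      nlinarith
  have h := hanti ht (ht.trans_le htx) htx
  simp only at h
  have e : Real.exp (-α*(x-t)) = Real.exp (α*t) * Real.exp (-(α*x)) := by rw [← Real.exp_add]; ring_nf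
  have e2 : Real.exp (α*x) * Real.exp (-(α*x)) = 1 := by rw [← Real.exp_add]; simp
  calc Y2 x = (Y2 x * Real.exp (α*x)) * Real.exp (-(α*x)) := by rw [mul_assoc, e2, mul_one]
    _ ≤ (Y2 t * Real.exp (α*t)) * Real.exp (-(α*x)) := by gcongr
    _ = _ := by rw [e]; ring

lemma Y1Y2_le (hB : BPair r α C0 Y1 Y1' Y2 Y2') {t : ℝ} (ht : 0 < t) :
    α * (t^r * (Y1 t * Y2 t)) ≤ 1 := by
  have h1 := hB.wr t ht
  have h2 := hB.dec t ht
  have h3 := hB.pos1 t ht.le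
  have h4 := hB.nn1 t ht.le
  have h5 := hB.pos2 t ht
  have hp : 0 < t^r := Real.rpow_pos_of_pos ht _
  have h6 : 0 ≤ t^r * (Y1' t * Y2 t) := by positivity
  have h7 : t^r * Y1 t * (α * Y2 t) ≤ t^r * Y1 t * (-Y2' t) := by gcongr
  nlinarith

lemma FF_growth (hr : 0 < r) (hα : |θ| < α) (hB : BPair r α C0 Y1 Y1' Y2 Y2') (hH : Continuous H)
    (hQ : IntegrableOn (fun t => Real.exp (θ*t) * t^(r-1) * Y2 t * H t) (Set.Ioi 0))
    {C : ℝ} (hC : 0 ≤ C) (hHb : ∀ t, 0 < t → |H t| ≤ C * (1+t)) :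
    ∃ K X0 : ℝ, ∀ x, X0 ≤ x → |FF r θ Y1 Y2 H x| ≤ K * (1 + x) := by
  have hα0 : 0 < α := (abs_nonneg _).trans_lt hα
  obtain ⟨hb, ha⟩ := abs_lt.mp hα
  set a := α - θ with ha'
  have hap : 0 < a := by linarith
  have hbp : 0 < α + θ := by linarith
  set M1 := Y2 1 * Real.exp α * |PP r θ Y1 H 1| with hM1
  have hY21 := hB.pos2 1 one_pos
  refine ⟨M1 + 2*C/α + (2*C/α) * (2/a), max 1 (2*r/a), ?_⟩
  intro x hx
  have hx1 : 1 ≤ x := (le_max_left _ _).trans hx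
  have hx2 : 2*r/a ≤ x := (le_max_right _ _).trans hx
  have hx0 : 0 < x := by linarith
  have hY1x := hB.pos1 x hx0.le
  have hY2x := hB.pos2 x hx0
  have hHt : ∀ t, 1 ≤ t → |H t| ≤ 2 * C * t := by
    intro t ht
    refine (hHb t (by linarith)).trans ?_
    nlinarith
  have hsplit : PP r θ Y1 H x = PP r θ Y1 H 1 + ∫ t in (1:ℝ)..x, Real.exp (θ*t) * t^(r-1) * Y1 t * H t := by
    have hc := Y1_cont hB
    have hi : ∀ u v : ℝ, IntervalIntegrable (fun t : ℝ => Real.exp (θ*t) * t^(r-1) * Y1 t * H t) volume u v := by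
      intro u v
      have h1 : IntervalIntegrable (fun t : ℝ => t^(r-1)) volume u v :=
        intervalIntegral.intervalIntegrable_rpow' (by linarith)
      have h2 := h1.mul_continuousOn (g := fun t => Real.exp (θ*t) * Y1 t * H t) (by fun_prop)
      refine h2.congr ?_
      intro t _
      simp only; ring
    unfold PP
    rw [intervalIntegral.integral_add_adjacent_intervals (hi _ _) (hi _ _)]
  have b1 : |Real.exp (-θ*x) * (Y2 x * PP r θ Y1 H 1)| ≤ M1 := by
    rw [abs_mul, abs_mul, abs_of_pos (Real.exp_pos _), abs_of_pos hY2x, hM1]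
    have h := Y2_decay hB one_pos hx1
    have e : Real.exp (-θ*x) * Real.exp (-α*(x-1)) ≤ Real.exp α := by
      rw [← Real.exp_add]; apply Real.exp_le_exp.mpr; nlinarith
    calc Real.exp (-θ*x) * (Y2 x * |PP r θ Y1 H 1|)
        ≤ Real.exp (-θ*x) * ((Y2 1 * Real.exp (-α*(x-1))) * |PP r θ Y1 H 1|) := by gcongr
      _ = Y2 1 * (Real.exp (-θ*x) * Real.exp (-α*(x-1))) * |PP r θ Y1 H 1| := by ring
      _ ≤ _ := by gcongr
  have b2 : |Real.exp (-θ*x) * (Y2 x * ∫ t in (1:ℝ)..x, Real.exp (θ*t) * t^(r-1) * Y1 t * H t)| ≤ 2*C/α * x := by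
    rw [← intervalIntegral.integral_const_mul, ← intervalIntegral.integral_const_mul, ← Real.norm_eq_abs]
    have h := intervalIntegral.norm_integral_le_of_norm_le_const (a := 1) (b := x) (C := 2*C/α)
      (f := fun t => Real.exp (-θ*x) * (Y2 x * (Real.exp (θ*t) * t^(r-1) * Y1 t * H t))) ?_
    · refine h.trans ?_
      rw [abs_of_nonneg (by linarith)]
      have : 0 ≤ 2*C/α := by positivity
      nlinarith
    · intro t ht
      rw [Set.uIoc_of_le hx1] at ht
      have ht0 : 0 < t := by linarith [ht.1]
      have hY1t := hB.pos1 t ht0.le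
      have hY2t := hB.pos2 t ht0
      have hp : 0 < t^(r-1) := Real.rpow_pos_of_pos ht0 _
      have hxr : t^r = t^(r-1) * t := by
        rw [Real.rpow_sub_one ht0.ne']; field_simp
      have h1 := Y2_decay hB ht0 ht.2
      have h2 := Y1Y2_le hB ht0
      have h3 := hHt t ht.1.le
      have e : Real.exp (-θ*x) * Real.exp (θ*t) * Real.exp (-α*(x-t)) ≤ 1 := by
        rw [← Real.exp_add, ← Real.exp_add]; apply Real.exp_le_one_iff.mpr; nlinarith [ht.2]
      rw [Real.norm_eq_abs, show Real.exp (-θ*x) * (Y2 x * (Real.exp (θ*t) * t^(r-1) * Y1 t * H t)) =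
        (Real.exp (-θ*x) * Real.exp (θ*t) * t^(r-1) * Y1 t * Y2 x) * H t by ring, abs_mul, abs_of_pos (by positivity)]
      calc (Real.exp (-θ*x) * Real.exp (θ*t) * t^(r-1) * Y1 t * Y2 x) * |H t|
          ≤ (Real.exp (-θ*x) * Real.exp (θ*t) * t^(r-1) * Y1 t * (Y2 t * Real.exp (-α*(x-t)))) * (2*C*t) := by gcongr
        _ = (Real.exp (-θ*x) * Real.exp (θ*t) * Real.exp (-α*(x-t))) * (2*C) * (t^r * (Y1 t * Y2 t)) := by rw [hxr]; ring
        _ ≤ 1 * (2*C) * (1/α) := by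
            gcongr
            rw [le_div_iff₀ hα0]; linarith
        _ = _ := by ring
  have hIe : IntegrableOn (fun t => 2*C/α * Real.exp (a/2*x) * Real.exp (-(a/2)*t)) (Set.Ioi x) :=
    (integrableOn_exp_mul_Ioi (by linarith) x).const_mul _
  have b3 : |Real.exp (-θ*x) * (Y1 x * QQ r θ Y2 H x)| ≤ 2*C/α * (2/a) := by
    unfold QQ
    rw [← integral_const_mul, ← integral_const_mul, ← Real.norm_eq_abs]
    have h := norm_integral_le_of_norm_le (μ := volume.restrict (Set.Ioi x))
      (f := fun t => Real.exp (-θ*x) * (Y1 x * (Real.exp (θ*t) * t^(r-1) * Y2 t * H t))) hIe ?_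
    · refine h.trans (le_of_eq ?_)
      rw [integral_const_mul, integral_exp_mul_Ioi (by linarith)]
      have : Real.exp (a/2*x) * Real.exp (-(a/2)*x) = 1 := by rw [← Real.exp_add]; ring_nf; simp
      field_simp
      rw [show a/2*x = a*x/2 by ring, show -(a/2)*x = -(a*x/2) by ring] at this
      linear_combination C * this
    · filter_upwards [ae_restrict_mem measurableSet_Ioi] with t ht
      have ht : x < t := ht
      have ht0 : 0 < t := by linarith
      have hY2t := hB.pos2 t ht0
      have hp : 0 < t^(r-1) := Real.rpow_pos_of_pos ht0 _
      have hxr : t^r = t^(r-1) * t := by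
        rw [Real.rpow_sub_one ht0.ne']; field_simp
      have h1 := Y2_decay hB hx0 ht.le
      have h2 := Y1Y2_le hB hx0
      have h3 := hHt t (by linarith)
      have h4 : t^r ≤ x^r * Real.exp (a/2*(t-x)) := by
        have e1 : t/x ≤ Real.exp ((t-x)/x) := by
          have := Real.add_one_le_exp ((t-x)/x)
          refine le_trans (le_of_eq ?_) this
          field_simp; ring
        have e2 : (t/x)^r ≤ Real.exp ((t-x)/x)^r := Real.rpow_le_rpow (by positivity) e1 hr.le
        rw [Real.div_rpow ht0.le hx0.le, div_le_iff₀ (by positivity), ← Real.exp_mul, mul_comm] at e2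
        refine e2.trans ?_
        apply mul_le_mul_of_nonneg_left _ (Real.rpow_nonneg hx0.le _)
        apply Real.exp_le_exp.mpr
        rw [div_mul_eq_mul_div, div_le_iff₀ hx0]
        rw [div_le_iff₀ hap] at hx2
        nlinarith
      rw [Real.norm_eq_abs, show Real.exp (-θ*x) * (Y1 x * (Real.exp (θ*t) * t^(r-1) * Y2 t * H t)) =
        (Real.exp (-θ*x) * Real.exp (θ*t) * t^(r-1) * Y1 x * Y2 t) * H t by ring, abs_mul, abs_of_pos (by positivity)]
      calc (Real.exp (-θ*x) * Real.exp (θ*t) * t^(r-1) * Y1 x * Y2 t) * |H t|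
          ≤ (Real.exp (-θ*x) * Real.exp (θ*t) * t^(r-1) * Y1 x * (Y2 x * Real.exp (-α*(t-x)))) * (2*C*t) := by gcongr
        _ = (Real.exp (-θ*x) * Real.exp (θ*t) * Real.exp (-α*(t-x))) * (2*C) * t^r * (Y1 x * Y2 x) := by rw [hxr]; ring
        _ ≤ (Real.exp (-θ*x) * Real.exp (θ*t) * Real.exp (-α*(t-x))) * (2*C) * (x^r * Real.exp (a/2*(t-x))) * (Y1 x * Y2 x) := by gcongr
        _ = (Real.exp (-θ*x) * Real.exp (θ*t) * Real.exp (-α*(t-x)) * Real.exp (a/2*(t-x))) * (2*C) * (x^r * (Y1 x * Y2 x)) := by ring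
        _ = (Real.exp (a/2*x) * Real.exp (-(a/2)*t)) * (2*C) * (x^r * (Y1 x * Y2 x)) := by
            congr 2
            rw [← Real.exp_add, ← Real.exp_add, ← Real.exp_add, ← Real.exp_add]
            congr 1; rw [ha']; ring
        _ ≤ (Real.exp (a/2*x) * Real.exp (-(a/2)*t)) * (2*C) * (1/α) := by
            gcongr
            rw [le_div_iff₀ hα0]; linarith
        _ = _ := by ring
  have hfin : FF r θ Y1 Y2 H x = -(Real.exp (-θ*x) * (Y2 x * PP r θ Y1 H 1)
      + Real.exp (-θ*x) * (Y2 x * ∫ t in (1:ℝ)..x, Real.exp (θ*t) * t^(r-1) * Y1 t * H t)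
      + Real.exp (-θ*x) * (Y1 x * QQ r θ Y2 H x)) := by
    unfold FF; rw [hsplit]; ring
  rw [hfin, abs_neg]
  refine (abs_add_three _ _ _).trans ?_
  have hM1p : 0 ≤ M1 := by positivity
  have : 0 ≤ 2*C/α := by positivity
  have : 0 ≤ 2*C/α*(2/a) := by positivity
  nlinarith

end



noncomputable def cY1 (r θ x : ℝ) : ℝ := bG ((r-1)/2) ((1+θ^2)*x^2/4)
noncomputable def cY1' (r θ x : ℝ) : ℝ := bG ((r-1)/2+1) ((1+θ^2)*x^2/4) * ((1+θ^2)*x/2)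
noncomputable def cY2 (r θ x : ℝ) : ℝ :=
  1/2 * ((1+θ^2)/4)^((r-1)/2) * bN (-((r-1)/2)) ((1+θ^2)*x^2/4)
noncomputable def cY2' (r θ x : ℝ) : ℝ :=
  -(1/2 * ((1+θ^2)/4)^((r-1)/2) * bN (-((r-1)/2)-1) ((1+θ^2)*x^2/4) * ((1+θ^2)*x/2))

lemma cY2_mul (r θ : ℝ) {x : ℝ} (hx : 0 < x) : x^(r-1) * cY2 r θ x = 1/2 * bN ((r-1)/2) ((1+θ^2)*x^2/4) := by
  have hq : 0 < 1 + θ^2 := by positivity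
  unfold cY2
  set ν := (r-1)/2 with hν
  rw [bN_symm ν (by positivity)]
  have e1 : (((1+θ^2)*x^2/4))^(-ν) = (((1+θ^2)/4)^ν)⁻¹ * (x^(r-1))⁻¹ := by
    rw [Real.rpow_neg (by positivity), show (1+θ^2)*x^2/4 = (1+θ^2)/4 * x^2 by ring,
      Real.mul_rpow (by positivity) (by positivity), mul_inv, ← Real.rpow_natCast x 2, ← Real.rpow_mul hx.le]
    congr 3; rw [hν]; push_cast; ring
  rw [e1]
  have h1 : 0 < x^(r-1) := by positivity
  have h2 : 0 < ((1+θ^2)/4)^ν := by positivity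
  field_simp

lemma cY2'_mul (r θ : ℝ) {x : ℝ} (hx : 0 < x) : x^r * cY2' r θ x = - bN ((r-1)/2+1) ((1+θ^2)*x^2/4) := by
  have hq : 0 < 1 + θ^2 := by positivity
  unfold cY2'
  set ν := (r-1)/2 with hν
  rw [show -ν-1 = -(ν+1) by ring, bN_symm (ν+1) (by positivity)]
  have e1 : (((1+θ^2)*x^2/4))^(-(ν+1)) = (((1+θ^2)/4)^ν)⁻¹ * ((1+θ^2)/4)⁻¹ * ((x^r)⁻¹ * x⁻¹) := by
    rw [Real.rpow_neg (by positivity), show (1+θ^2)*x^2/4 = (1+θ^2)/4 * x^2 by ring,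
      Real.mul_rpow (by positivity) (by positivity), mul_inv, ← Real.rpow_natCast x 2, ← Real.rpow_mul hx.le,
      Real.rpow_add_one (by positivity), mul_inv, ← mul_inv (x^r), ← Real.rpow_add_one hx.ne']
    congr 3; rw [hν]; push_cast; ring
  rw [e1]
  have h1 : 0 < x^r := by positivity
  have h2 : 0 < ((1+θ^2)/4)^ν := by positivity
  field_simp
  ring

lemma cPair (r θ : ℝ) (hr : 0 < r) : BPair r (Real.sqrt (1+θ^2)) (Real.Gamma ((r-1)/2+1))
    (cY1 r θ) (cY1' r θ) (cY2 r θ) (cY2' r θ) := by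
  have hq : 0 < 1 + θ^2 := by positivity
  have hν : -1/2 < (r-1)/2 := by linarith
  have hα : Real.sqrt (1+θ^2)^2 = 1 + θ^2 := Real.sq_sqrt hq.le
  have hu : ∀ x, HasDerivAt (fun x : ℝ => (1+θ^2)*x^2/4) ((1+θ^2)*x/2) x := by
    intro x
    refine (((hasDerivAt_pow 2 x).const_mul (1+θ^2)).div_const 4).congr_deriv ?_
    norm_num; ring
  have hl : ∀ x, HasDerivAt (fun x : ℝ => (1+θ^2)*x/2) ((1+θ^2)/2) x := by
    intro x
    refine (((hasDerivAt_id x).const_mul (1+θ^2)).div_const 2).congr_deriv ?_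
    norm_num
  have hbG : ∀ μ, -1 < μ → Continuous (bG μ) := fun μ hμ =>
    continuous_iff_continuousAt.mpr fun x => (bG_hasDerivAt hμ x).continuousAt
  constructor
  · intro x
    exact (bG_hasDerivAt (by linarith) _).comp x (hu x)
  · intro x hx
    have h := ((bG_hasDerivAt (μ := (r-1)/2+1) (by linarith) ((1+θ^2)*x^2/4)).comp x (hu x)).mul (hl x)
    refine h.congr_deriv ?_
    have hrec := bG_rec (μ := (r-1)/2) (by linarith) ((1+θ^2)*x^2/4)
    rw [show (r-1)/2+1+1 = (r-1)/2+2 by ring]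
    unfold cY1 cY1'
    simp only [Function.comp_apply]
    rw [hα]
    have : r / x * (bG ((r-1)/2+1) ((1+θ^2)*x^2/4) * ((1+θ^2)*x/2)) = r * (1+θ^2)/2 * bG ((r-1)/2+1) ((1+θ^2)*x^2/4) := by
      field_simp
    rw [this]
    linear_combination (1+θ^2) * hrec
  · have := hbG ((r-1)/2+1) (by linarith)
    unfold cY1'
    fun_prop
  · intro x hx
    exact bG_pos (by linarith) (by positivity)
  · intro x hx
    have := bG_pos (μ := (r-1)/2+1) (by linarith) (u := (1+θ^2)*x^2/4) (by positivity)
    unfold cY1'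
    positivity
  · intro x hx
    have h := ((bN_hasDerivAt (-((r-1)/2)) (u := (1+θ^2)*x^2/4) (by positivity)).comp x (hu x)).const_mul (1/2 * ((1+θ^2)/4)^((r-1)/2))
    refine h.congr_deriv ?_
    unfold cY2'
    ring
  · intro x hx
    have h := ((((bN_hasDerivAt (-((r-1)/2)-1) (u := (1+θ^2)*x^2/4) (by positivity)).comp x (hu x)).const_mul (1/2 * ((1+θ^2)/4)^((r-1)/2))).mul (hl x)).neg
    refine h.congr_deriv ?_
    have hrec := bN_rec (-((r-1)/2)-1) (u := (1+θ^2)*x^2/4) (by positivity)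
    unfold cY2 cY2'
    simp only [Function.comp_apply]
    rw [hα]
    rw [show -((r-1)/2)-1+1 = -((r-1)/2) by ring] at hrec
    rw [hrec]
    field_simp
    ring
  · intro x hx
    have := bN_pos (-((r-1)/2)) (u := (1+θ^2)*x^2/4) (by positivity)
    unfold cY2
    positivity
  · intro x hx
    have h1 := cY2_mul r θ hx
    have h2 := cY2'_mul r θ hx
    have hw := bessel_wronskian (ν := (r-1)/2) (by linarith) (u := (1+θ^2)*x^2/4) (by positivity)
    have hxr : x^r = x^(r-1) * x := by
      rw [Real.rpow_sub_one hx.ne']; field_simp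
    have e : x^r * (cY1' r θ x * cY2 r θ x - cY1 r θ x * cY2' r θ x) =
      cY1' r θ x * x * (x^(r-1) * cY2 r θ x) - cY1 r θ x * (x^r * cY2' r θ x) := by rw [hxr]; ring
    rw [e, h1, h2]
    unfold cY1 cY1'
    linear_combination hw
  · intro x hx
    have h := bN_mono_aux hν (u := (1+θ^2)*x^2/4) (by positivity)
    have hs : Real.sqrt ((1+θ^2)*x^2/4) = Real.sqrt (1+θ^2) * x / 2 := by
      rw [show (1+θ^2)*x^2/4 = (1+θ^2)*(x/2)^2 by ring, Real.sqrt_mul hq.le, Real.sqrt_sq (by positivity)]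
      ring
    rw [hs] at h
    unfold cY2 cY2'
    set κ := ((1+θ^2)/4)^((r-1)/2)
    have hk : 0 < κ := by positivity
    have h2 : Real.sqrt (1+θ^2) * (1/2*κ) * bN (-((r-1)/2)) ((1+θ^2)*x^2/4) ≤
      Real.sqrt (1+θ^2) * (1/2*κ) * (Real.sqrt (1+θ^2) * x / 2 * bN (-((r-1)/2)-1) ((1+θ^2)*x^2/4)) := by gcongr
    have e : Real.sqrt (1+θ^2) * (1/2*κ) * (Real.sqrt (1+θ^2) * x / 2 * bN (-((r-1)/2)-1) ((1+θ^2)*x^2/4)) =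
      Real.sqrt (1+θ^2)^2 * (1/2*κ) * ( x / 2 * bN (-((r-1)/2)-1) ((1+θ^2)*x^2/4)) := by ring
    rw [e, hα] at h2
    nlinarith
  · intro x hx
    rw [mul_neg, cY2'_mul r θ hx, neg_neg]
    exact bN_le_Gamma (by linarith) (by positivity)

/-- The Stein solution on the positive half line. -/
lemma stein_eq_FF (r θ : ℝ) (h : ℝ → ℝ) {x : ℝ} (hx : 0 < x) :
    steinSolution r θ 1 h x = FF r θ (cY1 r θ) (cY2 r θ) (htilde r θ 1 h) x := by
  have hq : 0 < 1 + θ^2 := by positivity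
  set α := Real.sqrt (1+θ^2) with hα
  have hαp : 0 < α := Real.sqrt_pos.mpr hq
  have hα2 : α^2 = 1 + θ^2 := Real.sq_sqrt hq.le
  have e0 : Real.sqrt (θ^2 + 1^2) = α := by rw [hα]; congr 1; ring
  have eu : ∀ t : ℝ, (α * t)^2/4 = (1+θ^2)*t^2/4 := by intro t; rw [mul_pow, hα2]
  set ν := (r-1)/2 with hν
  have eI : ∀ t, 0 < t → t^ν * besselI ν (α*t) = (α/2)^ν * (t^(r-1) * cY1 r θ t) := by
    intro t ht
    rw [besselI_eq_bG ν (by positivity), eu, show α*t/2 = α/2*t by ring, Real.mul_rpow (by positivity) ht.le]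
    have : t^(r-1) = t^ν * t^ν := by rw [← Real.rpow_add ht]; congr 1; rw [hν]; ring
    rw [this]; unfold cY1; ring
  have eK : ∀ t, 0 < t → t^ν * besselK ν (α*t) = ((α/2)^ν)⁻¹ * (t^(r-1) * cY2 r θ t) := by
    intro t ht
    rw [cY2_mul r θ ht, besselK_eq_bN ν (by positivity), eu, show α*t/2 = α/2*t by ring,
      Real.mul_rpow (by positivity) ht.le, Real.rpow_neg ht.le, Real.rpow_neg (by positivity)]
    have : 0 < t^ν := by positivity
    field_simp
    rw [hν]
  have hxν : 0 < x^ν := by positivity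
  have hx1 : x^(r-1) = x^ν * x^ν := by rw [← Real.rpow_add hx]; congr 1; rw [hν]; ring
  have hk : 0 < (α/2)^ν := by positivity
  have eI' : besselI ν (α*x) / x^ν = (α/2)^ν * cY1 r θ x := by
    have := eI x hx
    rw [hx1] at this
    rw [div_eq_iff hxν.ne']
    apply mul_left_cancel₀ hxν.ne'
    rw [this]; ring
  have eK' : besselK ν (α*x) / x^ν = ((α/2)^ν)⁻¹ * cY2 r θ x := by
    have := eK x hx
    rw [hx1] at this
    rw [div_eq_iff hxν.ne']
    apply mul_left_cancel₀ hxν.ne'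
    rw [this]; ring
  have i1 : (∫ t in (0:ℝ)..x, Real.exp (θ * t) * |t| ^ ν * besselI ν (α * |t|) * htilde r θ 1 h t)
      = (α/2)^ν * PP r θ (cY1 r θ) (htilde r θ 1 h) x := by
    unfold PP
    rw [← intervalIntegral.integral_const_mul, intervalIntegral.integral_of_le hx.le,
      intervalIntegral.integral_of_le hx.le]
    apply setIntegral_congr_fun measurableSet_Ioc
    intro t ht
    simp only
    rw [abs_of_pos ht.1]
    linear_combination Real.exp (θ*t) * htilde r θ 1 h t * eI t ht.1
  have i2 : (∫ t in Set.Ioi x, Real.exp (θ * t) * |t| ^ ν * besselK ν (α * |t|) * htilde r θ 1 h t)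
      = ((α/2)^ν)⁻¹ * QQ r θ (cY2 r θ) (htilde r θ 1 h) x := by
    unfold QQ
    rw [← integral_const_mul]
    apply setIntegral_congr_fun measurableSet_Ioi
    intro t ht
    have ht0 : 0 < t := hx.trans ht
    simp only
    rw [abs_of_pos ht0]
    linear_combination Real.exp (θ*t) * htilde r θ 1 h t * eK t ht0
  unfold steinSolution
  rw [e0]
  simp only [one_pow, div_one, one_mul]
  rw [i1, i2, abs_of_pos hx, mul_div_assoc, mul_div_assoc, eI', eK']
  unfold FF
  field_simp
  ring

/-- Integrability of the tail integrand. -/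
lemma QQ_integrable (r θ : ℝ) (hr : 0 < r) {h : ℝ → ℝ} {L : ℝ} (hL : 0 ≤ L)
    (hlip : ∀ u v : ℝ, |h u - h v| ≤ L * |u - v|) :
    ∃ c : ℝ, 0 < c ∧ (∀ t, 0 < t → Real.exp (θ*t) * t^(r-1) * cY2 r θ t * htilde r θ 1 h t =
      c * (htilde r θ 1 h t * vgDensity r θ 1 t)) ∧
    c = Real.sqrt π * Real.Gamma (r/2) * (1+θ^2)^((r-1)/2) ∧
    IntegrableOn (fun t => Real.exp (θ*t) * t^(r-1) * cY2 r θ t * htilde r θ 1 h t) (Set.Ioi 0) := by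
  have hq : 0 < 1 + θ^2 := by positivity
  have hG : 0 < Real.Gamma (r/2) := Real.Gamma_pos_of_pos (by positivity)
  have hp : 0 < Real.sqrt π := Real.sqrt_pos.mpr Real.pi_pos
  have key : ∀ t, 0 < t → Real.exp (θ*t) * t^(r-1) * cY2 r θ t * htilde r θ 1 h t =
      Real.sqrt π * Real.Gamma (r/2) * (1+θ^2)^((r-1)/2) * (htilde r θ 1 h t * vgDensity r θ 1 t) := by
    intro t ht
    rw [vg_eq_bN r θ ht.ne', mul_assoc (Real.exp (θ*t)), cY2_mul r θ ht, Real.rpow_neg hq.le]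
    have : 0 < (1+θ^2)^((r-1)/2) := by positivity
    field_simp
  refine ⟨_, by positivity, key, rfl, ?_⟩
  have := ((htilde_mean r θ hr hL hlip).1.integrableOn (s := Set.Ioi 0)).const_mul
    (Real.sqrt π * Real.Gamma (r/2) * (1+θ^2)^((r-1)/2))
  refine this.congr ?_
  filter_upwards [ae_restrict_mem measurableSet_Ioi] with t ht
  exact (key t ht).symm



lemma nonneg_of_deriv_nonneg {g g' : ℝ → ℝ} {X Y : ℝ}
    (hd : ∀ x, X < x → x ≤ Y → HasDerivAt g (g' x) x) (hn : ∀ x, X < x → x < Y → 0 ≤ g' x)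
    (ht : Tendsto g (nhdsWithin X (Set.Ioi X)) (nhds 0)) (hXY : X < Y) : 0 ≤ g Y := by
  have hm : MonotoneOn g (Set.Ioc X Y) := by
    apply monotoneOn_of_deriv_nonneg (convex_Ioc X Y)
    · exact fun x hx => (hd x hx.1 hx.2).continuousAt.continuousWithinAt
    · rw [interior_Ioc]; exact fun x hx => (hd x hx.1 hx.2.le).differentiableAt.differentiableWithinAt
    · rw [interior_Ioc]; intro x hx
      rw [(hd x hx.1 hx.2.le).deriv]; exact hn x hx.1 hx.2
  refine le_of_tendsto ht ?_
  filter_upwards [Ioc_mem_nhdsGT hXY] with z hz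
  exact hm hz ⟨hXY, le_rfl⟩ hz.2

lemma neg_of_deriv_neg {g g' : ℝ → ℝ} {X Y : ℝ}
    (hd : ∀ x, X < x → x < Y → HasDerivAt g (g' x) x) (hn : ∀ x, X < x → x < Y → g' x < 0)
    (ht : Tendsto g (nhdsWithin X (Set.Ioi X)) (nhds 0)) : ∀ x, X < x → x < Y → g x < 0 := by
  intro x hx hxY
  have hm : StrictAntiOn g (Set.Ioo X Y) := by
    apply strictAntiOn_of_deriv_neg (convex_Ioo X Y)
    · exact fun x hx => (hd x hx.1 hx.2).continuousAt.continuousWithinAt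
    · rw [interior_Ioo]; intro x hx
      rw [(hd x hx.1 hx.2).deriv]; exact hn x hx.1 hx.2
  have h1 : g ((X+x)/2) ≤ 0 := by
    refine ge_of_tendsto ht ?_
    filter_upwards [Ioo_mem_nhdsGT (show X < (X+x)/2 by linarith)] with z hz
    exact (hm ⟨hz.1, by linarith [hz.2]⟩ ⟨by linarith, by linarith⟩ hz.2).le
  exact (hm ⟨by linarith, by linarith⟩ ⟨hx, hxY⟩ (show (X+x)/2 < x by linarith)).trans_le h1

lemma rpow_exp_deriv (r c : ℝ) {x : ℝ} (hx : 0 < x) :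
    HasDerivAt (fun x : ℝ => x^r * Real.exp (c*x)) (x^(r-1) * Real.exp (c*x) * (r + c*x)) x := by
  have he : HasDerivAt (fun x => Real.exp (c*x)) (Real.exp (c*x) * c) x := by
    have := ((hasDerivAt_id x).const_mul c).exp
    simpa using this
  refine ((Real.hasDerivAt_rpow_const (Or.inl hx.ne')).mul he).congr_deriv ?_
  have hxr : x^r = x^(r-1) * x := by
    rw [Real.rpow_sub_one hx.ne']; field_simp
  rw [hxr]; ring

lemma max_principle {r θ X : ℝ} (hX : 0 ≤ X) {w w' w'' : ℝ → ℝ}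
    (hc : ContinuousOn w (Set.Ici X)) (hd : ∀ x, X < x → HasDerivAt w (w' x) x)
    (hdd : ∀ x, X < x → HasDerivAt w' (w'' x) x)
    (hT : ∀ x, X < x → w x < 0 → x * w'' x + (r + 2*θ*x) * w' x < 0)
    (hb : 0 ≤ w X ∨ Tendsto (fun x => x^r * Real.exp (2*θ*x) * w' x) (nhdsWithin X (Set.Ioi X)) (nhds 0))
    (hi : ∃ B, ∀ x, B ≤ x → 0 ≤ w x) : ∀ x, X ≤ x → 0 ≤ w x := by
  by_contra hcon
  push Not at hcon
  obtain ⟨x0, hx0, hw0⟩ := hcon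
  obtain ⟨B, hB⟩ := hi
  have hx0B : x0 ≤ max B x0 := le_max_right _ _
  obtain ⟨m, hm, hmin⟩ := (isCompact_Icc (a := X) (b := max B x0)).exists_isMinOn ⟨x0, hx0, hx0B⟩
    (hc.mono Set.Icc_subset_Ici_self)
  have hwm : w m < 0 := (hmin ⟨hx0, hx0B⟩).trans_lt hw0
  have hglob : ∀ y, X ≤ y → w m ≤ w y := by
    intro y hy
    by_cases h : y ≤ max B x0
    · exact hmin ⟨hy, h⟩
    · push Not at h
      exact hwm.le.trans (hB y ((le_max_left _ _).trans h.le))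
  have hlim : Tendsto (fun x => x^r * Real.exp (2*θ*x) * w' x) (nhdsWithin m (Set.Ioi m)) (nhds 0) := by
    rcases eq_or_lt_of_le hm.1 with h | h
    · rcases hb with hb | hb
      · rw [h] at hb; linarith
      · rw [← h]; exact hb
    · have hmp : 0 < m := hX.trans_lt h
      have h0 : w' m = 0 := by
        have hloc : IsLocalMin w m := by
          filter_upwards [Ioi_mem_nhds h] with y hy using hglob y (le_of_lt hy)
        exact hloc.hasDerivAt_eq_zero (hd m h)
      have hcc : ContinuousAt (fun x => x^r * Real.exp (2*θ*x) * w' x) m :=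
        (rpow_exp_deriv r (2*θ) hmp).continuousAt.mul (hdd m h).continuousAt
      have := hcc.tendsto
      rw [h0, mul_zero] at this
      exact this.mono_left nhdsWithin_le_nhds
  -- neighbourhood where w < 0
  have hcm : ContinuousWithinAt w (Set.Ici m) m := (hc m hm.1).mono (Set.Ici_subset_Ici.mpr hm.1)
  have hev : ∀ᶠ y in nhdsWithin m (Set.Ici m), w y < 0 := hcm.eventually (gt_mem_nhds hwm)
  obtain ⟨δ, hδ, hδ2⟩ := mem_nhdsGE_iff_exists_Ico_subset.mp hev
  have hδ : m < δ := hδ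
  have hneg : ∀ x, m < x → x < δ → x^r * Real.exp (2*θ*x) * w' x < 0 := by
    apply neg_of_deriv_neg (g' := fun x => x^(r-1) * Real.exp (2*θ*x) * (x * w'' x + (r + 2*θ*x) * w' x))
    · intro x hx hxδ
      have hxX : X < x := hm.1.trans_lt hx
      have hx0 : 0 < x := hX.trans_lt hxX
      refine ((rpow_exp_deriv r (2*θ) hx0).mul (hdd x hxX)).congr_deriv ?_
      have hxr : x^r = x^(r-1) * x := by
        rw [Real.rpow_sub_one hx0.ne']; field_simp
      rw [hxr]; ring
    · intro x hx hxδ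
      have hxX : X < x := hm.1.trans_lt hx
      have hx0 : 0 < x := hX.trans_lt hxX
      have h1 := hT x hxX (hδ2 ⟨hx.le, hxδ⟩)
      have h2 : 0 < x^(r-1) * Real.exp (2*θ*x) := by positivity
      exact mul_neg_of_pos_of_neg h2 h1
    · exact hlim
  have hanti : StrictAntiOn w (Set.Icc m ((m+δ)/2)) := by
    apply strictAntiOn_of_deriv_neg (convex_Icc _ _)
    · exact hc.mono (fun y hy => hm.1.trans hy.1)
    · rw [interior_Icc]
      intro x hx
      have hxX : X < x := hm.1.trans_lt hx.1
      have hx0 : 0 < x := hX.trans_lt hxX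
      rw [(hd x hxX).deriv]
      have h1 := hneg x hx.1 (by linarith [hx.2])
      have h2 : 0 < x^r * Real.exp (2*θ*x) := by positivity
      by_contra h3
      push Not at h3
      have := mul_nonneg h2.le h3
      linarith
  have h1 := hanti ⟨le_rfl, by linarith⟩ ⟨by linarith, le_rfl⟩ (show m < (m+δ)/2 by linarith)
  have h2 := hglob ((m+δ)/2) (by linarith [hm.1])
  linarith

/-- Half-line solution data. -/
structure HL (r θ L s : ℝ) (f f' H : ℝ → ℝ) : Prop where
  cont : ContinuousOn f (Set.Ici 0)
  d : ∀ x, 0 < x → HasDerivAt f (f' x) x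
  dd : ∀ x, 0 < x → HasDerivAt f' ((H x - (r + 2*θ*x) * f' x - (r*θ - x) * f x)/x) x
  z : Tendsto (fun x => x^r * f' x) (nhdsWithin 0 (Set.Ioi 0)) (nhds 0)
  g : ∃ K X0 : ℝ, ∀ x, X0 ≤ x → |f x| ≤ K * (1 + x)
  hb : ∀ x, |H x| ≤ L * (|x - r*θ| + s)
  hl : ∀ x y, |H x - H y| ≤ L * |x - y|

lemma HL.neg {r θ L s : ℝ} {f f' H : ℝ → ℝ} (h : HL r θ L s f f' H) :
    HL r θ L s (fun x => -f x) (fun x => -f' x) (fun x => -H x) where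
  cont := h.cont.neg
  d := fun x hx => (h.d x hx).neg
  dd := fun x hx => by
    refine (h.dd x hx).neg.congr_deriv ?_
    ring
  z := by
    have := h.z.neg
    simpa using this
  g := by
    obtain ⟨K, X0, hK⟩ := h.g
    exact ⟨K, X0, fun x hx => by rw [abs_neg]; exact hK x hx⟩
  hb := fun x => by rw [abs_neg]; exact h.hb x
  hl := fun x y => by
    rw [show -H x - -H y = -(H x - H y) by ring, abs_neg]; exact h.hl x y

lemma T_sq_bound (r θ : ℝ) (hr : 0 < r) : ∃ M, 0 ≤ M ∧ ∀ x, 0 ≤ x →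
    x * 2 + (r + 2*θ*x) * (2*x) + (r*θ - x) * x^2 ≤ M := by
  set c := 2 + 2*r
  set e := |4*θ+r*θ|
  have he : 0 ≤ e := abs_nonneg _
  have hc : 0 < c := by positivity
  set X := c + e + 1
  have hXp : 0 < X := by positivity
  refine ⟨c * X + e * X^2, by positivity, ?_⟩
  intro x hx
  have h1 : x * 2 + (r + 2*θ*x) * (2*x) + (r*θ - x) * x^2 = c*x + (4*θ+r*θ)*x^2 - x^3 := by
    simp only [c]; ring
  rw [h1]
  have h2 : (4*θ+r*θ)*x^2 ≤ e * x^2 := by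
    apply mul_le_mul_of_nonneg_right (le_abs_self _) (sq_nonneg _)
  by_cases h : x ≤ X
  · have h3 : c * x ≤ c * X := by gcongr
    have h4 : e * x^2 ≤ e * X^2 := by gcongr
    have h5 : 0 ≤ x^3 := by positivity
    linarith
  · push Not at h
    have h3 : X * x^2 ≤ x^3 := by
      rw [show x^3 = x * x^2 by ring]; gcongr
    have h4 : x ≤ x^2 := by
      have : 1 ≤ x := by linarith
      nlinarith
    have h5 : c * x ≤ c * x^2 := by gcongr
    have h6 : 0 ≤ c * X + e * X^2 := by positivity
    have h7 : X * x^2 = c * x^2 + e * x^2 + x^2 := by simp only [X]; ring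
    nlinarith [sq_nonneg x]

lemma cmp_one {r θ L s X : ℝ} {f f' H F F' F'' : ℝ → ℝ} (hr : 0 < r) (hL : 0 ≤ L) (hs : 0 < s)
    (h : HL r θ L s f f' H) (hX : 0 ≤ X) (hXr : r*θ ≤ X)
    (hFc : ContinuousOn F (Set.Ici X)) (hF0 : ∀ x, X ≤ x → 0 ≤ F x)
    (hFd : ∀ x, X < x → HasDerivAt F (F' x) x) (hFdd : ∀ x, X < x → HasDerivAt F' (F'' x) x)
    (hT : ∀ x, X < x → x * F'' x + (r + 2*θ*x) * F' x + (r*θ - x) * F x ≤ -(x - r*θ + s))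
    (hb : f X ≤ L * F X ∨ (X = 0 ∧ Tendsto (fun x => x^r * F' x) (nhdsWithin 0 (Set.Ioi 0)) (nhds 0))) :
    ∀ x, X ≤ x → f x ≤ L * F x := by
  obtain ⟨M, hM0, hM⟩ := T_sq_bound r θ hr
  have key : ∀ ε, 0 < ε → ∀ x, X ≤ x → f x ≤ (L + ε) * F x + (ε * s / (M + 1)) * x^2 := by
    intro ε hε
    set ε₂ := ε * s / (M+1) with hε₂
    have hε₂p : 0 < ε₂ := by positivity
    have hε₂M : ε₂ * M < ε * s := by
      rw [hε₂, div_mul_eq_mul_div, div_lt_iff₀ (by positivity)]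
      have : 0 < ε * s := by positivity
      nlinarith
    have hmp := max_principle (r := r) (θ := θ) (X := X) hX
      (w := fun x => (L + ε) * F x - f x + ε₂ * x^2)
      (w' := fun x => (L + ε) * F' x - f' x + ε₂ * (2*x))
      (w'' := fun x => (L + ε) * F'' x - ((H x - (r + 2*θ*x) * f' x - (r*θ - x) * f x)/x) + ε₂ * 2)
      ?_ ?_ ?_ ?_ ?_ ?_
    · intro x hx
      have := hmp x hx
      linarith
    · have h1 : ContinuousOn f (Set.Ici X) := h.cont.mono (Set.Ici_subset_Ici.mpr hX)
      fun_prop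
    · intro x hx
      refine (((hFd x hx).const_mul _).sub (h.d x (hX.trans_lt hx))).add ((hasDerivAt_pow 2 x).const_mul ε₂) |>.congr_deriv ?_
      norm_num
    · intro x hx
      refine (((hFdd x hx).const_mul _).sub (h.dd x (hX.trans_lt hx))).add (((hasDerivAt_id x).const_mul 2).const_mul ε₂) |>.congr_deriv ?_
      norm_num
    · intro x hx hw
      have hx0 : 0 < x := hX.trans_lt hx
      have h1 := hT x hx
      have h2 := h.hb x
      rw [abs_of_nonneg (show (0:ℝ) ≤ x - r*θ by linarith)] at h2
      have h3 := hM x hx0.le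
      have h4 : 0 ≤ (r*θ - x) * ((L + ε) * F x - f x + ε₂ * x^2) :=
        mul_nonneg_of_nonpos_of_nonpos (by linarith) hw.le
      have h5 : x * ((H x - (r + 2*θ*x) * f' x - (r*θ - x) * f x)/x) = H x - (r + 2*θ*x) * f' x - (r*θ - x) * f x := by
        field_simp
      have h6 : (L+ε) * (x * F'' x + (r + 2*θ*x) * F' x + (r*θ - x) * F x) ≤ (L+ε) * (-(x - r*θ + s)) := by gcongr
      have h7 := (abs_le.mp h2).1
      have h8 : ε₂ * (x * 2 + (r + 2*θ*x) * (2*x) + (r*θ - x) * x^2) ≤ ε₂ * M := by gcongr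
      have h9 : 0 ≤ ε * (x - r*θ) := mul_nonneg hε.le (by linarith)
      nlinarith
    · rcases hb with hb | ⟨hX0, hb⟩
      · left
        have : 0 ≤ ε * F X := mul_nonneg hε.le (hF0 X le_rfl)
        have : 0 ≤ ε₂ * X^2 := by positivity
        nlinarith
      · right
        rw [hX0]
        have h1 : Tendsto (fun x => Real.exp (2*θ*x)) (nhdsWithin 0 (Set.Ioi 0)) (nhds 1) := by
          have : Continuous (fun x => Real.exp (2*θ*x)) := by fun_prop
          have h := (this.tendsto 0).mono_left (nhdsWithin_le_nhds (s := Set.Ioi 0))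
          simpa using h
        have h2 : Tendsto (fun x : ℝ => x) (nhdsWithin 0 (Set.Ioi 0)) (nhds 0) :=
          tendsto_id.mono_left nhdsWithin_le_nhds
        have := h1.mul (((hb.const_mul (L+ε)).sub h.z).add ((rpow_zero_tendsto hr).mul (h2.const_mul (ε₂*2))))
        simp only [mul_zero, sub_zero, add_zero] at this
        refine this.congr ?_
        intro x; ring
    · obtain ⟨K, X0, hK⟩ := h.g
      refine ⟨max (max X X0) (max 1 (2*|K|/ε₂)), ?_⟩
      intro x hx
      have hx1 : X ≤ x := ((le_max_left _ _).trans (le_max_left _ _)).trans hx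
      have hx2 : X0 ≤ x := ((le_max_right _ _).trans (le_max_left _ _)).trans hx
      have hx3 : 1 ≤ x := ((le_max_left _ _).trans (le_max_right _ _)).trans hx
      have hx4 : 2*|K|/ε₂ ≤ x := ((le_max_right _ _).trans (le_max_right _ _)).trans hx
      rw [div_le_iff₀ hε₂p] at hx4
      have h1 := hK x hx2
      have h2 := le_abs_self (f x)
      have h3 : K * (1+x) ≤ |K| * (1+x) := mul_le_mul_of_nonneg_right (le_abs_self K) (by linarith)
      have h4 : |K| * (1 + x) ≤ |K| * (2*x) := mul_le_mul_of_nonneg_left (by linarith) (abs_nonneg K)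
      have h5 : 2*|K| * x ≤ x * ε₂ * x := by gcongr
      have h6 : 0 ≤ (L + ε) * F x := mul_nonneg (by positivity) (hF0 x hx1)
      nlinarith
  intro x hx
  have hFx := hF0 x hx
  apply le_of_forall_pos_le_add
  intro η hη
  have hD : 0 < F x + s / (M+1) * x^2 + 1 := by positivity
  have h1 := key (η / (F x + s / (M+1) * x^2 + 1)) (by positivity) x hx
  refine h1.trans ?_
  have e : (L + η / (F x + s / (M+1) * x^2 + 1)) * F x + (η / (F x + s / (M+1) * x^2 + 1)) * s / (M + 1) * x^2
      = L * F x + η * ((F x + s / (M+1) * x^2) / (F x + s / (M+1) * x^2 + 1)) := by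
    have : 0 < M + 1 := by positivity
    set D := F x + s / (M+1) * x^2 + 1
    have e1 : F x + s / (M+1) * x^2 = D - 1 := by simp only [D]; ring
    have e2 : η / D * s / (M+1) * x^2 = η / D * (D - 1 - F x) := by rw [← e1]; ring
    rw [e1, e2]; ring
  rw [e]
  have : (F x + s / (M+1) * x^2) / (F x + s / (M+1) * x^2 + 1) ≤ 1 := by
    rw [div_le_one hD]; linarith
  nlinarith

lemma cmp_abs {r θ L s X : ℝ} {f f' H F F' F'' : ℝ → ℝ} (hr : 0 < r) (hL : 0 ≤ L) (hs : 0 < s)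
    (h : HL r θ L s f f' H) (hX : 0 ≤ X) (hXr : r*θ ≤ X)
    (hFc : ContinuousOn F (Set.Ici X)) (hF0 : ∀ x, X ≤ x → 0 ≤ F x)
    (hFd : ∀ x, X < x → HasDerivAt F (F' x) x) (hFdd : ∀ x, X < x → HasDerivAt F' (F'' x) x)
    (hT : ∀ x, X < x → x * F'' x + (r + 2*θ*x) * F' x + (r*θ - x) * F x ≤ -(x - r*θ + s))
    (hb : |f X| ≤ L * F X ∨ (X = 0 ∧ Tendsto (fun x => x^r * F' x) (nhdsWithin 0 (Set.Ioi 0)) (nhds 0))) :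
    ∀ x, X ≤ x → |f x| ≤ L * F x := by
  intro x hx
  rw [abs_le']
  constructor
  · exact cmp_one hr hL hs h hX hXr hFc hF0 hFd hFdd hT (hb.imp_left fun hh => (le_abs_self _).trans hh) x hx
  · exact cmp_one hr hL hs h.neg hX hXr hFc hF0 hFd hFdd hT (hb.imp_left fun hh => (neg_le_abs _).trans hh) x hx



/-- Parameter facts. -/
structure PK (r θ s ρ k : ℝ) : Prop where
  r0 : 0 < r
  s0 : 0 < s
  k0 : 0 < k
  r1 : 1 ≤ ρ
  s2 : s^2 = r * (1 + 2*θ^2)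
  e : k * ρ * s = 1
  sk : s * k ≤ 1
  q : k^2 + 2 * |θ| * k ≤ 1
  t : 2 * |θ| ≤ ρ * s
  tk : 2 * |θ| * k ≤ 1
  rr : 2 ≤ ρ^2 * r

lemma PK_mk {r θ s ρ : ℝ} (hr : 0 < r) (hs : 0 < s) (hρ : 1 ≤ ρ) (hs2 : s^2 = r * (1 + 2*θ^2))
    (hρr : 2 ≤ ρ^2 * r) : PK r θ s ρ (1/(ρ*s)) := by
  have hρ0 : 0 < ρ := by linarith
  have hk0 : 0 < 1/(ρ*s) := by positivity
  have he : 1/(ρ*s) * ρ * s = 1 := by field_simp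
  have h1 : 2 + 4*θ^2 ≤ (ρ*s)^2 := by
    have : (ρ*s)^2 = (ρ^2*r) * (1+2*θ^2) := by rw [mul_pow, hs2]; ring
    rw [this]; nlinarith [sq_nonneg θ]
  have h2 : (1/(ρ*s))^2 * (2 + 4*θ^2) ≤ 1 := by
    rw [one_div, inv_pow, inv_mul_le_iff₀ (by positivity)]; linarith
  have ht : 2 * |θ| ≤ ρ * s := by
    apply abs_le_of_sq_le_sq' _ (by positivity) |>.2
    rw [mul_pow, sq_abs]; linarith
  refine ⟨hr, hs, hk0, hρ, hs2, he, ?_, ?_, ht, ?_, ?_⟩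
  · rw [mul_one_div, div_le_one (by positivity)]; nlinarith
  · nlinarith [sq_nonneg (1 - 2 * (|θ| * (1/(ρ*s)))), sq_abs θ]
  · rw [mul_one_div, div_le_one (by positivity)]; exact ht
  · exact hρr

lemma expk_deriv (c k x0 x : ℝ) : HasDerivAt (fun x => c * Real.exp (-k*(x - x0))) (-k * c * Real.exp (-k*(x-x0))) x := by
  have := ((((hasDerivAt_id x).sub_const x0).const_mul (-k)).exp).const_mul c
  refine this.congr_deriv ?_
  simp only [id]; ring

lemma bdA {r θ L s ρ k : ℝ} {f f' H : ℝ → ℝ} (hL : 0 ≤ L) (p : PK r θ s ρ k)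
    (h : HL r θ L s f f' H) (hθ : θ ≤ 0) : ∀ x, 0 ≤ x → |f x| ≤ (2 + ρ) * L := by
  have hr := p.r0
  have hs := p.s0
  have hk := p.k0
  have hρ : 0 < ρ := by linarith [p.r1]
  have key := cmp_abs (X := 0) (F := fun x => 2 + ρ * Real.exp (-k*(x-0)))
    (F' := fun x => -k * ρ * Real.exp (-k*(x-0))) (F'' := fun x => -k * (-k * ρ) * Real.exp (-k*(x-0)))
    hr hL hs h le_rfl (mul_nonpos_of_nonneg_of_nonpos hr.le hθ)
    (by fun_prop) (fun x hx => by positivity) (fun x hx => (expk_deriv ρ k 0 x).const_add 2)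
    (fun x hx => expk_deriv (-k*ρ) k 0 x) ?_ ?_
  · intro x hx
    refine (key x hx).trans ?_
    rw [mul_comm]
    have : Real.exp (-k*(x-0)) ≤ 1 := by
      rw [Real.exp_le_one_iff]; nlinarith
    have : ρ * Real.exp (-k*(x-0)) ≤ ρ := by nlinarith
    nlinarith
  · intro x hx
    have he1 : 1 - k * x ≤ Real.exp (-k*(x-0)) := by
      have := Real.add_one_le_exp (-k*(x-0)); linarith
    set e := Real.exp (-k*(x-0)) with he
    have he0 : 0 < e := Real.exp_pos _
    have hq := p.q
    rw [abs_of_nonpos hθ] at hq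
    have ht := p.t
    rw [abs_of_nonpos hθ] at ht
    have h1 : s ≤ ρ * (r * (k - θ)) := by
      have : s * s ≤ s * (ρ * (r * (k - θ))) := by
        have e1 : s * (ρ * (r * (k - θ))) = r * (k*ρ*s) - r * θ * (ρ * s) := by ring
        have h3 : 0 ≤ (-θ) * (ρ * s - 2 * (-θ)) := mul_nonneg (by linarith) (by linarith)
        have h4 := mul_nonneg hr.le h3
        have := p.s2
        rw [e1, p.e]
        nlinarith
      exact le_of_mul_le_mul_left this hs
    have h2 : 0 ≤ ρ * e * (x * (1 - k^2 + 2*θ*k)) := by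
      have : 0 ≤ 1 - k^2 + 2*θ*k := by linarith
      positivity
    have h3 : s * e ≤ ρ * (r * (k - θ)) * e := by gcongr
    have h4 : s * (1 - k*x) ≤ s * e := by gcongr
    have h5 : (s * k) * x ≤ 1 * x := mul_le_mul_of_nonneg_right p.sk hx.le
    have h6 : 0 ≤ r * (-θ) := mul_nonneg hr.le (by linarith)
    nlinarith
  · right
    refine ⟨rfl, ?_⟩
    have h1 : Tendsto (fun x => -k * ρ * Real.exp (-k*(x-0))) (nhdsWithin 0 (Set.Ioi 0)) (nhds (-k * ρ * Real.exp (-k*(0-0)))) := by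
      have : Continuous (fun x => -k * ρ * Real.exp (-k*(x-0))) := by fun_prop
      exact (this.tendsto 0).mono_left nhdsWithin_le_nhds
    have := (rpow_zero_tendsto hr).mul h1
    rw [zero_mul] at this
    exact this

lemma bdB1_pos {r θ a b α : ℝ} (hr : 0 < r) (hα : 0 < α) (ha : a = α - θ) (hbb : b = α + θ) (hab : a * b = 1)
    (hX : 0 < r * θ) {w w' w'' : ℝ → ℝ}
    (hc : ContinuousOn w (Set.Ici 0)) (hd : ∀ x, 0 < x → HasDerivAt w (w' x) x)
    (hdd : ∀ x, 0 < x → HasDerivAt w' (w'' x) x)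
    (hz : Tendsto (fun x => x^r * w' x) (nhdsWithin 0 (Set.Ioi 0)) (nhds 0))
    (hT : ∀ x, 0 < x → x < r*θ → 0 < x * w'' x + (r + 2*θ*x) * w' x + (r*θ - x) * w x)
    (hw0 : 0 < w 0) : ∀ x, 0 ≤ x → x ≤ r*θ → 0 < w x := by
  by_contra hcon
  push Not at hcon
  obtain ⟨x0, hx0, hx1, hx2⟩ := hcon
  have hcI : ContinuousOn w (Set.Icc 0 (r*θ)) := hc.mono Set.Icc_subset_Ici_self
  have hcompact : IsCompact ({x | x ∈ Set.Icc 0 (r*θ) ∧ w x ≤ 0}) := by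
    have : IsClosed ({x | x ∈ Set.Icc 0 (r*θ) ∧ w x ≤ 0}) := by
      have := hcI.preimage_isClosed_of_isClosed isClosed_Icc (isClosed_Iic (a := (0:ℝ)))
      exact this
    exact isCompact_Icc.of_isClosed_subset this (fun x hx => hx.1)
  obtain ⟨m, hm, hmin⟩ := hcompact.exists_isLeast ⟨x0, ⟨hx0, hx1⟩, hx2⟩
  have hm0 : 0 < m := by
    rcases eq_or_lt_of_le hm.1.1 with h | h
    · rw [← h] at hm; linarith [hm.2]
    · exact h
  have hpos : ∀ x, 0 ≤ x → x < m → 0 < w x := by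
    intro x hx hxm
    by_contra hh
    push Not at hh
    have := hmin ⟨⟨hx, hxm.le.trans hm.1.2⟩, hh⟩
    linarith
  -- W := w' + b w
  have hWneg : ∀ x, 0 < x → x < m → -(x^r * Real.exp (-a*x) * (w' x + b * w x)) < 0 := by
    apply neg_of_deriv_neg (g' := fun x => -(x^(r-1) * Real.exp (-a*x) *
      ((x * w'' x + (r + 2*θ*x) * w' x + (r*θ - x) * w x) + r * α * w x)))
    · intro x hx hxm
      refine ((rpow_exp_deriv r (-a) hx).mul ((hdd x hx).add ((hd x hx).const_mul b))).neg.congr_deriv ?_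
      have hxr : x^r = x^(r-1) * x := by
        rw [Real.rpow_sub_one hx.ne']; field_simp
      have h1 : b = a + 2*θ := by rw [ha, hbb]; ring
      have h2 : b = θ + α := by rw [hbb]; ring
      simp only [Pi.add_apply]
      rw [hxr]
      linear_combination (x^(r-1) * Real.exp (-a*x)) * (-(x * w' x) * h1 - r * w x * h2 + x * w x * hab)
    · intro x hx hxm
      have h1 := hT x hx (hxm.trans_le hm.1.2)
      have h2 := hpos x hx.le hxm
      have : 0 < x^(r-1) * Real.exp (-a*x) *
      ((x * w'' x + (r + 2*θ*x) * w' x + (r*θ - x) * w x) + r * α * w x) := by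
        have : 0 < r * α * w x := by positivity
        positivity
      linarith
    · have h1 : Tendsto (fun x => Real.exp (-a*x)) (nhdsWithin 0 (Set.Ioi 0)) (nhds 1) := by
        have : Continuous (fun x => Real.exp (-a*x)) := by fun_prop
        have h := (this.tendsto 0).mono_left (nhdsWithin_le_nhds (s := Set.Ioi 0))
        simpa using h
      have h2 : Tendsto w (nhdsWithin 0 (Set.Ioi 0)) (nhds (w 0)) :=
        (hc 0 (by simp)).tendsto.mono_left (nhdsWithin_mono _ Set.Ioi_subset_Ici_self)
      have := (h1.mul (hz.add ((rpow_zero_tendsto hr).mul (h2.const_mul b)))).neg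
      simp only [zero_mul, mul_zero, add_zero, neg_zero] at this
      refine this.congr ?_
      intro x; ring
  have hmono : StrictMonoOn (fun x => Real.exp (b*x) * w x) (Set.Icc 0 m) := by
    apply strictMonoOn_of_deriv_pos (convex_Icc _ _)
    · have := hc.mono (Set.Icc_subset_Ici_self (a := m) (b := 0))
      fun_prop
    · rw [interior_Icc]
      intro x hx
      have h1 : HasDerivAt (fun x => Real.exp (b*x) * w x) (Real.exp (b*x) * (w' x + b * w x)) x := by
        have he : HasDerivAt (fun x => Real.exp (b*x)) (Real.exp (b*x) * b) x := by
          have := ((hasDerivAt_id x).const_mul b).exp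
          simpa using this
        refine (he.mul (hd x hx.1)).congr_deriv ?_
        ring
      rw [h1.deriv]
      have h2 := hWneg x hx.1 hx.2
      have h0 := hx.1
      have h3 : 0 < x^r * Real.exp (-a*x) := by positivity
      have h4 : 0 < w' x + b * w x := by
        by_contra hh
        push Not at hh
        have := mul_nonpos_of_nonneg_of_nonpos h3.le hh
        linarith
      positivity
  have h1 := hmono ⟨le_rfl, hm0.le⟩ ⟨hm0.le, le_rfl⟩ hm0
  simp only [mul_zero, Real.exp_zero, one_mul] at h1
  have h2 : Real.exp (b*m) * w m ≤ 0 := mul_nonpos_of_nonneg_of_nonpos (Real.exp_pos _).le hm.2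
  linarith

lemma bdB1_one {r θ L s ρ k : ℝ} {f f' H : ℝ → ℝ} (hL : 0 ≤ L) (p : PK r θ s ρ k)
    (h : HL r θ L s f f' H) (hθ : 0 < θ) (h0 : f 0 ≤ (2 + ρ) * L) :
    ∀ x, 0 ≤ x → x ≤ r*θ → f x ≤ (2 + 2*ρ) * L := by
  have hr := p.r0
  have hs := p.s0
  have hk := p.k0
  have hρ : 0 < ρ := by linarith [p.r1]
  have hα2 : 0 ≤ 1 + θ^2 := by positivity
  have key : ∀ ε, 0 < ε → ∀ x, 0 ≤ x → x ≤ r*θ → f x ≤ (L + ε) * (2 + 2*ρ) := by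
    intro ε hε
    have hmp := bdB1_pos (r := r) (θ := θ) (a := √(1+θ^2) - θ) (b := √(1+θ^2) + θ) (α := √(1+θ^2)) hr
      (by positivity) rfl rfl (by have := Real.sq_sqrt hα2; linear_combination this) (by positivity)
      (w := fun x => (L+ε) * ((2 + ρ) + ρ * Real.exp (-(-k)*(x-r*θ))) - f x)
      (w' := fun x => (L+ε) * (-(-k) * ρ * Real.exp (-(-k)*(x-r*θ))) - f' x)
      (w'' := fun x => (L+ε) * (-(-k) * (-(-k) * ρ) * Real.exp (-(-k)*(x-r*θ))) -
        ((H x - (r + 2*θ*x) * f' x - (r*θ - x) * f x)/x))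
      ?_ ?_ ?_ ?_ ?_ ?_
    · intro x hx hx1
      have h1 := hmp x hx hx1
      have h2 : Real.exp (-(-k)*(x-r*θ)) ≤ 1 := by
        rw [Real.exp_le_one_iff]; nlinarith
      have h3 : (L+ε) * ((2 + ρ) + ρ * Real.exp (-(-k)*(x-r*θ))) ≤ (L+ε) * (2+2*ρ) := by
        have : ρ * Real.exp (-(-k)*(x-r*θ)) ≤ ρ := by nlinarith
        exact mul_le_mul_of_nonneg_left (by linarith) (by linarith)
      linarith
    · have := h.cont
      fun_prop
    · intro x hx
      exact (((expk_deriv ρ (-k) (r*θ) x).const_add (2+ρ)).const_mul (L+ε)).sub (h.d x hx)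
    · intro x hx
      exact ((expk_deriv (-(-k)*ρ) (-k) (r*θ) x).const_mul (L+ε)).sub (h.dd x hx)
    · have h1 : Tendsto (fun x => (L+ε) * (-(-k) * ρ * Real.exp (-(-k)*(x-r*θ)))) (nhdsWithin 0 (Set.Ioi 0))
          (nhds ((L+ε) * (-(-k) * ρ * Real.exp (-(-k)*(0-r*θ))))) := by
        have : Continuous (fun x => (L+ε) * (-(-k) * ρ * Real.exp (-(-k)*(x-r*θ)))) := by fun_prop
        exact (this.tendsto 0).mono_left nhdsWithin_le_nhds
      have := ((rpow_zero_tendsto hr).mul h1).sub h.z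
      rw [zero_mul, sub_zero] at this
      refine this.congr ?_
      intro x; ring
    · intro x hx hx1
      have he1 : 1 - k * (r*θ - x) ≤ Real.exp (-(-k)*(x-r*θ)) := by
        have := Real.add_one_le_exp (-(-k)*(x-r*θ)); linarith
      set e := Real.exp (-(-k)*(x-r*θ)) with he
      have he0 : 0 < e := Real.exp_pos _
      have htk := p.tk
      rw [abs_of_pos hθ] at htk
      have h2 := h.hb x
      rw [abs_of_nonpos (show x - r*θ ≤ 0 by linarith)] at h2
      have h3 := (abs_le.mp h2).2
      have h5 : x * ((H x - (r + 2*θ*x) * f' x - (r*θ - x) * f x)/x) = H x - (r + 2*θ*x) * f' x - (r*θ - x) * f x := by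
        field_simp
      have hy : 0 < r*θ - x := by linarith
      have hTF : (r*θ - x) + s ≤ x * (-(-k) * (-(-k) * ρ) * e) + (r + 2*θ*x) * (-(-k) * ρ * e)
          + (r*θ - x) * ((2 + ρ) + ρ * e) := by
        have g1 : 0 ≤ x * (-(-k) * (-(-k) * ρ) * e) := by
          rw [neg_neg]; positivity
        have g2 : (r + 2*θ*x) * (-(-k) * ρ * e) = e * s - 2*θ*(r*θ-x)*k*ρ*e := by
          have : r + 2*θ*x = s^2 - 2*θ*(r*θ-x) := by rw [p.s2]; ring
          rw [this]
          linear_combination s * e * p.e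
        have g3 : 0 ≤ ρ * e * ((r*θ-x) * (1 - 2*θ*k)) := by
          have : 0 ≤ 1 - 2*θ*k := by linarith
          positivity
        have g4 : s * (1 - k * (r*θ - x)) ≤ s * e := by gcongr
        have g5 : (s * k) * (r*θ-x) ≤ 1 * (r*θ-x) := mul_le_mul_of_nonneg_right p.sk hy.le
        have g6 : 0 ≤ ρ * (r*θ-x) := by positivity
        nlinarith
      have h6 : (L+ε) * ((r*θ - x) + s) ≤ (L+ε) * (x * (-(-k) * (-(-k) * ρ) * e) + (r + 2*θ*x) * (-(-k) * ρ * e)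
          + (r*θ - x) * ((2 + ρ) + ρ * e)) := mul_le_mul_of_nonneg_left hTF (by linarith)
      have h7 : 0 < ε * ((r*θ - x) + s) := by positivity
      have h8 : 0 < (L+ε) * (x * (-(-k) * (-(-k) * ρ) * e) + (r + 2*θ*x) * (-(-k) * ρ * e)
          + (r*θ - x) * ((2 + ρ) + ρ * e)) - H x := by nlinarith
      refine h8.trans_eq ?_
      linear_combination h5
    · have : 0 < Real.exp (-(-k)*(0-r*θ)) := Real.exp_pos _
      have h2 : 0 ≤ (L+ε) * (ρ * Real.exp (-(-k)*(0-r*θ))) := by positivity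
      have h3 : 0 < ε * (2+ρ) := by positivity
      nlinarith
  intro x hx hx1
  apply le_of_forall_pos_le_add
  intro η hη
  have := key (η/(2+2*ρ)) (by positivity) x hx hx1
  refine this.trans_eq ?_
  field_simp

lemma bdB {r θ L s ρ k : ℝ} {f f' H : ℝ → ℝ} (hL : 0 ≤ L) (p : PK r θ s ρ k)
    (h : HL r θ L s f f' H) (hθ : 0 < θ) (h0 : |f 0| ≤ (2 + ρ) * L) :
    ∀ x, 0 ≤ x → |f x| ≤ (2 + 2*ρ) * L := by
  have hr := p.r0
  have hs := p.s0
  have hk := p.k0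
  have hρ : 0 < ρ := by linarith [p.r1]
  have h1 : ∀ x, 0 ≤ x → x ≤ r*θ → |f x| ≤ (2 + 2*ρ) * L := by
    intro x hx hx1
    rw [abs_le']
    exact ⟨bdB1_one hL p h hθ ((le_abs_self _).trans h0) x hx hx1,
      bdB1_one hL p h.neg hθ ((neg_le_abs _).trans h0) x hx hx1⟩
  have hX : 0 < r*θ := by positivity
  have key := cmp_abs (X := r*θ) (F := fun x => 2 + (2*ρ) * Real.exp (-k*(x-r*θ)))
    (F' := fun x => -k * (2*ρ) * Real.exp (-k*(x-r*θ))) (F'' := fun x => -k * (-k * (2*ρ)) * Real.exp (-k*(x-r*θ)))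
    hr hL hs h hX.le le_rfl
    (by fun_prop) (fun x hx => by positivity) (fun x hx => (expk_deriv (2*ρ) k (r*θ) x).const_add 2)
    (fun x hx => expk_deriv (-k*(2*ρ)) k (r*θ) x) ?_ ?_
  · intro x hx
    by_cases hxx : x ≤ r*θ
    · exact h1 x hx hxx
    push Not at hxx
    refine (key x hxx.le).trans ?_
    rw [mul_comm]
    have : Real.exp (-k*(x-r*θ)) ≤ 1 := by
      rw [Real.exp_le_one_iff]; nlinarith
    have : (2*ρ) * Real.exp (-k*(x-r*θ)) ≤ 2*ρ := by nlinarith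
    nlinarith
  · intro x hx
    have he1 : 1 - k * (x - r*θ) ≤ Real.exp (-k*(x-r*θ)) := by
      have := Real.add_one_le_exp (-k*(x-r*θ)); linarith
    set e := Real.exp (-k*(x-r*θ)) with he
    have he0 : 0 < e := Real.exp_pos _
    have hy : 0 < x - r*θ := by linarith
    have hq := p.q
    rw [abs_of_pos hθ] at hq
    have htk := p.tk
    rw [abs_of_pos hθ] at htk
    have g0 : 2*ρ*k^2*(r*θ) ≤ s := by
      have : s * (2*ρ*k^2*(r*θ)) ≤ s * s := by
        have e1 : s * (2*ρ*k^2*(r*θ)) = r * (2*θ*k) * (k*ρ*s) := by ring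
        rw [e1, p.e]
        have := p.s2
        have : r * (2*θ*k) ≤ r * 1 := by gcongr
        nlinarith [mul_nonneg hr.le (sq_nonneg θ)]
      exact le_of_mul_le_mul_left this hs
    have g1 : (r + 2*θ*x) * (-k * (2*ρ) * e) = - (2 * e * s) - 4*θ*(x - r*θ)*k*ρ*e := by
      have : r + 2*θ*x = s^2 + 2*θ*(x-r*θ) := by rw [p.s2]; ring
      rw [this]
      linear_combination - 2 * s * e * p.e
    have g2 : 0 ≤ 2 * ρ * e * ((x-r*θ) * (1 - k^2 + 2*θ*k)) := by
      have : 0 ≤ 1 - k^2 + 2*θ*k := by nlinarith [mul_pos hθ hk]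
      positivity
    have g3 : 2*ρ*k^2*(r*θ) * e ≤ s * e := by gcongr
    have g4 : s * (1 - k * (x-r*θ)) ≤ s * e := by gcongr
    have g5 : (s * k) * (x-r*θ) ≤ 1 * (x-r*θ) := mul_le_mul_of_nonneg_right p.sk hy.le
    rw [g1]
    nlinarith
  · left
    have := h1 (r*θ) hX.le le_rfl
    simp only [sub_self, mul_zero, Real.exp_zero, mul_one]
    linarith



lemma ode_one {r b M : ℝ} (hr : 0 < r) {z zp R : ℝ → ℝ} (hd : ∀ x, 0 < x → HasDerivAt z (zp x) x)
    (heq : ∀ x, 0 < x → x * zp x + (r + b*x) * z x = R x)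
    (hlim : Tendsto (fun x => x^r * z x) (nhdsWithin 0 (Set.Ioi 0)) (nhds 0))
    (hR : ∀ x, 0 < x → R x ≤ M * (r + b*x)) : ∀ x, 0 < x → z x ≤ M := by
  intro x0 hx0
  have key : 0 ≤ (fun x => x^r * Real.exp (b*x) * (M - z x)) x0 := by
    apply nonneg_of_deriv_nonneg (g := fun x => x^r * Real.exp (b*x) * (M - z x)) (X := 0) (Y := x0) (g' := fun x => x^(r-1) * Real.exp (b*x) * (M * (r + b*x) - R x))
    · intro x hx _
      refine ((rpow_exp_deriv r b hx).mul ((hd x hx).const_sub M)).congr_deriv ?_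
      have hxr : x^r = x^(r-1) * x := by
        rw [Real.rpow_sub_one hx.ne']; field_simp
      rw [hxr]
      linear_combination (-x^(r-1) * Real.exp (b*x)) * heq x hx
    · intro x hx _
      have := hR x hx
      have : 0 ≤ M * (r + b*x) - R x := by linarith
      positivity
    · have h1 : Tendsto (fun x => Real.exp (b*x)) (nhdsWithin 0 (Set.Ioi 0)) (nhds 1) := by
        have : Continuous (fun x => Real.exp (b*x)) := by fun_prop
        have h := (this.tendsto 0).mono_left (nhdsWithin_le_nhds (s := Set.Ioi 0))
        simpa using h
      have := h1.mul (((rpow_zero_tendsto hr).const_mul M).sub hlim)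
      simp only [mul_zero, sub_zero] at this
      refine this.congr ?_
      intro x; ring
    · exact hx0
  have h1 : 0 < x0^r * Real.exp (b*x0) := by positivity
  by_contra hh
  push Not at hh
  have := mul_neg_of_pos_of_neg h1 (show M - z x0 < 0 by linarith)
  exact absurd key (not_le.mpr this)

lemma ode_two {r b M Λ : ℝ} (hr : 0 < r) (hb : 0 < b) {z zp R : ℝ → ℝ} (hd : ∀ x, 0 < x → HasDerivAt z (zp x) x)
    (heq : ∀ x, 0 < x → x * zp x + (r + b*x) * z x = R x)
    (hlim : Tendsto (fun x => x^r * z x) (nhdsWithin 0 (Set.Ioi 0)) (nhds 0))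
    (hR : ∀ x, 0 < x → |R x| ≤ M * (r + b*x)) (hRl : ∀ x y, 0 < x → 0 < y → |R x - R y| ≤ Λ * |x - y|) :
    ∀ x, 0 < x → zp x ≤ (Λ + b * M) / (r+1) := by
  intro x0 hx0
  have hM : 0 ≤ M := by
    have h1 := (abs_nonneg _).trans (hR 1 one_pos)
    have : 0 < r + b * 1 := by positivity
    by_contra hh
    push Not at hh
    have := mul_neg_of_neg_of_pos hh this
    linarith
  have hΛ : 0 ≤ Λ := by
    have h1 := (abs_nonneg _).trans (hRl 2 1 two_pos one_pos)
    norm_num at h1; exact h1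
  have hc0 : 0 ≤ Λ + b * M := by positivity
  have key : 0 ≤ (fun t => (Λ + b*M) * (t^r * Real.exp (b*t) * (x0 - t) + Real.exp (b*x0) * (t^(r+1) / (r+1)))
      - t^r * Real.exp (b*t) * (R x0 - (r + b*x0) * z t)) x0 := by
    apply nonneg_of_deriv_nonneg (g := fun t => (Λ + b*M) * (t^r * Real.exp (b*t) * (x0 - t) + Real.exp (b*x0) * (t^(r+1) / (r+1)))
      - t^r * Real.exp (b*t) * (R x0 - (r + b*x0) * z t)) (X := 0) (Y := x0) (g' := fun t => (Λ + b*M) * (t^(r-1) * Real.exp (b*t) * ((r + b*t) * (x0 - t)) + t^r * (Real.exp (b*x0) - Real.exp (b*t)))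
      - t^(r-1) * Real.exp (b*t) * ((r + b*t) * R x0 - (r + b*x0) * R t))
    · intro t ht _
      have hp : HasDerivAt (fun t : ℝ => t^(r+1) / (r+1)) (t^r) t := by
        refine ((Real.hasDerivAt_rpow_const (p := r+1) (Or.inl ht.ne')).div_const (r+1)).congr_deriv ?_
        rw [add_sub_cancel_right]; field_simp
      refine ((((rpow_exp_deriv r b ht).mul ((hasDerivAt_id t).const_sub x0)).add (hp.const_mul (Real.exp (b*x0)))).const_mul (Λ + b*M)).sub
        ((rpow_exp_deriv r b ht).mul (((hd t ht).const_mul (r + b*x0)).const_sub (R x0))) |>.congr_deriv ?_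
      have hxr : t^r = t^(r-1) * t := by
        rw [Real.rpow_sub_one ht.ne']; field_simp
      simp only [id]
      rw [hxr]
      linear_combination (t^(r-1) * Real.exp (b*t) * (r + b*x0)) * heq t ht
    · intro t ht ht0
      have h1 : (r + b*t) * R x0 - (r + b*x0) * R t ≤ (Λ + b*M) * ((r + b*t) * (x0 - t)) := by
        have h2 := hRl x0 t hx0 ht
        rw [abs_of_pos (show 0 < x0 - t by linarith)] at h2
        have h3 := (abs_le.mp h2).2
        have h4 := (abs_le.mp (hR t ht)).1
        have h5 : (r + b*t) * (R x0 - R t) ≤ (r + b*t) * (Λ * (x0 - t)) := mul_le_mul_of_nonneg_left h3 (by positivity)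
        have h6 : (b * (x0 - t)) * (-(R t)) ≤ (b * (x0 - t)) * (M * (r + b*t)) := by
          apply mul_le_mul_of_nonneg_left (by linarith)
          exact mul_nonneg hb.le (by linarith)
        nlinarith
      have h7 : 0 ≤ t^(r-1) * Real.exp (b*t) * ((Λ + b*M) * ((r + b*t) * (x0 - t)) - ((r + b*t) * R x0 - (r + b*x0) * R t)) := by
        have := sub_nonneg.mpr h1
        positivity
      have h8 : 0 ≤ (Λ + b*M) * (t^r * (Real.exp (b*x0) - Real.exp (b*t))) := by
        have : 0 ≤ Real.exp (b*x0) - Real.exp (b*t) := by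
          rw [sub_nonneg, Real.exp_le_exp]; nlinarith
        positivity
      linarith
    · have h1 : Tendsto (fun x => Real.exp (b*x)) (nhdsWithin 0 (Set.Ioi 0)) (nhds 1) := by
        have : Continuous (fun x => Real.exp (b*x)) := by fun_prop
        have h := (this.tendsto 0).mono_left (nhdsWithin_le_nhds (s := Set.Ioi 0))
        simpa using h
      have h2 : Tendsto (fun x : ℝ => x0 - x) (nhdsWithin 0 (Set.Ioi 0)) (nhds (x0 - 0)) :=
        (tendsto_id.mono_left nhdsWithin_le_nhds).const_sub x0
      have h3 := rpow_zero_tendsto hr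
      have h4 := rpow_zero_tendsto (show 0 < r+1 by linarith)
      have := ((((h3.mul h1).mul h2).add ((h4.div_const (r+1)).const_mul (Real.exp (b*x0)))).const_mul (Λ + b*M)).sub
        (h1.mul ((h3.mul_const (R x0)).sub (hlim.const_mul (r + b*x0))))
      simp only [zero_mul, mul_zero, zero_div, sub_zero, add_zero] at this
      refine this.congr ?_
      intro x; ring
    · exact hx0
  have hx1 : x0^(r+1) = x0^r * x0 := Real.rpow_add_one hx0.ne' r
  have h1 : 0 < x0^r * Real.exp (b*x0) * x0 := by positivity
  have h2 : x0^r * Real.exp (b*x0) * x0 * zp x0 ≤ x0^r * Real.exp (b*x0) * x0 * ((Λ + b * M) / (r+1)) := by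
    simp only [sub_self, hx1, mul_zero, zero_add] at key
    have h3 := heq x0 hx0
    have h4 : R x0 - (r + b*x0) * z x0 = x0 * zp x0 := by linarith
    rw [h4] at key
    have : (Λ + b * M) * (Real.exp (b*x0) * (x0^r * x0/(r+1))) = x0^r * Real.exp (b*x0) * x0 * ((Λ + b * M) / (r+1)) := by ring
    linarith
  exact le_of_mul_le_mul_left h2 h1

lemma bdC {r θ L s ρ k α : ℝ} {f f' H : ℝ → ℝ} (hL : 0 ≤ L) (p : PK r θ s ρ k)
    (h : HL r θ L s f f' H) (hα : α = √(1+θ^2)) (hf : ∀ x, 0 ≤ x → |f x| ≤ (2 + 2*ρ) * L) {m D : ℝ}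
    (hm : m = α * (3 + 3*ρ)) (hD : D = (α - θ) * (2 + 2*ρ) + m) :
    ∀ x, 0 < x → |(H x - (r + 2*θ*x) * f' x - (r*θ - x) * f x)/x| ≤
      ((1 + r*α*D + (α+θ)*m)/(r+1) + (α-θ)*D) * L := by
  have hr := p.r0
  have hs := p.s0
  have hρ1 := p.r1
  have hα0 : 0 < α := by rw [hα]; positivity
  have hα2 : α^2 = 1 + θ^2 := by rw [hα]; exact Real.sq_sqrt (by positivity)
  have hθα : |θ| < α := by
    rw [hα]; apply Real.lt_sqrt_of_sq_lt; rw [sq_abs]; linarith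
  obtain ⟨hθ1, hθ2⟩ := abs_lt.mp hθα
  set a := α - θ with ha
  set b := α + θ with hb
  have ha0 : 0 < a := by linarith
  have hb0 : 0 < b := by linarith
  have hab : a * b = 1 := by rw [ha, hb]; linear_combination hα2
  have hm0 : 0 < m := by rw [hm]; positivity
  have hD0 : 0 < D := by rw [hD]; positivity
  have hsr : s ≤ r * (α * ρ) := by
    apply abs_le_of_sq_le_sq' _ (by positivity) |>.2
    have : (r * (α * ρ))^2 = r * (ρ^2*r) * α^2 := by ring
    rw [this, p.s2, hα2]
    have := mul_le_mul_of_nonneg_left p.rr (show 0 ≤ r * (1 + θ^2) by positivity)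
    nlinarith
  have hR : ∀ x, 0 < x → |H x - r*α*f x| ≤ m * L * (r + b*x) := by
    intro x hx
    have h1 := h.hb x
    have h2 := hf x hx.le
    have h3 : |x - r*θ| ≤ x + r*|θ| := by
      calc |x - r*θ| ≤ |x| + |r*θ| := abs_sub _ _
        _ = x + r*|θ| := by rw [abs_mul, abs_of_pos hx, abs_of_pos hr]
    have h4 : |H x - r*α*f x| ≤ |H x| + r*α*|f x| := by
      calc |H x - r*α*f x| ≤ |H x| + |r*α*f x| := abs_sub _ _
        _ = _ := by rw [abs_mul (r*α), abs_of_pos (show 0 < r*α by positivity)]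
    have h5 : r*α*|f x| ≤ r*α*((2+2*ρ)*L) := by gcongr
    have h6 : L * (|x - r*θ| + s) ≤ L * (x + r*|θ| + r*(α*ρ)) := by gcongr
    have h7 : x ≤ m * b * x := by
      have : a * b ≤ m * b := by
        apply mul_le_mul_of_nonneg_right _ hb0.le
        rw [hm]; nlinarith
      nlinarith
    have h8 : r * (|θ| + α*ρ + α*(2+2*ρ)) ≤ r * m := by
      apply mul_le_mul_of_nonneg_left _ hr.le
      rw [hm]; nlinarith
    have h9 : L * (x + r*|θ| + r*(α*ρ) + r*α*(2+2*ρ)) ≤ L * (m * b * x + r * m) := by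
      apply mul_le_mul_of_nonneg_left _ hL
      linarith
    nlinarith
  have hzd : ∀ x, 0 < x → HasDerivAt (fun x => f' x - a * f x)
      ((H x - (r + 2*θ*x) * f' x - (r*θ - x) * f x)/x - a * f' x) x := fun x hx =>
    (h.dd x hx).sub ((h.d x hx).const_mul a)
  have heq : ∀ x, 0 < x → x * ((H x - (r + 2*θ*x) * f' x - (r*θ - x) * f x)/x - a * f' x) + (r + b*x) * (f' x - a * f x)
      = H x - r*α*f x := by
    intro x hx
    have h1 : x * ((H x - (r + 2*θ*x) * f' x - (r*θ - x) * f x)/x) = (H x - (r + 2*θ*x) * f' x - (r*θ - x) * f x) := by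
      field_simp
    have hb2 : b - a = 2 * θ := by rw [hb, ha]; ring
    have ha2 : a = α - θ := ha
    linear_combination h1 + x * f' x * hb2 - x * f x * hab - r * f x * ha2
  have hlim : Tendsto (fun x => x^r * (f' x - a * f x)) (nhdsWithin 0 (Set.Ioi 0)) (nhds 0) := by
    have h2 : Tendsto f (nhdsWithin 0 (Set.Ioi 0)) (nhds (f 0)) :=
      (h.cont 0 (by simp)).tendsto.mono_left (nhdsWithin_mono _ Set.Ioi_subset_Ici_self)
    have := h.z.sub ((rpow_zero_tendsto hr).mul (h2.const_mul a))
    rw [zero_mul, sub_zero] at this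
    refine this.congr ?_
    intro x; ring
  have heqn : ∀ x, 0 < x → x * (-((H x - (r + 2*θ*x) * f' x - (r*θ - x) * f x)/x - a * f' x)) + (r + b*x) * (-(f' x - a * f x))
      = -(H x - r*α*f x) := by
    intro x hx
    linear_combination - heq x hx
  have hlimn : Tendsto (fun x => x^r * (-(f' x - a * f x))) (nhdsWithin 0 (Set.Ioi 0)) (nhds 0) := by
    have := hlim.neg
    rw [neg_zero] at this
    refine this.congr ?_
    intro x; ring
  have hzb : ∀ x, 0 < x → |f' x - a * f x| ≤ m * L := by
    intro x hx
    rw [abs_le']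
    exact ⟨ode_one hr hzd heq hlim (fun x hx => (le_abs_self _).trans (hR x hx)) x hx,
      ode_one hr (fun x hx => (hzd x hx).neg) heqn hlimn (fun x hx => (neg_le_abs _).trans (hR x hx)) x hx⟩
  have hf'b : ∀ x, 0 < x → |f' x| ≤ D * L := by
    intro x hx
    have h1 : |f' x| ≤ |f' x - a * f x| + |a * f x| := by
      have := abs_add_le (f' x - a * f x) (a * f x)
      rwa [sub_add_cancel] at this
    rw [abs_mul, abs_of_pos ha0] at h1
    have h2 := mul_le_mul_of_nonneg_left (hf x hx.le) ha0.le
    have h3 := hzb x hx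
    rw [hD]
    nlinarith
  have hRl : ∀ x y, 0 < x → 0 < y → |(H x - r*α*f x) - (H y - r*α*f y)| ≤ ((1 + r*α*D)*L) * |x - y| := by
    intro x y hx hy
    have h1 := (convex_Ioi (0:ℝ)).norm_image_sub_le_of_norm_hasDerivWithin_le
      (fun t ht => (h.d t ht).hasDerivWithinAt) (fun t ht => hf'b t ht) (show y ∈ Set.Ioi (0:ℝ) from hy) (show x ∈ Set.Ioi (0:ℝ) from hx)
    rw [Real.norm_eq_abs, Real.norm_eq_abs] at h1
    have h2 := h.hl x y
    have h3 : |(H x - r*α*f x) - (H y - r*α*f y)| ≤ |H x - H y| + r*α*|f x - f y| := by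
      calc |(H x - r*α*f x) - (H y - r*α*f y)| = |(H x - H y) - (r*α)*(f x - f y)| := by ring_nf
        _ ≤ |H x - H y| + |(r*α)*(f x - f y)| := abs_sub _ _
        _ = _ := by rw [abs_mul (r*α), abs_of_pos (show 0 < r*α by positivity)]
    have h4 : r*α*|f x - f y| ≤ r*α*(D*L*|x-y|) := by gcongr
    nlinarith
  intro x hx
  have hz' : |(H x - (r + 2*θ*x) * f' x - (r*θ - x) * f x)/x - a * f' x| ≤ ((1 + r*α*D)*L + b*(m*L))/(r+1) := by
    rw [abs_le']
    refine ⟨ode_two hr hb0 hzd heq hlim hR hRl x hx,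
      ode_two hr hb0 (fun x hx => (hzd x hx).neg) heqn hlimn (fun x hx => by rw [abs_neg]; exact hR x hx) (fun x y hx hy => ?_) x hx⟩
    rw [show -(H x - r*α*f x) - -(H y - r*α*f y) = -((H x - r*α*f x) - (H y - r*α*f y)) by ring, abs_neg]
    exact hRl x y hx hy
  have h1 := abs_add_le ((H x - (r + 2*θ*x) * f' x - (r*θ - x) * f x)/x - a * f' x) (a * f' x)
  rw [sub_add_cancel, abs_mul a, abs_of_pos ha0] at h1
  have h2 := mul_le_mul_of_nonneg_left (hf'b x hx) ha0.le
  have h3 : ((1 + r*α*D + b*m)/(r+1) + a*D) * L = ((1 + r*α*D)*L + b*(m*L))/(r+1) + a * (D*L) := by ring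
  rw [h3]
  linarith



lemma htilde_neg (r θ : ℝ) (h : ℝ → ℝ) (t : ℝ) :
    htilde r (-θ) 1 (fun u => h (-u)) t = htilde r θ 1 h (-t) := by
  unfold htilde
  congr 1
  rw [← integral_neg_eq_self (fun t => h t * vgDensity r θ 1 t)]
  congr 1
  ext u
  rw [vg_neg]

lemma lip_neg {h : ℝ → ℝ} {L : ℝ} (hlip : ∀ u v : ℝ, |h u - h v| ≤ L * |u - v|) :
    ∀ u v : ℝ, |(fun u => h (-u)) u - (fun u => h (-u)) v| ≤ L * |u - v| := by
  intro u v
  have := hlip (-u) (-v)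
  rw [show -u - -v = -(u - v) by ring, abs_neg] at this
  exact this

lemma tail_neg (r θ : ℝ) (hr : 0 < r) {h : ℝ → ℝ} {L : ℝ} (hL : 0 ≤ L)
    (hlip : ∀ u v : ℝ, |h u - h v| ≤ L * |u - v|) (y : ℝ) :
    ∫ t in Set.Ioi (-y), htilde r θ 1 h t * vgDensity r θ 1 t =
      - ∫ t in Set.Ioi y, htilde r (-θ) 1 (fun u => h (-u)) t * vgDensity r (-θ) 1 t := by
  obtain ⟨hi, h0⟩ := htilde_mean r θ hr hL hlip
  have h1 : ∫ t in Set.Ioi y, htilde r (-θ) 1 (fun u => h (-u)) t * vgDensity r (-θ) 1 t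
      = ∫ t in Set.Iic (-y), htilde r θ 1 h t * vgDensity r θ 1 t := by
    rw [← integral_comp_neg_Ioi y (fun t => htilde r θ 1 h t * vgDensity r θ 1 t)]
    congr 1
    ext t
    rw [htilde_neg, vg_neg]
  have h2 := intervalIntegral.integral_Iic_add_Ioi (b := -y) hi.integrableOn hi.integrableOn
  rw [h1]
  linarith

lemma vg_K (r θ t : ℝ) (hr : 0 < r) :
    Real.exp ((θ / 1 ^ 2) * t) * |t| ^ ((r - 1) / 2) *
      besselK ((r - 1) / 2) (Real.sqrt (θ ^ 2 + 1 ^ 2) / 1 ^ 2 * |t|) =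
    (√π * Real.Gamma (r/2) * (2 * √(1+θ^2))^((r-1)/2)) * vgDensity r θ 1 t := by
  unfold vgDensity
  have e : θ^2 + 1^2 = 1 + θ^2 := by ring
  rw [e, Real.div_rpow (abs_nonneg t) (by positivity)]
  have h1 : 0 < Real.Gamma (r/2) := Real.Gamma_pos_of_pos (by positivity)
  have h2 : 0 < (2 * √(1+θ^2))^((r-1)/2) := by positivity
  have h3 : 0 < √π := by positivity
  simp only [one_pow, div_one, one_mul]
  field_simp

lemma stein_neg (r θ : ℝ) (hr : 0 < r) {h : ℝ → ℝ} {L : ℝ} (hL : 0 ≤ L)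
    (hlip : ∀ u v : ℝ, |h u - h v| ≤ L * |u - v|) (y : ℝ) :
    steinSolution r θ 1 h (-y) = - steinSolution r (-θ) 1 (fun u => h (-u)) y := by
  unfold steinSolution
  have e1 : (∫ t in (0:ℝ)..(-y), Real.exp ((θ / 1 ^ 2) * t) * |t| ^ ((r - 1) / 2) *
      besselI ((r - 1) / 2) (Real.sqrt (θ ^ 2 + 1 ^ 2) / 1 ^ 2 * |t|) * htilde r θ 1 h t)
      = - ∫ t in (0:ℝ)..y, Real.exp (((-θ) / 1 ^ 2) * t) * |t| ^ ((r - 1) / 2) *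
      besselI ((r - 1) / 2) (Real.sqrt ((-θ) ^ 2 + 1 ^ 2) / 1 ^ 2 * |t|) * htilde r (-θ) 1 (fun u => h (-u)) t := by
    have := intervalIntegral.integral_comp_neg (a := 0) (b := y) (fun t => Real.exp ((θ / 1 ^ 2) * t) * |t| ^ ((r - 1) / 2) *
      besselI ((r - 1) / 2) (Real.sqrt (θ ^ 2 + 1 ^ 2) / 1 ^ 2 * |t|) * htilde r θ 1 h t)
    rw [neg_zero] at this
    rw [intervalIntegral.integral_symm, ← this]
    congr 1
    apply intervalIntegral.integral_congr
    intro t _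
    simp only [abs_neg, htilde_neg, neg_sq]
    congr 4
    ring
  have e2 : ∀ (θ y : ℝ) (h : ℝ → ℝ), (∫ t in Set.Ioi y, Real.exp ((θ / 1 ^ 2) * t) * |t| ^ ((r - 1) / 2) *
      besselK ((r - 1) / 2) (Real.sqrt (θ ^ 2 + 1 ^ 2) / 1 ^ 2 * |t|) * htilde r θ 1 h t)
      = (√π * Real.Gamma (r/2) * (2 * √(1+θ^2))^((r-1)/2)) * ∫ t in Set.Ioi y, htilde r θ 1 h t * vgDensity r θ 1 t := by
    intro θ y h
    rw [← integral_const_mul]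
    congr 1
    ext t
    rw [vg_K r θ t hr]; ring
  rw [e1, e2, e2, tail_neg r θ hr hL hlip y]
  rw [abs_neg, neg_sq, show -(θ / 1^2) * (-y) = -(-θ/1^2) * y by ring]
  ring

lemma QQ_zero_neg (r θ : ℝ) (hr : 0 < r) {h : ℝ → ℝ} {L : ℝ} (hL : 0 ≤ L)
    (hlip : ∀ u v : ℝ, |h u - h v| ≤ L * |u - v|) :
    QQ r θ (cY2 r θ) (htilde r θ 1 h) 0 = - QQ r (-θ) (cY2 r (-θ)) (htilde r (-θ) 1 (fun u => h (-u))) 0 := by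
  obtain ⟨c, _, hc1, hc2, _⟩ := QQ_integrable r θ hr hL hlip
  obtain ⟨c', _, hc1', hc2', _⟩ := QQ_integrable r (-θ) hr hL (lip_neg hlip)
  have hcc : c' = c := by rw [hc2, hc2', neg_sq]
  unfold QQ
  rw [setIntegral_congr_fun measurableSet_Ioi (fun t ht => hc1 t ht),
    setIntegral_congr_fun measurableSet_Ioi (fun t ht => hc1' t ht), hcc, integral_const_mul, integral_const_mul]
  have := tail_neg r θ hr hL hlip 0
  rw [neg_zero] at this
  rw [this]; ring

noncomputable def fe (r θ : ℝ) (h : ℝ → ℝ) (x : ℝ) : ℝ :=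
  if x ≤ 0 then -(cY1 r θ 0 * QQ r θ (cY2 r θ) (htilde r θ 1 h) 0)
  else FF r θ (cY1 r θ) (cY2 r θ) (htilde r θ 1 h) x

lemma fe_HL (r θ : ℝ) (hr : 0 < r) {h : ℝ → ℝ} {L : ℝ} (hL : 0 ≤ L)
    (hlip : ∀ u v : ℝ, |h u - h v| ≤ L * |u - v|) :
    HL r θ L (√(r * (1 + 2*θ^2))) (fe r θ h)
      (FF' r θ (cY1 r θ) (cY1' r θ) (cY2 r θ) (cY2' r θ) (htilde r θ 1 h)) (htilde r θ 1 h) := by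
  have hB := cPair r θ hr
  have hH : Continuous (htilde r θ 1 h) := lip_continuous hL (htilde_lip r θ 1 hlip)
  obtain ⟨c, _, _, _, hQ⟩ := QQ_integrable r θ hr hL hlip
  have hα0 : 0 < √(1+θ^2) := by positivity
  have hα2 : √(1+θ^2)^2 = 1 + θ^2 := Real.sq_sqrt (by positivity)
  have hθα : |θ| < √(1+θ^2) := by
    apply Real.lt_sqrt_of_sq_lt; rw [sq_abs]; linarith
  have hev : ∀ x, 0 < x → fe r θ h =ᶠ[nhds x] FF r θ (cY1 r θ) (cY2 r θ) (htilde r θ 1 h) := by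
    intro x hx
    filter_upwards [Ioi_mem_nhds hx] with y hy
    have hy : 0 < y := hy
    simp [fe, not_le.mpr hy]
  have hfx : ∀ x, 0 < x → fe r θ h x = FF r θ (cY1 r θ) (cY2 r θ) (htilde r θ 1 h) x := fun x hx => (hev x hx).eq_of_nhds
  have hd : ∀ x, 0 < x → HasDerivAt (fe r θ h)
      (FF' r θ (cY1 r θ) (cY1' r θ) (cY2 r θ) (cY2' r θ) (htilde r θ 1 h) x) x := fun x hx =>
    (FF_hasDerivAt hr hB hH hQ hx).congr_of_eventuallyEq (hev x hx)
  refine ⟨?_, hd, ?_, FF'_zero hr hα0 hB hH hQ, ?_, htilde_bound r θ hr hL hlip, htilde_lip r θ 1 hlip⟩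
  · intro x hx
    rcases eq_or_lt_of_le (show 0 ≤ x from hx) with h0 | h0
    · rw [← h0]
      have h1 := FF_zero hr hα0 hB hH hQ
      rw [← continuousWithinAt_sdiff_self]
      have e : Set.Ici (0:ℝ) \ {0} = Set.Ioi 0 := Set.Ici_sdiff_left
      rw [e]
      unfold ContinuousWithinAt
      have e0 : fe r θ h 0 = -(cY1 r θ 0 * QQ r θ (cY2 r θ) (htilde r θ 1 h) 0) := by simp [fe]
      rw [e0]
      refine h1.congr' ?_
      filter_upwards [self_mem_nhdsWithin] with y hy
      exact (hfx y hy).symm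
    · exact (hd x h0).continuousAt.continuousWithinAt
  · intro x hx
    rw [hfx x hx]
    exact FF'_hasDerivAt hr hα2 hB hH hQ hx
  · have hC : 0 ≤ L * (1 + |r*θ| + √(r * (1 + 2*θ^2))) := by positivity
    obtain ⟨K, X0, hK⟩ := FF_growth hr hθα hB hH hQ hC (fun t ht => by
      refine (htilde_bound r θ hr hL hlip t).trans ?_
      rw [mul_assoc]
      apply mul_le_mul_of_nonneg_left _ hL
      have h1 : |t - r*θ| ≤ t + |r*θ| := by
        have := abs_sub t (r*θ)
        rwa [abs_of_pos ht] at this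
      have h2 : 0 ≤ t * (|r*θ| + √(r * (1 + 2*θ^2))) := by positivity
      nlinarith)
    refine ⟨K, max X0 1, fun x hx => ?_⟩
    have h1 : 0 < x := lt_of_lt_of_le one_pos ((le_max_right _ _).trans hx)
    rw [hfx x h1]
    exact hK x ((le_max_left _ _).trans hx)

lemma fe_zero_neg (r θ : ℝ) (hr : 0 < r) {h : ℝ → ℝ} {L : ℝ} (hL : 0 ≤ L)
    (hlip : ∀ u v : ℝ, |h u - h v| ≤ L * |u - v|) :
    |fe r θ h 0| = |fe r (-θ) (fun u => h (-u)) 0| := by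
  have e : cY1 r (-θ) 0 = cY1 r θ 0 := by simp [cY1]
  simp only [fe, le_refl, if_true]
  rw [QQ_zero_neg r θ hr hL hlip, e, mul_neg, abs_neg]

lemma fe_bound (r θ : ℝ) (hr : 0 < r) {h : ℝ → ℝ} {L ρ : ℝ} (hL : 0 ≤ L)
    (hlip : ∀ u v : ℝ, |h u - h v| ≤ L * |u - v|) (hρ : 1 ≤ ρ) (hρr : 2 ≤ ρ^2 * r) :
    ∀ x, 0 ≤ x → |fe r θ h x| ≤ (2 + 2*ρ) * L := by
  have pk : ∀ θ, PK r θ (√(r * (1 + 2*θ^2))) ρ (1/(ρ*√(r * (1 + 2*θ^2)))) := fun θ =>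
    PK_mk hr (by positivity) hρ (Real.sq_sqrt (by positivity)) hρr
  rcases le_or_gt θ 0 with hθ | hθ
  · intro x hx
    refine (bdA hL (pk θ) (fe_HL r θ hr hL hlip) hθ x hx).trans ?_
    nlinarith
  · apply bdB hL (pk θ) (fe_HL r θ hr hL hlip) hθ
    rw [fe_zero_neg r θ hr hL hlip]
    exact bdA hL (pk (-θ)) (fe_HL r (-θ) hr hL (lip_neg hlip)) (by linarith) 0 le_rfl

/-- F has a second derivative at x bounded by B -/
def SD (F : ℝ → ℝ) (x B : ℝ) : Prop :=
  ∃ f' : ℝ → ℝ, (∀ᶠ y in nhds x, HasDerivAt F (f' y) y) ∧ ∃ e, HasDerivAt f' e x ∧ |e| ≤ B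

/-- the explicit bound -/
noncomputable def Eb (r ρ θ : ℝ) : ℝ :=
  (1 + r * √(1+θ^2) * ((√(1+θ^2) + |θ|) * (2 + 2*ρ) + √(1+θ^2) * (3+3*ρ)) + (√(1+θ^2) + |θ|) * (√(1+θ^2) * (3+3*ρ)))/(r+1)
    + (√(1+θ^2) + |θ|) * ((√(1+θ^2) + |θ|) * (2 + 2*ρ) + √(1+θ^2) * (3+3*ρ))

lemma SD_pos (r θ : ℝ) (hr : 0 < r) {h : ℝ → ℝ} {L ρ : ℝ} (hL : 0 ≤ L)
    (hlip : ∀ u v : ℝ, |h u - h v| ≤ L * |u - v|) (hρ : 1 ≤ ρ) (hρr : 2 ≤ ρ^2 * r) {x : ℝ} (hx : 0 < x) :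
    SD (steinSolution r θ 1 h) x (Eb r ρ θ * L) := by
  have hHL := fe_HL r θ hr hL hlip
  refine ⟨_, ?_, _, hHL.dd x hx, ?_⟩
  · filter_upwards [Ioi_mem_nhds hx] with y hy
    have hy : 0 < y := hy
    refine (hHL.d y hy).congr_of_eventuallyEq ?_
    filter_upwards [Ioi_mem_nhds hy] with u hu
    have hu : 0 < u := hu
    rw [stein_eq_FF r θ h hu]
    simp [fe, not_le.mpr hu]
  · have pk : PK r θ (√(r * (1 + 2*θ^2))) ρ (1/(ρ*√(r * (1 + 2*θ^2)))) :=
      PK_mk hr (by positivity) hρ (Real.sq_sqrt (by positivity)) hρr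
    refine (bdC hL pk hHL rfl (fe_bound r θ hr hL hlip hρ hρr) rfl rfl x hx).trans ?_
    apply mul_le_mul_of_nonneg_right _ hL
    unfold Eb
    have hα0 : 0 < √(1+θ^2) := by positivity
    have h1 := le_abs_self θ
    have h2 := neg_le_abs θ
    have h3 := abs_nonneg θ
    have hθα : |θ| < √(1+θ^2) := by
      apply Real.lt_sqrt_of_sq_lt; rw [sq_abs]; linarith
    set α := √(1+θ^2)
    set κ := α + |θ|
    have g1 : α - θ ≤ κ := by simp only [κ]; linarith
    have g2 : α + θ ≤ κ := by simp only [κ]; linarith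
    have g0 : 0 ≤ α - θ := by linarith
    have g3 : 0 ≤ α + θ := by linarith
    have g4 : 0 ≤ κ := by linarith
    gcongr

lemma SD_neg {F G : ℝ → ℝ} {x B : ℝ} (hFG : ∀ y, F (-y) = - G y) (hG : SD G (-x) B) : SD F x B := by
  obtain ⟨f', h1, e, h2, h3⟩ := hG
  have hF : F = fun y => - G (-y) := by
    ext y; rw [← hFG, neg_neg]
  refine ⟨fun y => f' (-y), ?_, -e, ?_, by rwa [abs_neg]⟩
  · have ht : Tendsto (fun y : ℝ => -y) (nhds x) (nhds (-x)) := tendsto_neg x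
    filter_upwards [ht.eventually h1] with y hy
    rw [hF]
    refine ((HasDerivAt.comp y hy (hasDerivAt_neg y)).neg).congr_deriv ?_
    ring
  · refine (HasDerivAt.comp x h2 (hasDerivAt_neg x)).congr_deriv ?_
    ring

lemma SD_all (r θ : ℝ) (hr : 0 < r) {h : ℝ → ℝ} {L ρ : ℝ} (hL : 0 ≤ L)
    (hlip : ∀ u v : ℝ, |h u - h v| ≤ L * |u - v|) (hρ : 1 ≤ ρ) (hρr : 2 ≤ ρ^2 * r) {x : ℝ} (hx : x ≠ 0) :
    SD (steinSolution r θ 1 h) x (Eb r ρ θ * L) := by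
  rcases lt_or_gt_of_ne hx with hx | hx
  · apply SD_neg (stein_neg r θ hr hL hlip)
    have := SD_pos r (-θ) hr hL (lip_neg hlip) hρ hρr (x := -x) (by linarith)
    have e : Eb r ρ (-θ) = Eb r ρ θ := by simp [Eb]
    rwa [e] at this
  · exact SD_pos r θ hr hL hlip hρ hρr hx

lemma vg_scale (r θ : ℝ) {σ : ℝ} (hσ : 0 < σ) (u : ℝ) :
    σ * vgDensity r θ σ (σ * u) = vgDensity r (θ/σ) 1 u := by
  have e : √(θ^2 + σ^2) = σ * √((θ/σ)^2 + 1^2) := by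
    rw [show θ^2 + σ^2 = σ^2 * ((θ/σ)^2 + 1^2) by field_simp, Real.sqrt_mul (by positivity), Real.sqrt_sq hσ.le]
  unfold vgDensity
  rw [e, abs_mul, abs_of_pos hσ]
  have hw : 0 < √((θ/σ)^2 + 1^2) := by positivity
  set w := √((θ/σ)^2 + 1^2)
  have e1 : θ * (σ * u) / σ^2 = θ/σ * u / 1^2 := by field_simp
  have e2 : σ * |u| / (2 * (σ * w)) = |u| / (2*w) := by field_simp
  have e3 : σ * w * (σ * |u|) / σ^2 = w * |u| / 1^2 := by field_simp
  rw [e1, e2, e3]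
  have : σ * (σ * √π * Real.Gamma (r/2))⁻¹ = (1 * √π * Real.Gamma (r/2))⁻¹ := by
    rw [mul_assoc, mul_inv, one_mul, ← mul_assoc, mul_inv_cancel₀ hσ.ne', one_mul]
  rw [← this]; ring

lemma htilde_scale (r θ : ℝ) {σ : ℝ} (hσ : 0 < σ) (h : ℝ → ℝ) (u : ℝ) :
    htilde r θ σ h (σ * u) = htilde r (θ/σ) 1 (fun u => h (σ * u)) u := by
  unfold htilde
  congr 1
  have := Measure.integral_comp_mul_left (fun t => h t * vgDensity r θ σ t) σ
  rw [abs_of_pos (inv_pos.mpr hσ), smul_eq_mul] at this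
  have e : (∫ t, h t * vgDensity r θ σ t) = σ * ∫ t, h (σ * t) * vgDensity r θ σ (σ * t) := by
    rw [this, ← mul_assoc, mul_inv_cancel₀ hσ.ne', one_mul]
  rw [e, ← integral_const_mul]
  congr 1
  ext t
  rw [← vg_scale r θ hσ]; ring

lemma stein_scale (r θ : ℝ) {σ : ℝ} (hσ : 0 < σ) (h : ℝ → ℝ) (y : ℝ) :
    steinSolution r θ σ h (σ * y) = 1/σ * steinSolution r (θ/σ) 1 (fun u => h (σ * u)) y := by
  have e : √(θ^2 + σ^2) = σ * √((θ/σ)^2 + 1^2) := by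
    rw [show θ^2 + σ^2 = σ^2 * ((θ/σ)^2 + 1^2) by field_simp, Real.sqrt_mul (by positivity), Real.sqrt_sq hσ.le]
  unfold steinSolution
  rw [e]
  set w := √((θ/σ)^2 + 1^2)
  set ν := (r-1)/2
  have e1 : ∀ u, θ/σ^2 * (σ * u) = θ/σ/1^2 * u := fun u => by field_simp
  have e2 : ∀ u : ℝ, (|σ * u|)^ν = σ^ν * |u|^ν := fun u => by
    rw [abs_mul, abs_of_pos hσ, Real.mul_rpow hσ.le (abs_nonneg u)]
  have e3 : ∀ u, σ * w / σ^2 * |σ * u| = w / 1^2 * |u| := fun u => by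
    rw [abs_mul, abs_of_pos hσ]; field_simp
  have i1 : (∫ t in (0:ℝ)..(σ * y), Real.exp ((θ / σ ^ 2) * t) * |t| ^ ν *
      besselI ν (σ * w / σ ^ 2 * |t|) * htilde r θ σ h t)
      = σ * σ^ν * ∫ t in (0:ℝ)..y, Real.exp ((θ / σ / 1 ^ 2) * t) * |t| ^ ν *
      besselI ν (w / 1 ^ 2 * |t|) * htilde r (θ/σ) 1 (fun u => h (σ * u)) t := by
    have := intervalIntegral.mul_integral_comp_mul_left (a := 0) (b := y) (f := fun t => Real.exp ((θ / σ ^ 2) * t) * |t| ^ ν *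
      besselI ν (σ * w / σ ^ 2 * |t|) * htilde r θ σ h t) σ
    rw [mul_zero] at this
    rw [← this, mul_assoc, ← intervalIntegral.integral_const_mul (σ^ν)]
    congr 1
    apply intervalIntegral.integral_congr
    intro t _
    simp only [e1, e2, e3, htilde_scale r θ hσ]
    ring
  have i2 : (∫ t in Set.Ioi (σ * y), Real.exp ((θ / σ ^ 2) * t) * |t| ^ ν *
      besselK ν (σ * w / σ ^ 2 * |t|) * htilde r θ σ h t)
      = σ * σ^ν * ∫ t in Set.Ioi y, Real.exp ((θ / σ / 1 ^ 2) * t) * |t| ^ ν *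
      besselK ν (w / 1 ^ 2 * |t|) * htilde r (θ/σ) 1 (fun u => h (σ * u)) t := by
    have := integral_comp_mul_left_Ioi (fun t => Real.exp ((θ / σ ^ 2) * t) * |t| ^ ν *
      besselK ν (σ * w / σ ^ 2 * |t|) * htilde r θ σ h t) y hσ
    rw [smul_eq_mul] at this
    rw [← mul_right_inj' (inv_ne_zero hσ.ne'), ← this, mul_assoc, ← mul_assoc, inv_mul_cancel₀ hσ.ne', one_mul, ← integral_const_mul]
    congr 1
    ext t
    simp only [e1, e2, e3, htilde_scale r θ hσ]
    ring
  have e1' : -(θ/σ^2) * (σ * y) = -(θ/σ/1^2) * y := by field_simp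
  rw [i1, i2, e1', e2, e3]
  have hσν : 0 < σ^ν := by positivity
  have c1 : ∀ A J : ℝ, (A / (σ^2 * (σ^ν * |y|^ν))) * (σ * σ^ν * J) = 1/σ * (A / (1^2 * |y|^ν) * J) := by
    intro A J
    rw [← mul_assoc, one_pow, one_mul, ← div_div, ← div_div]
    field_simp
  rw [neg_mul, neg_mul, c1, c1]
  ring

lemma SD_scale {F G : ℝ → ℝ} {σ x B : ℝ} (hσ : 0 < σ) (hFG : ∀ y, F (σ * y) = 1/σ * G y) (hG : SD G (x/σ) B) :
    SD F x (1/σ^3 * B) := by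
  obtain ⟨f', h1, e, h2, h3⟩ := hG
  have hF : F = fun y => 1/σ * G (y/σ) := by
    ext y; rw [← hFG, mul_div_cancel₀ _ hσ.ne']
  have hdv : ∀ y, HasDerivAt (fun y : ℝ => y/σ) (1/σ) y := fun y => (hasDerivAt_id y).div_const σ
  refine ⟨fun y => 1/σ^2 * f' (y/σ), ?_, 1/σ^3 * e, ?_, ?_⟩
  · have ht : Tendsto (fun y : ℝ => y/σ) (nhds x) (nhds (x/σ)) := (hdv x).continuousAt
    filter_upwards [ht.eventually h1] with y hy
    rw [hF]
    refine ((HasDerivAt.comp y hy (hdv y)).const_mul (1/σ)).congr_deriv ?_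
    field_simp
  · refine ((HasDerivAt.comp x h2 (hdv x)).const_mul (1/σ^2)).congr_deriv ?_
    field_simp
  · rw [abs_mul, abs_of_pos (by positivity : 0 < 1/σ^3)]
    gcongr

lemma SD_main (r θ : ℝ) {σ : ℝ} (hr : 0 < r) (hσ : 0 < σ) {h : ℝ → ℝ} {L ρ : ℝ} (hL : 0 ≤ L)
    (hlip : ∀ u v : ℝ, |h u - h v| ≤ L * |u - v|) (hρ : 1 ≤ ρ) (hρr : 2 ≤ ρ^2 * r) {x : ℝ} (hx : x ≠ 0) :
    SD (steinSolution r θ σ h) x (1/σ^2 * Eb r ρ (θ/σ) * L) := by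
  have hl : ∀ u v : ℝ, |(fun u => h (σ * u)) u - (fun u => h (σ * u)) v| ≤ (σ * L) * |u - v| := by
    intro u v
    refine (hlip (σ*u) (σ*v)).trans_eq ?_
    rw [← mul_sub, abs_mul, abs_of_pos hσ]; ring
  have := SD_scale hσ (stein_scale r θ hσ h) (SD_all r (θ/σ) hr (by positivity) hl hρ hρr (x := x/σ) (div_ne_zero hx hσ.ne'))
  have e : 1/σ^3 * (Eb r ρ (θ/σ) * (σ * L)) = 1/σ^2 * Eb r ρ (θ/σ) * L := by field_simp
  rwa [e] at this

lemma SD_unique {F g : ℝ → ℝ} {x B d : ℝ} (hS : SD F x B) (hx : x ≠ 0)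
    (hg : ∀ᶠ y in nhds x, y ≠ 0 → HasDerivAt F (g y) y) (hd : HasDerivAt g d x) : |d| ≤ B := by
  obtain ⟨f', h1, e, h2, h3⟩ := hS
  have heq : g =ᶠ[nhds x] f' := by
    filter_upwards [hg, h1, isOpen_ne.mem_nhds hx] with y h4 h5 h6
    exact (h4 h6).unique h5
  have := (h2.congr_of_eventuallyEq heq).unique hd
  rwa [← this]



lemma Gamma_half {x : ℝ} (hx : 0 < x) (hx2 : x ≤ 2) : 1/2 ≤ Real.Gamma x := by
  have h1 : ∀ y : ℝ, 2 ≤ y → 1 ≤ Real.Gamma y := by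
    intro y hy
    have := Real.Gamma_strictMonoOn_Ici.monotoneOn (show (2:ℝ) ∈ Set.Ici 2 by simp) (show y ∈ Set.Ici (2:ℝ) from hy) hy
    rwa [Real.Gamma_two] at this
  rcases le_or_gt 1 x with h | h
  · have h2 := h1 (x+1) (by linarith)
    rw [Real.Gamma_add_one hx.ne'] at h2
    have := Real.Gamma_pos_of_pos hx
    nlinarith
  · have h2 := h1 (x+1+1) (by linarith)
    rw [Real.Gamma_add_one (by positivity), Real.Gamma_add_one hx.ne'] at h2
    have := Real.Gamma_pos_of_pos hx
    have h3 : (x+1) * x ≤ 2 := by nlinarith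
    nlinarith

lemma Aconst_nonneg (r θ σ : ℝ) (hr : 0 < r) : 0 ≤ Aconst r θ σ := by
  unfold Aconst
  have := Real.Gamma_pos_of_pos (show 0 < r/2 by positivity)
  split_ifs <;> positivity

lemma Cconst_ge (r θ σ : ℝ) (hr : 0 < r) (hσ : 0 < σ) :
    2 * (√(2*r) + r) * Aconst r θ σ ≤ Cconst r θ σ := by
  unfold Cconst
  have : 0 ≤ 6 + 2 * √2 / √r + 2 * √(2 * π * (r + 1)) * (|θ| / σ) * (1 + θ ^ 2 / σ ^ 2) ^ ((r - 1) / 2) := by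
    positivity
  linarith

lemma A_ge_one (r θ σ : ℝ) (hr : 0 < r) (hr2 : r < 2) : 1 ≤ Aconst (r+1) θ σ := by
  have hq : 1 ≤ 1 + θ^2/σ^2 := by
    have : 0 ≤ θ^2/σ^2 := by positivity
    linarith
  unfold Aconst
  split_ifs with h
  · have h1 : √(2*(r+1)-1) ≤ 2 * √π := by
      rw [show 2 * √π = √(4 * π) by rw [Real.sqrt_mul (by norm_num), show (4:ℝ) = 2^2 by norm_num, Real.sqrt_sq (by norm_num)]]
      apply Real.sqrt_le_sqrt
      linarith [Real.pi_gt_three]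
    have h0 : 0 < √(2*(r+1)-1) := Real.sqrt_pos.mpr (by linarith)
    have h2 : 1 ≤ 2 * √π / √(2*(r+1)-1) := by rwa [one_le_div h0]
    have h3 : 1 ≤ (1 + θ^2/σ^2)^((r+1)/2) := Real.one_le_rpow hq (by positivity)
    nlinarith
  · have := Gamma_half (x := (r+1)/2) (by positivity) (by linarith)
    nlinarith

lemma Eb_small (r ρ t : ℝ) (hr : 0 < r) (hρ : 1 ≤ ρ) : Eb r ρ t ≤ 21 * (1+t^2) * (1+ρ) := by
  have hr1 : 0 < r + 1 := by linarith
  have hα0 : 0 < √(1+t^2) := by positivity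
  have hα2 : √(1+t^2)^2 = 1 + t^2 := Real.sq_sqrt (by positivity)
  have hα1 : 1 ≤ √(1+t^2) := by
    rw [Real.one_le_sqrt]; nlinarith [sq_nonneg t]
  have huα : |t| ≤ √(1+t^2) := by
    apply Real.le_sqrt_of_sq_le; rw [sq_abs]; linarith
  have hu0 := abs_nonneg t
  unfold Eb
  have hκ0 : 0 ≤ √(1+t^2) + |t| := by linarith
  have hκ : √(1+t^2) + |t| ≤ 2*√(1+t^2) := by linarith
  generalize √(1+t^2) + |t| = κ at *
  generalize √(1+t^2) = α at *
  have hD : κ*(2+2*ρ) + α*(3+3*ρ) ≤ 7 * (α * (1+ρ)) := by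
    have : κ*(2+2*ρ) ≤ (2*α)*(2+2*ρ) := by gcongr
    linarith
  have hD0 : 0 ≤ κ*(2+2*ρ) + α*(3+3*ρ) := by positivity
  have g2 : κ*(α*(3+3*ρ)) ≤ (2*α)*(α*(3+3*ρ)) := by gcongr
  generalize κ*(2+2*ρ) + α*(3+3*ρ) = D at *
  have hαα : 1 ≤ α^2 := by nlinarith
  have h3 : (1 + r * α * D + κ*(α*(3+3*ρ)))/(r+1) ≤ 7 * (α^2 * (1+ρ)) := by
    rw [div_le_iff₀ hr1]
    have g1 : r * α * D ≤ r * α * (7 * (α * (1+ρ))) := by gcongr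
    have g3 : 1 ≤ α^2 * (1+ρ) := by nlinarith
    linarith
  have h4 : κ * D ≤ (2*α) * (7 * (α * (1+ρ))) := by gcongr
  have e : 21 * (1+t^2) * (1+ρ) = 21 * α^2 * (1+ρ) := by rw [hα2]
  rw [e]
  linarith

set_option maxHeartbeats 1000000 in
lemma final_const (r θ σ : ℝ) (hr : 0 < r) (hσ : 0 < σ) :
    ∃ ρ, 1 ≤ ρ ∧ 2 ≤ ρ^2 * r ∧ Eb r ρ (θ/σ) ≤ (2/(r+1) + Aconst (r+1) θ σ) * (1 + (2 + θ^2/σ^2) * Cconst r θ σ) := by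
  have hA0 := Aconst_nonneg r θ σ hr
  have hA1 := Aconst_nonneg (r+1) θ σ (by linarith)
  have hC := Cconst_ge r θ σ hr hσ
  have hC0 : 0 ≤ Cconst r θ σ := le_trans (by positivity) hC
  have hge : ∀ E, E ≤ Aconst (r+1) θ σ * ((2 + θ^2/σ^2) * Cconst r θ σ) →
      E ≤ (2/(r+1) + Aconst (r+1) θ σ) * (1 + (2 + θ^2/σ^2) * Cconst r θ σ) := by
    intro E hE
    have h1 : 0 ≤ 2/(r+1) := by positivity
    have h2 : 0 ≤ (2 + θ^2/σ^2) * Cconst r θ σ := by positivity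
    have h3 : 0 ≤ 2/(r+1) * (1 + (2 + θ^2/σ^2) * Cconst r θ σ) := by positivity
    nlinarith
  have hqe : θ^2/σ^2 = (θ/σ)^2 := by rw [div_pow]
  set t := θ/σ
  have hα0 : 0 < √(1+t^2) := by positivity
  have hα2 : √(1+t^2)^2 = 1 + t^2 := Real.sq_sqrt (by positivity)
  have hα1 : 1 ≤ √(1+t^2) := by
    rw [Real.one_le_sqrt]; nlinarith [sq_nonneg t]
  have hu2 : |t|^2 = t^2 := sq_abs t
  have hu0 := abs_nonneg t
  have huα : |t| ≤ √(1+t^2) := by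
    apply Real.le_sqrt_of_sq_le; rw [hu2]; linarith
  have hr1 : 0 < r + 1 := by linarith
  rcases le_or_gt 2 r with h2 | h2
  · refine ⟨1, le_rfl, by linarith, hge _ ?_⟩
    -- Eb bound
    have hE : Eb r 1 t ≤ (2 * √(1+t^2) + |t|) * (10 * √(1+t^2) + 4*|t|) := by
      unfold Eb
      set α := √(1+t^2)
      set u := |t|
      have hαu : α * u ≤ α^2 := by nlinarith
      have h3 : (1 + r * α * ((α + u) * (2+2*1) + α*(3+3*1)) + (α+u)*(α*(3+3*1)))/(r+1) ≤ α * (10*α+4*u) := by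
        rw [div_le_iff₀ hr1]
        nlinarith
      nlinarith
    have hE2 : Eb r 1 t ≤ 12 * (2 + t^2) * (1+t^2)^2 := by
      refine hE.trans ?_
      set α := √(1+t^2)
      set u := |t|
      have h4 : α * u ≤ α^2/6 + 3/2*u^2 := by nlinarith [sq_nonneg (α - 3*u)]
      nlinarith [sq_nonneg t, sq_nonneg (t^2), mul_nonneg (sq_nonneg t) (sq_nonneg (t^2))]
    refine hE2.trans ?_
    have hq1 : 1 ≤ 1 + t^2 := by nlinarith [sq_nonneg t]
    have p1 : 1 + t^2 ≤ (1+t^2)^((r+1)/2) := by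
      calc 1 + t^2 = (1+t^2)^(1:ℝ) := by rw [Real.rpow_one]
        _ ≤ _ := Real.rpow_le_rpow_of_exponent_le hq1 (by linarith)
    have p2 : 1 + t^2 ≤ (1+t^2)^(r/2) := by
      calc 1 + t^2 = (1+t^2)^(1:ℝ) := by rw [Real.rpow_one]
        _ ≤ _ := Real.rpow_le_rpow_of_exponent_le hq1 (by linarith)
    have w1 : 0 < √(2*(r+1)-1) := Real.sqrt_pos.mpr (by linarith)
    have w2 : 0 < √(2*r-1) := Real.sqrt_pos.mpr (by linarith)
    have a1 : 2 * √π / √(2*(r+1)-1) * (1+t^2) ≤ Aconst (r+1) θ σ := by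
      unfold Aconst
      rw [if_pos (by linarith), hqe]
      gcongr
    have a2 : 2 * √π / √(2*r-1) * (1+t^2) ≤ Aconst r θ σ := by
      unfold Aconst
      rw [if_pos h2, hqe]
      gcongr
    have c1 : 2 * r * (2 * √π / √(2*r-1) * (1+t^2)) ≤ Cconst r θ σ := by
      refine le_trans ?_ hC
      have : 2 * r ≤ 2 * (√(2*r) + r) := by
        have := Real.sqrt_nonneg (2*r); linarith
      gcongr
    have w3 : √(2*(r+1)-1) * √(2*r-1) ≤ 2*r := by
      rw [← Real.sqrt_mul (by linarith)]
      apply Real.sqrt_le_iff.mpr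
      constructor
      · linarith
      · nlinarith
    rw [hqe]
    calc 12 * (2+t^2) * (1+t^2)^2 ≤ (4 * π) * (2+t^2) * (1+t^2)^2 := by
          have := Real.pi_gt_three
          gcongr
          linarith
      _ ≤ (4 * π * (2*r / (√(2*(r+1)-1) * √(2*r-1)))) * (2+t^2) * (1+t^2)^2 := by
          have : 1 ≤ 2*r / (√(2*(r+1)-1) * √(2*r-1)) := by
            rwa [one_le_div (by positivity)]
          have hp := Real.pi_pos
          have : 4 * π ≤ 4 * π * (2*r / (√(2*(r+1)-1) * √(2*r-1))) := by nlinarith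
          gcongr
      _ = (2 * √π / √(2*(r+1)-1) * (1+t^2)) * ((2 + t^2) * (2 * r * (2 * √π / √(2*r-1) * (1+t^2)))) := by
          have hp : π = √π * √π := (Real.mul_self_sqrt Real.pi_pos.le).symm
          field_simp
          linear_combination 4 * hp
      _ ≤ _ := by gcongr
  · have hρ1 : 1 ≤ √(2/r) := by
      rw [Real.one_le_sqrt, one_le_div hr]; linarith
    have hρ2 : √(2/r)^2 = 2/r := Real.sq_sqrt (by positivity)
    refine ⟨√(2/r), hρ1, by rw [hρ2]; field_simp; exact le_rfl, hge _ ?_⟩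
    have hrρ : √(2*r) = r * √(2/r) := by
      rw [show 2 * r = r^2 * (2/r) by field_simp, Real.sqrt_mul (by positivity), Real.sqrt_sq hr.le]
    set ρ := √(2/r)
    have hE : Eb r ρ t ≤ 21 * (1+t^2) * (1+ρ) := Eb_small r ρ t hr hρ1
    refine hE.trans ?_
    have a1 := A_ge_one r θ σ hr h2
    have c1 : 24 * (1+ρ) * (1+t^2) ≤ Cconst r θ σ := by
      refine le_trans ?_ hC
      unfold Aconst
      rw [if_neg (by linarith), hqe, hrρ]
      have hG := Gamma_half (x := r/2+1) (by positivity) (by linarith)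
      rw [Real.Gamma_add_one (by positivity)] at hG
      have e : 2 * (r * ρ + r) * (12 * Real.Gamma (r/2) * (1+t^2)) = 48 * (r/2 * Real.Gamma (r/2)) * (1+ρ) * (1+t^2) := by ring
      rw [e]
      gcongr
      linarith
    rw [hqe]
    have h5 : 21 * (1+t^2) * (1+ρ) ≤ (2 + t^2) * Cconst r θ σ := by
      have : 0 ≤ (1+t^2) * (1+ρ) := by positivity
      nlinarith [mul_nonneg (sq_nonneg t) hC0]
    have h6 : 0 ≤ (2 + t^2) * Cconst r θ σ := by positivity
    exact h5.trans (le_mul_of_one_le_left h6 a1)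

theorem main_thm (r θ σ : ℝ) (hr : 0 < r) (hσ : 0 < σ)
    (h : ℝ → ℝ) (L : ℝ) (hL : 0 ≤ L) (hlip : ∀ u v : ℝ, |h u - h v| ≤ L * |u - v|) :
    ∀ x : ℝ, x ≠ 0 → ∀ g : ℝ → ℝ,
      (∀ᶠ y in nhds x, y ≠ 0 → HasDerivAt (steinSolution r θ σ h) (g y) y) →
      ∀ d : ℝ, HasDerivAt g d x →
      |d| ≤ (1 / σ ^ 2) * (2 / (r + 1) + Aconst (r + 1) θ σ) *
          (1 + (2 + θ ^ 2 / σ ^ 2) * Cconst r θ σ) * L := by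
  intro x hx g hg d hd
  obtain ⟨ρ, hρ, hρr, hE⟩ := final_const r θ σ hr hσ
  refine (SD_unique (SD_main r θ hr hσ hL hlip hρ hρr hx) hx hg hd).trans ?_
  apply mul_le_mul_of_nonneg_right _ hL
  rw [mul_assoc]
  gcongr


theorem stein_factor_f''_lipschitz (r θ σ : ℝ) (hr : 0 < r) (hσ : 0 < σ)
    (h : ℝ → ℝ) (L : ℝ) (hL : 0 ≤ L) (hlip : ∀ u v : ℝ, |h u - h v| ≤ L * |u - v|) :
    ∀ x : ℝ, x ≠ 0 → ∀ g : ℝ → ℝ,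
      (∀ᶠ y in nhds x, y ≠ 0 → HasDerivAt (steinSolution r θ σ h) (g y) y) →
      ∀ d : ℝ, HasDerivAt g d x →
      |d| ≤ (1 / σ ^ 2) * (2 / (r + 1) + Aconst (r + 1) θ σ) *
          (1 + (2 + θ ^ 2 / σ ^ 2) * Cconst r θ σ) * L := by
  
  exact main_thm r θ σ hr hσ h L hL hlip
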